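/- arXiv:2602.19374 — 5 statements merged into one kernel-verified Lean document; each statement's English description precedes it below -/
import Mathlib

section
/- Let n ≥ 1 be an integer and let g be a Schwartz function on ℝ. Then for every s ∈ ℝ and every ξ ∈ ℝ, ∫_{ℝ^{2n}} e^{i s Φⁿ(ξ,η)} g(ξ−η_{2n}) · conj g(η_{2n−1}−η_{2n}) · (∏_{i=1}^{n−1} g(η_{2i+1}−η_{2i}) · conj g(η_{2i−1}−η_{2i})) · g(η₁) dη = ∫_{ℝ^{2n}} e^{i s Ψⁿ(η)} 𝒩ⁿ[g](ξ,η) dη. -/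
noncomputable section

open MeasureTheory Real Finset
open scoped ENNReal

/-- `coordOf η j` is the `j`-th coordinate of `η` in 1-based indexing (`η_j`). -/
def coordOf {m : ℕ} (η : Fin m → ℝ) (j : ℕ) : ℝ :=
  if h : j - 1 < m then η ⟨j - 1, h⟩ else 0

/-- `Hᵢⁿ(ξ,η) = ξ − ∑_{k=i}^n η_{2k-1}`. -/
def Hf (n : ℕ) (ξ : ℝ) (η : Fin (2 * n) → ℝ) (i : ℕ) : ℝ :=
  ξ - ∑ k ∈ Finset.Icc i n, coordOf η (2 * k - 1)

/-- `Ψⁿ(η) = ∑_{i=1}^n η_{2i} η_{2i-1}`. -/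
def Psi (n : ℕ) (η : Fin (2 * n) → ℝ) : ℝ :=
  ∑ i ∈ Finset.Icc 1 n, coordOf η (2 * i) * coordOf η (2 * i - 1)

/-- The quadratic form `η · Qⁿ η = 2 Ψⁿ(η)` (where `Qⁿ` is block-diagonal with
blocks `[[0,1],[1,0]]`, so that `(Qⁿ)⁻¹ = Qⁿ`). -/
def Qform (n : ℕ) (η : Fin (2 * n) → ℝ) : ℝ := 2 * Psi n η

/-- The multilinear expression `𝒩ⁿ[g](ξ,η)`. -/
def Nn (n : ℕ) (g : ℝ → ℂ) (ξ : ℝ) (η : Fin (2 * n) → ℝ) : ℂ :=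
  g (ξ - coordOf η (2 * n)) * (starRingEnd ℂ) (g (Hf n ξ η n - coordOf η (2 * n))) *
  (∏ i ∈ Finset.Icc 1 (n - 1),
    g (Hf n ξ η (i + 1) - coordOf η (2 * i)) *
      (starRingEnd ℂ) (g (Hf n ξ η i - coordOf η (2 * i)))) *
  g (Hf n ξ η 1)

/-- The phase `Φⁿ(ξ,η)`. -/
def Phi (n : ℕ) (ξ : ℝ) (η : Fin (2 * n) → ℝ) : ℝ :=
  (1 / 2) * (ξ ^ 2 - (ξ - coordOf η (2 * n)) ^ 2 +
    (coordOf η (2 * n - 1) - coordOf η (2 * n)) ^ 2 +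
    (∑ i ∈ Finset.Icc 1 (n - 1),
      (-(coordOf η (2 * i + 1) - coordOf η (2 * i)) ^ 2 +
        (coordOf η (2 * i) - coordOf η (2 * i - 1)) ^ 2)) -
    (coordOf η 1) ^ 2)

/-- Inverse Fourier transform in `η ∈ ℝ^{2n}`: `(2π)^{-n} ∫ e^{iσ·η} h(η) dη`. -/
def invFTeta (n : ℕ) (h : (Fin (2 * n) → ℝ) → ℂ) (σ : Fin (2 * n) → ℝ) : ℂ :=
  ((((2 * Real.pi) ^ n)⁻¹ : ℝ) : ℂ) *
    ∫ η : Fin (2 * n) → ℝ, Complex.exp (Complex.I * ((∑ j, σ j * η j : ℝ) : ℂ)) * h η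


/-- Matrix of the linear part of the change of variables. -/
def cvM (n : ℕ) : Matrix (Fin (2 * n)) (Fin (2 * n)) ℝ := fun j k =>
  if j.val % 2 = 0 then (if j.val ≤ k.val ∧ k.val % 2 = 0 then -1 else 0)
  else (if j = k then 1 else 0)

/-- Translation part of the change of variables. -/
def cvC (n : ℕ) (ξ : ℝ) : Fin (2 * n) → ℝ := fun j => if j.val % 2 = 0 then ξ else 0

/-- The change of variables. -/
def cvT (n : ℕ) (ξ : ℝ) (η : Fin (2 * n) → ℝ) : Fin (2 * n) → ℝ :=
  cvC n ξ + Matrix.toLin' (cvM n) η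

lemma cvM_det (n : ℕ) : |(cvM n).det| = 1 := by
  rw [Matrix.det_of_upperTriangular, Finset.abs_prod]
  · apply Finset.prod_eq_one
    intro i _
    unfold cvM
    by_cases h : i.val % 2 = 0 <;> simp [h]
  · intro j k hjk
    have hjk' : k < j := hjk
    have h1 : ¬ (j.val ≤ k.val) := by
      have : k.val < j.val := hjk'
      omega
    have h2 : j ≠ k := ne_of_gt hjk'
    simp [cvM, h1, h2]

lemma cvM_det_ne (n : ℕ) : (cvM n).det ≠ 0 := by
  intro h
  have := cvM_det n
  simp [h] at this

lemma cvT_integral (n : ℕ) (ξ : ℝ) (F : (Fin (2 * n) → ℝ) → ℂ) :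
    ∫ η, F (cvT n ξ η) = ∫ η, F η := by
  have h1 : MeasurePreserving (Matrix.toLin' (cvM n)) volume volume := by
    refine ⟨(LinearMap.continuous_of_finiteDimensional _).measurable, ?_⟩
    rw [Real.map_matrix_volume_pi_eq_smul_volume_pi (cvM_det_ne n), abs_inv, cvM_det]
    simp
  have hinj : Function.Injective (Matrix.toLin' (cvM n)) := by
    have : IsUnit (cvM n) := by
      rw [Matrix.isUnit_iff_isUnit_det]
      exact (cvM_det_ne n).isUnit
    exact Matrix.mulVec_injective_iff_isUnit.mpr this
  have h2 : MeasurableEmbedding (Matrix.toLin' (cvM n)) :=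
    (LinearMap.isClosedEmbedding_of_injective (LinearMap.ker_eq_bot.mpr hinj)).measurableEmbedding
  unfold cvT
  rw [h1.integral_comp h2 (fun y => F (cvC n ξ + y))]
  exact integral_add_left_eq_self F (cvC n ξ)

lemma cvT_even (n : ℕ) (ξ : ℝ) (η : Fin (2 * n) → ℝ) (i : ℕ) (h1 : 1 ≤ i) (h2 : i ≤ n) :
    coordOf (cvT n ξ η) (2 * i) = coordOf η (2 * i) := by
  have h : 2 * i - 1 < 2 * n := by omega
  have h' : (2 * i - 1) % 2 = 1 := by omega
  simp [coordOf, h, cvT, cvC, h', cvM, Matrix.mulVec, dotProduct]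

lemma cvT_odd (n : ℕ) (ξ : ℝ) (η : Fin (2 * n) → ℝ) (i : ℕ) (h1 : 1 ≤ i) (h2 : i ≤ n) :
    coordOf (cvT n ξ η) (2 * i - 1) = Hf n ξ η i := by
  have h : 2 * i - 1 - 1 < 2 * n := by omega
  have h' : (2 * i - 1 - 1) % 2 = 0 := by omega
  rw [coordOf, dif_pos h]
  simp only [cvT, cvC, cvM, Pi.add_apply, h', if_true, Matrix.toLin'_apply, Matrix.mulVec,
    dotProduct, Hf, ite_mul, zero_mul, neg_mul, one_mul]
  rw [sub_eq_add_neg, ← Finset.sum_filter, Finset.sum_neg_distrib]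
  congr 2
  symm
  refine Finset.sum_bij' (fun k hk => ⟨2 * k - 1 - 1, by
      have := Finset.mem_Icc.mp hk; omega⟩) (fun k _ => k.val / 2 + 1) ?_ ?_ ?_ ?_ ?_
  · intro k hk
    have := Finset.mem_Icc.mp hk
    simp only [Finset.mem_filter, Finset.mem_univ, true_and]
    omega
  · intro k hk
    simp only [Finset.mem_filter, Finset.mem_univ, true_and] at hk
    have := k.isLt
    rw [Finset.mem_Icc]
    omega
  · intro k hk
    have := Finset.mem_Icc.mp hk
    simp only
    omega
  · intro k hk
    simp only [Finset.mem_filter, Finset.mem_univ, true_and] at hk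
    ext
    simp only
    omega
  · intro k hk
    have := Finset.mem_Icc.mp hk
    rw [coordOf, dif_pos]

lemma Hf_succ (n : ℕ) (ξ : ℝ) (η : Fin (2 * n) → ℝ) (i : ℕ) (h2 : i ≤ n) :
    coordOf η (2 * i - 1) = Hf n ξ η (i + 1) - Hf n ξ η i := by
  unfold Hf
  rw [← Finset.add_sum_Ioc_eq_sum_Icc h2]
  have : Finset.Icc (i + 1) n = Finset.Ioc i n := by ext; simp [Nat.succ_le_iff]
  rw [this]
  ring

lemma phase_alg (n : ℕ) (H e : ℕ → ℝ) :
    (1 / 2) * (H (n + 1 + 1) ^ 2 - (H (n + 1 + 1) - e (n + 1)) ^ 2 +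
    (H (n + 1) - e (n + 1)) ^ 2 +
    (∑ i ∈ Finset.Icc 1 n, (-(H (i + 1) - e i) ^ 2 + (e i - H i) ^ 2)) - (H 1) ^ 2)
    = ∑ i ∈ Finset.Icc 1 (n + 1), e i * (H (i + 1) - H i) := by
  induction n with
  | zero => simp; ring
  | succ n ih =>
    rw [Finset.sum_Icc_succ_top (by omega), Finset.sum_Icc_succ_top (by omega), ← ih]
    ring

lemma Phi_cvT (n : ℕ) (hn : 1 ≤ n) (ξ : ℝ) (η : Fin (2 * n) → ℝ) :
    Phi n ξ (cvT n ξ η) = Psi n η := by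
  obtain ⟨m, rfl⟩ : ∃ m, n = m + 1 := ⟨n - 1, by omega⟩
  have hξ : Hf (m + 1) ξ η (m + 1 + 1) = ξ := by simp [Hf]
  have key := phase_alg m (Hf (m + 1) ξ η) (fun i => coordOf η (2 * i))
  rw [hξ] at key
  have hR : Psi (m + 1) η = ∑ i ∈ Finset.Icc 1 (m + 1),
      coordOf η (2 * i) * (Hf (m + 1) ξ η (i + 1) - Hf (m + 1) ξ η i) := by
    unfold Psi
    refine Finset.sum_congr rfl fun i hi => ?_
    rw [Hf_succ (m + 1) ξ η i (Finset.mem_Icc.mp hi).2]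
  rw [hR, ← key]
  unfold Phi
  have e1 := cvT_odd (m + 1) ξ η 1 le_rfl (by omega)
  rw [show 2 * 1 - 1 = 1 from rfl] at e1
  rw [cvT_even (m + 1) ξ η (m + 1) hn le_rfl, cvT_odd (m + 1) ξ η (m + 1) hn le_rfl, e1,
    show m + 1 - 1 = m from rfl]
  have hs : ∀ i ∈ Finset.Icc 1 m,
      (-(coordOf (cvT (m + 1) ξ η) (2 * i + 1) - coordOf (cvT (m + 1) ξ η) (2 * i)) ^ 2 +
        (coordOf (cvT (m + 1) ξ η) (2 * i) - coordOf (cvT (m + 1) ξ η) (2 * i - 1)) ^ 2) =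
      (-(Hf (m + 1) ξ η (i + 1) - coordOf η (2 * i)) ^ 2 +
        (coordOf η (2 * i) - Hf (m + 1) ξ η i) ^ 2) := by
    intro i hi
    have hi' := Finset.mem_Icc.mp hi
    rw [cvT_even (m + 1) ξ η i (by omega) (by omega), cvT_odd (m + 1) ξ η i (by omega) (by omega),
      show 2 * i + 1 = 2 * (i + 1) - 1 by omega,
      cvT_odd (m + 1) ξ η (i + 1) (by omega) (by omega)]
  rw [Finset.sum_congr rfl hs]

/-- the change of variables removing `ξ` from the phase. -/
theorem statement2 (n : ℕ) (hn : 1 ≤ n) (g : SchwartzMap ℝ ℂ) (s ξ : ℝ) :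
    (∫ η : Fin (2 * n) → ℝ,
      Complex.exp (Complex.I * ((s * Phi n ξ η : ℝ) : ℂ)) *
        (g (ξ - coordOf η (2 * n)) *
          (starRingEnd ℂ) (g (coordOf η (2 * n - 1) - coordOf η (2 * n))) *
          (∏ i ∈ Finset.Icc 1 (n - 1),
            g (coordOf η (2 * i + 1) - coordOf η (2 * i)) *
              (starRingEnd ℂ) (g (coordOf η (2 * i - 1) - coordOf η (2 * i)))) *
          g (coordOf η 1))) =
    ∫ η : Fin (2 * n) → ℝ,
      Complex.exp (Complex.I * ((s * Psi n η : ℝ) : ℂ)) * Nn n (fun y => g y) ξ η := by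
  rw [← cvT_integral n ξ]
  congr 1
  funext η
  have e1 := cvT_odd n ξ η 1 le_rfl hn
  rw [show 2 * 1 - 1 = 1 from rfl] at e1
  rw [Phi_cvT n hn, cvT_even n ξ η n hn le_rfl, cvT_odd n ξ η n hn le_rfl, e1]
  unfold Nn
  congr 3
  refine Finset.prod_congr rfl fun i hi => ?_
  have hi' := Finset.mem_Icc.mp hi
  rw [cvT_even n ξ η i (by omega) (by omega), cvT_odd n ξ η i (by omega) (by omega),
    show 2 * i + 1 = 2 * (i + 1) - 1 by omega, cvT_odd n ξ η (i + 1) (by omega) (by omega)]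
end
end

section
/- Let n ≥ 1 and N ≥ 0 be integers and let g be a Schwartz function on ℝ. Then for every t > 0 and ξ ∈ ℝ, (2π)^{-n} ∫_{ℝ^{2n}} e^{i t Ψⁿ(η)} 𝒩ⁿ[g](ξ,η) dη = Σ_{k=0}^{N} t^{-k-n} 𝔓ⁿ_k(ξ) + Rⁿ_{N+1}(t,ξ), where 𝔓ⁿ_k(ξ) = (i^k/k!) Σ_{m ∈ ℕⁿ, |m| = k} (k!/(m₁!⋯mₙ!)) · (∏_{j=1}^n ∂_{η_{2j-1}}^{m_j} ∂_{η_{2j}}^{m_j}) 𝒩ⁿ[g](ξ,η) evaluated at η = 0, and Rⁿ_{N+1}(t,ξ) = (2π)^{-n} t^{-n} ∫_{ℝ^{2n}} (e^{-i η·Qⁿη/(2t)} − Σ_{j=0}^{N} (−i η·Qⁿη)^j/((2t)^j j!)) · ℱ_η^{-1}[𝒩ⁿ[g](ξ,·)](η) dη. -/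
noncomputable section

open MeasureTheory Real Finset
open scoped ENNReal

/-- Partial derivative of `F` in the coordinate direction `c`. -/
def pderiv' {m : ℕ} (c : Fin m) (F : (Fin m → ℝ) → ℂ) : (Fin m → ℝ) → ℂ :=
  fun η => fderiv ℝ F η (Pi.single c 1)

/-- Iterated partial derivatives along a list of coordinate directions. -/
def pderivIter {m : ℕ} : List (Fin m) → ((Fin m → ℝ) → ℂ) → ((Fin m → ℝ) → ℂ)
  | [], F => F
  | c :: cs, F => pderiv' c (pderivIter cs F)

/-- The list of coordinate directions encoding `∏_{j=1}^n ∂_{η_{2j-1}}^{m_j} ∂_{η_{2j}}^{m_j}`. -/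
def derivList (n : ℕ) (mv : Fin n → ℕ) : List (Fin (2 * n)) :=
  (List.finRange n).flatMap fun j =>
    List.replicate (mv j) (⟨2 * j.val, by have := j.isLt; omega⟩ : Fin (2 * n)) ++
      List.replicate (mv j) (⟨2 * j.val + 1, by have := j.isLt; omega⟩ : Fin (2 * n))

/-- The stationary phase coefficient
`𝔓ⁿ_k(ξ) = (i^k/k!) ∑_{|m|=k} (k!/(m₁!⋯mₙ!)) ∏_j ∂_{η_{2j-1}}^{m_j}∂_{η_{2j}}^{m_j} 𝒩ⁿ[g](ξ,0)`. -/
def Pfrak (n : ℕ) (g : ℝ → ℂ) (k : ℕ) (ξ : ℝ) : ℂ :=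
  (Complex.I ^ k / (k.factorial : ℂ)) *
    ∑ mv ∈ Finset.Nat.antidiagonalTuple n k,
      ((Nat.multinomial Finset.univ mv : ℕ) : ℂ) *
        pderivIter (derivList n mv) (fun η => Nn n g ξ η) 0

/-- The stationary-phase remainder `Rⁿ_r(t,ξ)` (with Taylor sum `∑_{j=0}^{r-1}`). -/
def Rrem (n : ℕ) (g : ℝ → ℂ) (r : ℕ) (t ξ : ℝ) : ℂ :=
  ((((2 * Real.pi) ^ n)⁻¹ : ℝ) : ℂ) * (((t ^ n : ℝ)⁻¹ : ℝ) : ℂ) *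
    ∫ η : Fin (2 * n) → ℝ,
      (Complex.exp (-Complex.I * ((Qform n η / (2 * t) : ℝ) : ℂ)) -
        ∑ j ∈ Finset.range r,
          (-Complex.I * ((Qform n η : ℝ) : ℂ)) ^ j /
            (((2 * t : ℝ) : ℂ) ^ j * (j.factorial : ℂ))) *
      invFTeta n (fun σ => Nn n g ξ σ) η


open scoped ContDiff

/-- Smooth functions whose derivatives decay faster than any power of `1 + ρ`. -/
def DecayCls {E : Type*} [NormedAddCommGroup E] [NormedSpace ℝ E] (ρ : E → ℝ) (f : E → ℂ) : Prop :=
  ContDiff ℝ ∞ f ∧ ∀ K k : ℕ, ∃ C : ℝ, ∀ x, (1 + ρ x) ^ K * ‖iteratedFDeriv ℝ k f x‖ ≤ C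

lemma DecayCls.mul {E : Type*} [NormedAddCommGroup E] [NormedSpace ℝ E] {ρ₁ ρ₂ : E → ℝ}
    {f₁ f₂ : E → ℂ} (h₁ : DecayCls ρ₁ f₁) (h₂ : DecayCls ρ₂ f₂)
    (hρ₁ : ∀ x, 0 ≤ ρ₁ x) (hρ₂ : ∀ x, 0 ≤ ρ₂ x) :
    DecayCls (fun x => ρ₁ x + ρ₂ x) (fun x => f₁ x * f₂ x) := by
  refine ⟨h₁.1.mul h₂.1, fun K k => ?_⟩
  choose C₁ hC₁ using h₁.2 K
  choose C₂ hC₂ using h₂.2 K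
  refine ⟨∑ i ∈ Finset.range (k + 1), (k.choose i : ℝ) * (C₁ i * C₂ (k - i)), fun x => ?_⟩
  have hb := norm_iteratedFDeriv_mul_le (𝕜 := ℝ) h₁.1 h₂.1 x (n := k)
    (by exact_mod_cast le_top)
  have h1 := hρ₁ x
  have h2 := hρ₂ x
  have hK : (1 + (ρ₁ x + ρ₂ x)) ^ K ≤ (1 + ρ₁ x) ^ K * (1 + ρ₂ x) ^ K := by
    rw [← mul_pow]
    apply pow_le_pow_left₀ (by positivity)
    nlinarith [mul_nonneg h1 h2]
  calc _ ≤ ((1 + ρ₁ x) ^ K * (1 + ρ₂ x) ^ K) * _ := by gcongr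
    _ ≤ ((1 + ρ₁ x) ^ K * (1 + ρ₂ x) ^ K) * _ := by
      apply mul_le_mul_of_nonneg_left hb (by positivity)
    _ ≤ _ := by
      rw [Finset.mul_sum]
      apply Finset.sum_le_sum
      intro i hi
      have e : (1 + ρ₁ x) ^ K * (1 + ρ₂ x) ^ K * ((k.choose i : ℝ) * ‖iteratedFDeriv ℝ i f₁ x‖ *
        ‖iteratedFDeriv ℝ (k - i) f₂ x‖) = (k.choose i : ℝ) *
        (((1 + ρ₁ x) ^ K * ‖iteratedFDeriv ℝ i f₁ x‖) *
          ((1 + ρ₂ x) ^ K * ‖iteratedFDeriv ℝ (k - i) f₂ x‖)) := by ring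
      rw [e]
      apply mul_le_mul_of_nonneg_left _ (by positivity)
      apply mul_le_mul (hC₁ i x) (hC₂ _ x) (by positivity)
      exact le_trans (by positivity) (hC₁ i x)

lemma DecayCls.prod {E ι : Type*} [NormedAddCommGroup E] [NormedSpace ℝ E] {ρ : ι → E → ℝ}
    {f : ι → E → ℂ} (s : Finset ι) (h : ∀ i, DecayCls (ρ i) (f i)) (hρ : ∀ i x, 0 ≤ ρ i x) :
    DecayCls (fun x => ∑ i ∈ s, ρ i x) (fun x => ∏ i ∈ s, f i x) := by
  classical
  induction s using Finset.induction_on with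
  | empty =>
    refine ⟨by simpa using contDiff_const, fun K k => ?_⟩
    simp only [Finset.sum_empty, Finset.prod_empty]
    rcases k with _ | k
    · exact ⟨1, fun x => by simp⟩
    · exact ⟨0, fun x => by simp [iteratedFDeriv_const_of_ne (𝕜 := ℝ) (Nat.succ_ne_zero k)]⟩
  | insert a s ha ih =>
    have := (h a).mul ih (hρ a) (fun x => Finset.sum_nonneg fun i _ => hρ i x)
    simpa [Finset.sum_insert ha, Finset.prod_insert ha] using this

lemma DecayCls.base {E : Type*} [NormedAddCommGroup E] [NormedSpace ℝ E] (G : SchwartzMap ℝ ℂ)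
    (c : ℝ) (l : E →L[ℝ] ℝ) : DecayCls (fun x => |c - l x|) (fun x => G (c - l x)) := by
  have hG : ContDiff ℝ ∞ (fun y => G (c + y)) := (G.smooth ⊤).comp (by fun_prop)
  have he : (fun x => G (c - l x)) = (fun y => G (c + y)) ∘ (-l) := by
    ext x; simp [sub_eq_add_neg]
  refine ⟨?_, fun K k => ?_⟩
  · rw [he]; exact hG.comp (-l).contDiff
  · refine ⟨‖-l‖ ^ k * (2 ^ K * ((Finset.Iic (K, k)).sup fun m => SchwartzMap.seminorm ℝ m.1 m.2) G),
      fun x => ?_⟩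
    rw [he, ContinuousLinearMap.iteratedFDeriv_comp_right (-l) hG x (by exact_mod_cast le_top),
      iteratedFDeriv_comp_add_left]
    have h1 := ContinuousMultilinearMap.norm_compContinuousLinearMap_le
      (iteratedFDeriv ℝ k (⇑G) (c + (-l) x)) (fun _ => -l)
    simp only [Finset.prod_const, Finset.card_univ, Fintype.card_fin] at h1
    have h2 := SchwartzMap.one_add_le_sup_seminorm_apply (𝕜 := ℝ) (m := (K, k)) le_rfl le_rfl G
      (c + (-l) x)
    have h3 : |c - l x| = ‖c + (-l) x‖ := by simp [sub_eq_add_neg]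
    simp only [h3]
    refine (mul_le_mul_of_nonneg_left h1 (by positivity)).trans ?_
    calc _ = ‖-l‖ ^ k * ((1 + ‖c + (-l) x‖) ^ K * ‖iteratedFDeriv ℝ k (⇑G) (c + (-l) x)‖) := by ring
      _ ≤ _ := mul_le_mul_of_nonneg_left h2 (by positivity)

lemma DecayCls.schwartz {E : Type*} [NormedAddCommGroup E] [NormedSpace ℝ E] {ρ : E → ℝ}
    {f : E → ℂ} (h : DecayCls ρ f) (hρ0 : ∀ x, 0 ≤ ρ x)
    (hρ : (fun x : E => x) =O[⊤] (fun x => 1 + ρ x)) :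
    ∃ F : SchwartzMap E ℂ, ∀ x, F x = f x := by
  refine ⟨⟨f, h.1, fun k m => ?_⟩, fun x => rfl⟩
  obtain ⟨A, hA0, hA⟩ := hρ.exists_nonneg
  obtain ⟨C, hC⟩ := h.2 k m
  rw [Asymptotics.isBigOWith_top] at hA
  refine ⟨A ^ k * C, fun x => ?_⟩
  have hx := hA x
  have hp := hρ0 x
  rw [Real.norm_of_nonneg (by positivity)] at hx
  calc _ ≤ (A * (1 + ρ x)) ^ k * ‖iteratedFDeriv ℝ m f x‖ := by gcongr
    _ = A ^ k * ((1 + ρ x) ^ k * ‖iteratedFDeriv ℝ m f x‖) := by rw [mul_pow]; ring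
    _ ≤ _ := mul_le_mul_of_nonneg_left (hC x) (by positivity)

/-- Coordinates as continuous linear maps. -/
def coordL (m : ℕ) (j : ℕ) : EuclideanSpace ℝ (Fin m) →L[ℝ] ℝ :=
  if h : j - 1 < m then EuclideanSpace.proj ⟨j - 1, h⟩ else 0

lemma coordL_apply (m j : ℕ) (x : EuclideanSpace ℝ (Fin m)) :
    coordL m j x = coordOf (fun i => x i) j := by
  unfold coordL coordOf
  split_ifs <;> simp

/-- The sums appearing in `Hf`. -/
def sumL (n : ℕ) (i : ℕ) : EuclideanSpace ℝ (Fin (2 * n)) →L[ℝ] ℝ :=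
  ∑ k ∈ Finset.Icc i n, coordL (2 * n) (2 * k - 1)

lemma Hf_eq (n : ℕ) (ξ : ℝ) (x : EuclideanSpace ℝ (Fin (2 * n))) (i : ℕ) :
    Hf n ξ (fun i => x i) i = ξ - sumL n i x := by
  simp [Hf, sumL, coordL_apply]

/-- The total weight. -/
def rhoT (n : ℕ) (ξ : ℝ) (x : EuclideanSpace ℝ (Fin (2 * n))) : ℝ :=
  |ξ - coordL (2 * n) (2 * n) x| + |ξ - (sumL n n + coordL (2 * n) (2 * n)) x| +
  (∑ i ∈ Finset.Icc 1 (n - 1),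
    (|ξ - (sumL n (i + 1) + coordL (2 * n) (2 * i)) x| +
      |ξ - (sumL n i + coordL (2 * n) (2 * i)) x|)) + |ξ - sumL n 1 x|

lemma rhoT_nonneg (n : ℕ) (ξ : ℝ) (x : EuclideanSpace ℝ (Fin (2 * n))) : 0 ≤ rhoT n ξ x := by
  unfold rhoT; positivity

lemma decay_Nn (n : ℕ) (g : SchwartzMap ℝ ℂ) (ξ : ℝ) :
    DecayCls (rhoT n ξ) (fun x : EuclideanSpace ℝ (Fin (2 * n)) => Nn n (fun y => g y) ξ (fun i => x i)) := by
  let gc : SchwartzMap ℝ ℂ := SchwartzMap.postcompCLM (𝕜 := ℝ) (Complex.conjCLE : ℂ →L[ℝ] ℂ) g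
  have hgc : ∀ y, gc y = (starRingEnd ℂ) (g y) := fun y => by
    simp [gc, SchwartzMap.postcompCLM_apply]
  have hb := fun (G : SchwartzMap ℝ ℂ) l => DecayCls.base (E := EuclideanSpace ℝ (Fin (2 * n))) G ξ l
  have := (((hb g (coordL (2 * n) (2 * n))).mul (hb gc (sumL n n + coordL (2 * n) (2 * n)))
    (fun x => abs_nonneg _) (fun x => abs_nonneg _)).mul
    (DecayCls.prod (Finset.Icc 1 (n - 1)) (fun i =>
      (hb g (sumL n (i + 1) + coordL (2 * n) (2 * i))).mul
        (hb gc (sumL n i + coordL (2 * n) (2 * i))) (fun x => abs_nonneg _) (fun x => abs_nonneg _))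
        (fun i x => by positivity)) (fun x => by positivity) (fun x => by positivity)).mul
    (hb g (sumL n 1)) (fun x => by positivity) (fun x => by positivity)
  simp only [Nn, Hf_eq, ← coordL_apply, sub_sub, ← hgc, ← add_apply]
  exact this

lemma isBigO_rhoT (n : ℕ) (hn : 1 ≤ n) (ξ : ℝ) :
    (fun x : EuclideanSpace ℝ (Fin (2 * n)) => x) =O[⊤] (fun x => 1 + rhoT n ξ x) := by
  have key : ∀ u : EuclideanSpace ℝ (Fin (2 * n)) → ℝ, (∀ x, |ξ - u x| ≤ rhoT n ξ x) →
      u =O[⊤] (fun x => 1 + rhoT n ξ x) := by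
    intro u hu
    refine Asymptotics.IsBigO.of_bound (1 + |ξ|) (Filter.Eventually.of_forall fun x => ?_)
    have h1 := hu x
    have h2 := rhoT_nonneg n ξ x
    rw [Real.norm_of_nonneg (by positivity : 0 ≤ 1 + rhoT n ξ x), Real.norm_eq_abs]
    have h3 : |u x| ≤ |ξ| + |ξ - u x| := by
      have := abs_sub ξ (ξ - u x); simpa using this
    nlinarith [abs_nonneg ξ, mul_nonneg (abs_nonneg ξ) h2]
  have k1 : (fun x => coordL (2 * n) (2 * n) x) =O[⊤] (fun x => 1 + rhoT n ξ x) := by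
    apply key; intro x; unfold rhoT
    have : 0 ≤ ∑ i ∈ Finset.Icc 1 (n - 1),
    (|ξ - (sumL n (i + 1) + coordL (2 * n) (2 * i)) x| +
      |ξ - (sumL n i + coordL (2 * n) (2 * i)) x|) := by positivity
    linarith [abs_nonneg (ξ - (sumL n n + coordL (2 * n) (2 * n)) x), abs_nonneg (ξ - sumL n 1 x)]
  have k2 : (fun x => (sumL n n + coordL (2 * n) (2 * n)) x) =O[⊤] (fun x => 1 + rhoT n ξ x) := by
    apply key; intro x; unfold rhoT
    have : 0 ≤ ∑ i ∈ Finset.Icc 1 (n - 1),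
    (|ξ - (sumL n (i + 1) + coordL (2 * n) (2 * i)) x| +
      |ξ - (sumL n i + coordL (2 * n) (2 * i)) x|) := by positivity
    linarith [abs_nonneg (ξ - coordL (2 * n) (2 * n) x), abs_nonneg (ξ - sumL n 1 x)]
  have k3 : ∀ i ∈ Finset.Icc 1 (n - 1), ∀ x, |ξ - (sumL n (i + 1) + coordL (2 * n) (2 * i)) x| +
      |ξ - (sumL n i + coordL (2 * n) (2 * i)) x| ≤ rhoT n ξ x := by
    intro i hi x
    have := Finset.single_le_sum (f := fun i => |ξ - (sumL n (i + 1) + coordL (2 * n) (2 * i)) x| +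
      |ξ - (sumL n i + coordL (2 * n) (2 * i)) x|) (fun i _ => by positivity) hi
    unfold rhoT
    have h1 := abs_nonneg (ξ - coordL (2 * n) (2 * n) x)
    have h2 := abs_nonneg (ξ - sumL n 1 x)
    have h3 := abs_nonneg (ξ - (sumL n n + coordL (2 * n) (2 * n)) x)
    linarith
  have k4 : ∀ i ∈ Finset.Icc 1 (n - 1), (fun x => (sumL n (i + 1) + coordL (2 * n) (2 * i)) x)
      =O[⊤] (fun x => 1 + rhoT n ξ x) := fun i hi => key _ fun x =>
    le_trans (le_add_of_nonneg_right (abs_nonneg _)) (k3 i hi x)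
  have k5 : ∀ i ∈ Finset.Icc 1 (n - 1), (fun x => (sumL n i + coordL (2 * n) (2 * i)) x)
      =O[⊤] (fun x => 1 + rhoT n ξ x) := fun i hi => key _ fun x =>
    le_trans (le_add_of_nonneg_left (abs_nonneg _)) (k3 i hi x)
  have hS : ∀ d, d < n → (fun x => sumL n (n - d) x) =O[⊤] (fun x => 1 + rhoT n ξ x) := by
    intro d
    induction d with
    | zero =>
      intro _
      have := k2.sub k1
      simpa using this
    | succ d ih =>
      intro hd
      have h0 := ih (by omega)
      have hi : n - (d + 1) ∈ Finset.Icc 1 (n - 1) := by simp; omega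
      have e : n - (d + 1) + 1 = n - d := by omega
      have h1 := (h0.add (k5 _ hi)).sub (k4 _ hi)
      rw [e] at h1
      refine h1.congr_left fun x => ?_
      simp only [add_apply]; ring
  have hS' : ∀ i, 1 ≤ i → (fun x => sumL n i x) =O[⊤] (fun x => 1 + rhoT n ξ x) := by
    intro i hi
    by_cases h : i ≤ n
    · have := hS (n - i) (by omega)
      rwa [show n - (n - i) = i by omega] at this
    · have : sumL n i = 0 := by
        unfold sumL; rw [Finset.Icc_eq_empty (by omega)]; simp
      simp only [this, zero_apply]
      exact Asymptotics.isBigO_zero _ _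
  have hodd : ∀ i ∈ Finset.Icc 1 n, (fun x => coordL (2 * n) (2 * i - 1) x) =O[⊤] (fun x => 1 + rhoT n ξ x) := by
    intro i hi
    rw [Finset.mem_Icc] at hi
    refine ((hS' i hi.1).sub (hS' (i + 1) (by omega))).congr_left fun x => ?_
    have : sumL n i = coordL (2 * n) (2 * i - 1) + sumL n (i + 1) := by
      unfold sumL
      have h : Finset.Icc i n = insert i (Finset.Icc (i + 1) n) := by
        ext k; simp; omega
      rw [h, Finset.sum_insert (by simp)]
    rw [this]; simp
  have heven : ∀ i ∈ Finset.Icc 1 n, (fun x => coordL (2 * n) (2 * i) x) =O[⊤] (fun x => 1 + rhoT n ξ x) := by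
    intro i hi
    rw [Finset.mem_Icc] at hi
    by_cases h : i = n
    · subst h; exact k1
    · refine ((k5 i (by simp; omega)).sub (hS' i hi.1)).congr_left fun x => ?_
      simp
  have hall : ∀ j : Fin (2 * n), (fun x : EuclideanSpace ℝ (Fin (2 * n)) => x j) =O[⊤] (fun x => 1 + rhoT n ξ x) := by
    intro j
    have hj := j.isLt
    have e : ∀ x : EuclideanSpace ℝ (Fin (2 * n)), coordL (2 * n) (j.val + 1) x = x j := by
      intro x; simp [coordL_apply, coordOf]
    rcases Nat.even_or_odd' j.val with ⟨c, hc | hc⟩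
    · have := hodd (c + 1) (by simp; omega)
      rw [show 2 * (c + 1) - 1 = j.val + 1 by omega] at this
      exact this.congr_left e
    · have := heven (c + 1) (by simp; omega)
      rw [show 2 * (c + 1) = j.val + 1 by omega] at this
      exact this.congr_left e
  have hx : (fun x : EuclideanSpace ℝ (Fin (2 * n)) => x) = fun x => ∑ j, x j • EuclideanSpace.single j (1 : ℝ) := by
    funext x
    have := (EuclideanSpace.basisFun (Fin (2 * n)) ℝ).sum_repr x
    simpa using this.symm
  rw [hx]
  refine Asymptotics.IsBigO.fun_sum fun j _ => ?_
  refine (Asymptotics.IsBigO.trans ?_ (hall j))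
  refine Asymptotics.IsBigO.of_bound 1 (Filter.Eventually.of_forall fun x => ?_)
  simp [norm_smul]

lemma exists_schwartz_Nn (n : ℕ) (hn : 1 ≤ n) (g : SchwartzMap ℝ ℂ) (ξ : ℝ) :
    ∃ F : SchwartzMap (EuclideanSpace ℝ (Fin (2 * n))) ℂ,
      ∀ x, F x = Nn n (fun y => g y) ξ (fun i => x i) :=
  (decay_Nn n g ξ).schwartz (rhoT_nonneg n ξ) (isBigO_rhoT n hn ξ)

open scoped FourierTransform RealInnerProductSpace

lemma core_identity {E : Type*} [NormedAddCommGroup E] [InnerProductSpace ℝ E]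
    [FiniteDimensional ℝ E] [MeasurableSpace E] [BorelSpace E] (h F : E × E → ℂ)
    (hc : Continuous h) (hi : Integrable h) (bnd : E → ℝ) (hb : Integrable bnd)
    (hbd : ∀ x y, ‖h (x, y)‖ ≤ bnd y) (hF : Integrable F)
    (hFs : ∀ b, Integrable fun a => F (a, b))
    (hdef : ∀ a b, F (a, b) =
      ∫ p : E × E, Complex.exp (((2 * π * (⟪p.1, a⟫ + ⟪p.2, b⟫) : ℝ) : ℂ) * Complex.I) * h p)
    (t : ℝ) (ht : 0 < t) :
    ∫ p : E × E, Complex.exp (Complex.I * ((t * ⟪p.1, p.2⟫ : ℝ) : ℂ)) * h p =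
      (((2 * π / t) ^ Module.finrank ℝ E : ℝ) : ℂ) *
      ∫ p : E × E, Complex.exp (-Complex.I * ((4 * π ^ 2 / t * ⟪p.1, p.2⟫ : ℝ) : ℂ)) * F p := by
  have normexp : ∀ r : ℝ, ‖Complex.exp ((r : ℂ) * Complex.I)‖ = 1 := Complex.norm_exp_ofReal_mul_I
  set k : E → E → ℂ := fun b x =>
    ∫ y, Complex.exp (((2 * π * ⟪y, b⟫ : ℝ) : ℂ) * Complex.I) * h (x, y) with hk
  have intmul : ∀ (H : E × E → ℂ) (u : E × E → ℝ), Integrable H → Continuous u →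
      Integrable (fun p => Complex.exp (((u p : ℝ) : ℂ) * Complex.I) * H p) := by
    intro H u hH hu
    refine hH.bdd_mul (c := 1) (Continuous.aestronglyMeasurable (by fun_prop)) ?_
    exact Filter.Eventually.of_forall fun p => (normexp _).le
  -- continuity of `k b`
  have kc : ∀ b, Continuous (k b) := by
    intro b
    refine continuous_of_dominated (bound := bnd) (fun x => ?_) (fun x => ?_) hb ?_
    · exact Continuous.aestronglyMeasurable (by fun_prop)
    · refine Filter.Eventually.of_forall fun y => ?_
      rw [norm_mul, normexp, one_mul]; exact hbd x y
    · exact Filter.Eventually.of_forall fun y => by fun_prop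
  have ki : ∀ b, Integrable (k b) := by
    intro b
    have := (intmul h (fun p => 2 * π * ⟪p.2, b⟫) hi (by fun_prop))
    exact this.integral_prod_left
  have kF : ∀ b, 𝓕⁻ (k b) = fun a => F (a, b) := by
    intro b
    funext a
    rw [Real.fourierInv_eq', hdef, MeasureTheory.Measure.volume_eq_prod, integral_prod]
    · refine integral_congr_ae (Filter.Eventually.of_forall fun x => ?_)
      simp only [hk, smul_eq_mul]
      rw [← integral_const_mul]
      refine integral_congr_ae (Filter.Eventually.of_forall fun y => ?_)
      simp only [← mul_assoc]
      rw [← Complex.exp_add]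
      congr 2
      push_cast; ring
    · exact intmul h (fun p => 2 * π * (⟪p.1, a⟫ + ⟪p.2, b⟫)) hi (by fun_prop)
  have kinv : ∀ b x, k b x = ∫ a, Complex.exp (((-2 * π * ⟪a, x⟫ : ℝ) : ℂ) * Complex.I) * F (a, b) := by
    intro b x
    have h2 : Integrable (𝓕 (k b)) := by
      have : 𝓕 (k b) = fun a => F (-a, b) := by
        funext a
        have := congrFun (kF b) (-a)
        rw [Real.fourierInv_eq_fourier_neg, neg_neg] at this
        exact this
      rw [this]
      exact (hFs b).comp_neg
    have := congrFun ((kc b).fourier_fourierInv_eq (ki b) h2) x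
    rw [← this, Real.fourier_eq', kF]
    simp only [smul_eq_mul]
  -- left side
  have L : ∫ p : E × E, Complex.exp (Complex.I * ((t * ⟪p.1, p.2⟫ : ℝ) : ℂ)) * h p =
      ∫ x, k ((t / (2 * π)) • x) x := by
    rw [MeasureTheory.Measure.volume_eq_prod, integral_prod]
    · refine integral_congr_ae (Filter.Eventually.of_forall fun x => ?_)
      refine integral_congr_ae (Filter.Eventually.of_forall fun y => ?_)
      simp only
      congr 2
      rw [inner_smul_right, real_inner_comm, mul_comm]
      congr 2
      have := Real.pi_ne_zero
      field_simp
    · have := intmul h (fun p => t * ⟪p.1, p.2⟫) hi (by fun_prop)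
      refine this.congr (Filter.Eventually.of_forall fun p => ?_)
      simp only [mul_comm Complex.I]
  have R : ∫ p : E × E, Complex.exp (-Complex.I * ((4 * π ^ 2 / t * ⟪p.1, p.2⟫ : ℝ) : ℂ)) * F p =
      ∫ b, k b ((2 * π / t) • b) := by
    rw [MeasureTheory.Measure.volume_eq_prod, integral_prod_symm]
    · refine integral_congr_ae (Filter.Eventually.of_forall fun b => ?_)
      simp only
      rw [kinv]
      refine integral_congr_ae (Filter.Eventually.of_forall fun a => ?_)
      simp only
      congr 2
      rw [inner_smul_right]
      push_cast
      ring
    · have := intmul F (fun p => -(4 * π ^ 2 / t * ⟪p.1, p.2⟫)) hF (by fun_prop)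
      refine this.congr (Filter.Eventually.of_forall fun p => ?_)
      simp only
      congr 2
      push_cast; ring
  rw [L, R]
  have hs := Measure.integral_comp_smul (volume : Measure E) (fun x => k ((t / (2 * π)) • x) x) (2 * π / t)
  have e : ∀ b : E, (t / (2 * π)) • ((2 * π / t) • b) = b := by
    intro b
    rw [smul_smul, show t / (2 * π) * (2 * π / t) = 1 by
      have := Real.pi_ne_zero; field_simp, one_smul]
  simp only [e] at hs
  rw [hs, abs_of_pos (by positivity), Complex.real_smul, ← mul_assoc]
  have hne : ((2 * π / t) ^ Module.finrank ℝ E : ℝ) ≠ 0 := by positivity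
  rw [← Complex.ofReal_mul, mul_inv_cancel₀ hne]
  simp

lemma pderivIter_fourier {m : ℕ} (L : List (Fin m)) (F : SchwartzMap (EuclideanSpace ℝ (Fin m)) ℂ) :
    ∃ G : SchwartzMap (EuclideanSpace ℝ (Fin m)) ℂ,
      (∀ s, G s = (L.map (fun c => -(2 * π * Complex.I) * (s c : ℂ))).prod * F s) ∧
      pderivIter L (fun η => (𝓕 F) (WithLp.toLp 2 η)) = fun η => (𝓕 G) (WithLp.toLp 2 η) := by
  induction L with
  | nil => exact ⟨F, fun s => by simp, rfl⟩
  | cons c cs ih =>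
    obtain ⟨G, hG, hp⟩ := ih
    have htg : (fun x : EuclideanSpace ℝ (Fin m) => inner ℝ x (EuclideanSpace.single c (1 : ℝ))).HasTemperateGrowth := by
      fun_prop
    refine ⟨-(2 * π * Complex.I) • SchwartzMap.smulLeftCLM ℂ
      (fun x : EuclideanSpace ℝ (Fin m) => inner ℝ x (EuclideanSpace.single c (1 : ℝ))) G, fun s => ?_, ?_⟩
    · rw [smul_apply, SchwartzMap.smulLeftCLM_apply_apply htg, hG]
      simp [EuclideanSpace.inner_single_right]
      ring
    · rw [← SchwartzMap.lineDerivOp_fourier_eq]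
      funext η
      simp only [pderivIter, pderiv', hp]
      rw [SchwartzMap.lineDerivOp_apply_eq_fderiv]
      set G' : SchwartzMap (EuclideanSpace ℝ (Fin m)) ℂ := 𝓕 G
      have h1 : HasFDerivAt (fun η : Fin m → ℝ => G' (WithLp.toLp 2 η))
          ((fderiv ℝ (⇑G') (WithLp.toLp 2 η)).comp
            ((PiLp.continuousLinearEquiv 2 ℝ (fun _ : Fin m => ℝ)).symm : (Fin m → ℝ) →L[ℝ] _)) η :=
        (G'.hasFDerivAt (WithLp.toLp 2 η)).comp η
          (PiLp.continuousLinearEquiv 2 ℝ (fun _ : Fin m => ℝ)).symm.hasFDerivAt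
      rw [h1.fderiv]
      rfl

/-- even/odd splitting of the index set. -/
def splitMap (n : ℕ) : Fin n ⊕ Fin n → Fin (2 * n) :=
  Sum.elim (fun j => ⟨2 * j.val, by have := j.isLt; omega⟩)
    (fun j => ⟨2 * j.val + 1, by have := j.isLt; omega⟩)

lemma splitMap_bij (n : ℕ) : Function.Bijective (splitMap n) := by
  rw [Fintype.bijective_iff_injective_and_card]
  refine ⟨?_, by simp; omega⟩
  rintro (a | a) (b | b) h <;> simp [splitMap, Fin.ext_iff] at h ⊢ <;> omega

/-- even/odd splitting of the index set, as an equivalence. -/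
def splitE (n : ℕ) : Fin n ⊕ Fin n ≃ Fin (2 * n) := Equiv.ofBijective _ (splitMap_bij n)

/-- The recombination map. -/
def recomb (n : ℕ) (p : EuclideanSpace ℝ (Fin n) × EuclideanSpace ℝ (Fin n)) :
    EuclideanSpace ℝ (Fin (2 * n)) :=
  WithLp.toLp 2 (fun i => Sum.elim (fun j => p.1 j) (fun j => p.2 j) ((splitE n).symm i))

lemma recomb_inl (n : ℕ) (p : EuclideanSpace ℝ (Fin n) × EuclideanSpace ℝ (Fin n)) (j : Fin n) :
    recomb n p (splitE n (Sum.inl j)) = p.1 j := by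
  simp [recomb]

lemma recomb_inr (n : ℕ) (p : EuclideanSpace ℝ (Fin n) × EuclideanSpace ℝ (Fin n)) (j : Fin n) :
    recomb n p (splitE n (Sum.inr j)) = p.2 j := by
  simp [recomb]

lemma recomb_inner (n : ℕ) (p q : EuclideanSpace ℝ (Fin n) × EuclideanSpace ℝ (Fin n)) :
    ⟪recomb n p, recomb n q⟫ = ⟪p.1, q.1⟫ + ⟪p.2, q.2⟫ := by
  simp only [PiLp.inner_apply]
  rw [← (splitE n).sum_comp, Fintype.sum_sum_type]
  simp only [recomb_inl, recomb_inr]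

lemma recomb_norm_fst (n : ℕ) (p : EuclideanSpace ℝ (Fin n) × EuclideanSpace ℝ (Fin n)) :
    ‖p.1‖ ≤ ‖recomb n p‖ := by
  apply le_of_sq_le_sq _ (norm_nonneg _)
  rw [← real_inner_self_eq_norm_sq, ← real_inner_self_eq_norm_sq, recomb_inner]
  linarith [real_inner_self_nonneg (x := p.2)]

lemma recomb_norm_snd (n : ℕ) (p : EuclideanSpace ℝ (Fin n) × EuclideanSpace ℝ (Fin n)) :
    ‖p.2‖ ≤ ‖recomb n p‖ := by
  apply le_of_sq_le_sq _ (norm_nonneg _)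
  rw [← real_inner_self_eq_norm_sq, ← real_inner_self_eq_norm_sq, recomb_inner]
  linarith [real_inner_self_nonneg (x := p.1)]

/-- The recombination map as a measurable equivalence. -/
def recombM (n : ℕ) : EuclideanSpace ℝ (Fin n) × EuclideanSpace ℝ (Fin n) ≃ᵐ
    EuclideanSpace ℝ (Fin (2 * n)) :=
  (((MeasurableEquiv.toLp 2 (Fin n → ℝ)).symm.prodCongr (MeasurableEquiv.toLp 2 (Fin n → ℝ)).symm).trans
    (MeasurableEquiv.sumPiEquivProdPi (fun _ : Fin n ⊕ Fin n => ℝ)).symm).trans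
    ((MeasurableEquiv.piCongrLeft (fun _ : Fin (2 * n) => ℝ) (splitE n)).trans
      (MeasurableEquiv.toLp 2 (Fin (2 * n) → ℝ)))

lemma recombM_coe (n : ℕ) : ⇑(recombM n) = recomb n := by
  funext p
  ext i
  obtain ⟨s, rfl⟩ := (splitE n).surjective i
  have : recombM n p (splitE n s) =
      (MeasurableEquiv.sumPiEquivProdPi (fun _ : Fin n ⊕ Fin n => ℝ)).symm
        (WithLp.ofLp p.1, WithLp.ofLp p.2) s :=
    Equiv.piCongrLeft_apply_apply (fun _ : Fin (2 * n) => ℝ) (splitE n) _ s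
  rw [this]
  rcases s with j | j
  · rw [recomb_inl]; rfl
  · rw [recomb_inr]; rfl

lemma recombM_mp (n : ℕ) : MeasurePreserving (recombM n) volume volume := by
  have h1 := (PiLp.volume_preserving_ofLp (Fin n)).prod (PiLp.volume_preserving_ofLp (Fin n))
  have h2 := volume_measurePreserving_sumPiEquivProdPi_symm (fun _ : Fin n ⊕ Fin n => ℝ)
  have h3 := volume_measurePreserving_piCongrLeft (fun _ : Fin (2 * n) => ℝ) (splitE n)
  have h4 := PiLp.volume_preserving_toLp (Fin (2 * n))
  exact h4.comp (h3.comp (h2.comp h1))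

lemma recomb_integral (n : ℕ) (f : EuclideanSpace ℝ (Fin (2 * n)) → ℂ) :
    ∫ p, f (recomb n p) = ∫ x, f x := by
  rw [← recombM_coe]
  exact (recombM_mp n).integral_comp (recombM n).measurableEmbedding f

lemma recomb_integrable (n : ℕ) (f : EuclideanSpace ℝ (Fin (2 * n)) → ℂ) (hf : Integrable f) :
    Integrable (fun p => f (recomb n p)) := by
  rw [← recombM_coe]
  exact ((recombM_mp n).integrable_comp_emb (recombM n).measurableEmbedding).2 hf

lemma recomb_continuous (n : ℕ) : Continuous (recomb n) := by
  refine (PiLp.continuous_toLp 2 _).comp (continuous_pi fun i => ?_)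
  rcases (splitE n).symm i with j | j <;> simp <;> fun_prop

lemma Psi_eq_sum (n : ℕ) (η : Fin (2 * n) → ℝ) :
    Psi n η = ∑ j : Fin n, η (splitE n (Sum.inl j)) * η (splitE n (Sum.inr j)) := by
  unfold Psi
  symm
  refine Finset.sum_bij (fun (j : Fin n) _ => j.val + 1) (fun j _ => by simp)
    (fun a _ b _ hab => by simpa [Fin.ext_iff] using hab)
    (fun b hb => ⟨⟨b - 1, by simp at hb; omega⟩, by simp, by simp at hb ⊢; omega⟩) (fun j _ => ?_)
  have hj := j.isLt
  have h1 : 2 * (j.val + 1) - 1 = 2 * j.val + 1 := by omega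
  rw [h1]
  unfold coordOf
  rw [dif_pos (by omega), dif_pos (by omega), mul_comm]
  rfl

lemma Psi_recomb (n : ℕ) (p : EuclideanSpace ℝ (Fin n) × EuclideanSpace ℝ (Fin n)) :
    Psi n (fun i => recomb n p i) = ⟪p.1, p.2⟫ := by
  rw [Psi_eq_sum, PiLp.inner_apply]
  simp only [recomb_inl, recomb_inr]
  exact Finset.sum_congr rfl fun j _ => by simp [mul_comm]

lemma schwartz_bound {V : Type*} [NormedAddCommGroup V] [NormedSpace ℝ V]
    (F : SchwartzMap V ℂ) (d : ℕ) : ∃ C : ℝ, 0 ≤ C ∧ ∀ x, ‖F x‖ ≤ C * (1 + ‖x‖) ^ (-(d : ℝ)) := by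
  refine ⟨2 ^ d * ((Finset.Iic (d, 0)).sup fun m => SchwartzMap.seminorm ℝ m.1 m.2) F, by positivity,
    fun x => ?_⟩
  have h2 := SchwartzMap.one_add_le_sup_seminorm_apply (𝕜 := ℝ) (m := (d, 0)) le_rfl le_rfl F x
  simp only [norm_iteratedFDeriv_zero] at h2
  rw [Real.rpow_neg (by positivity), Real.rpow_natCast, ← div_eq_mul_inv, le_div_iff₀ (by positivity),
    mul_comm]
  exact h2

/-- Parseval identity for the oscillatory factor. -/
lemma parseval_osc (n : ℕ) (h : SchwartzMap (EuclideanSpace ℝ (Fin (2 * n))) ℂ) (t : ℝ) (ht : 0 < t) :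
    ∫ x : EuclideanSpace ℝ (Fin (2 * n)),
        Complex.exp (Complex.I * ((t * Psi n (fun i => x i) : ℝ) : ℂ)) * h x =
      (((2 * π / t) ^ n : ℝ) : ℂ) * ∫ x : EuclideanSpace ℝ (Fin (2 * n)),
        Complex.exp (-Complex.I * ((4 * π ^ 2 / t * Psi n (fun i => x i) : ℝ) : ℂ)) * (𝓕⁻ h) x := by
  obtain ⟨C, hC0, hC⟩ := schwartz_bound h (n + 1)
  obtain ⟨C', hC0', hC'⟩ := schwartz_bound (𝓕⁻ h) (n + 1)
  have hIntg : Integrable (fun y : EuclideanSpace ℝ (Fin n) => (1 + ‖y‖) ^ (-((n + 1 : ℕ) : ℝ))) :=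
    integrable_one_add_norm (by simp)
  have hmono : ∀ a b : ℝ, 0 ≤ a → a ≤ b →
      (1 + b) ^ (-((n + 1 : ℕ) : ℝ)) ≤ (1 + a) ^ (-((n + 1 : ℕ) : ℝ)) := by
    intro a b ha hab
    exact Real.rpow_le_rpow_of_nonpos (by positivity) (by linarith) (neg_nonpos.2 (Nat.cast_nonneg _))
  have := core_identity (fun p => h (recomb n p)) (fun p => (𝓕⁻ h) (recomb n p))
    (h.continuous.comp (recomb_continuous n)) (recomb_integrable n _ h.integrable)
    (fun y => C * (1 + ‖y‖) ^ (-((n + 1 : ℕ) : ℝ))) (hIntg.const_mul C)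
    (fun x y => (hC _).trans (mul_le_mul_of_nonneg_left
      (hmono _ _ (norm_nonneg _) (recomb_norm_snd n (x, y))) hC0))
    (recomb_integrable n _ (𝓕⁻ h).integrable)
    (fun b => (hIntg.const_mul C').mono'
      (Continuous.aestronglyMeasurable ((𝓕⁻ h).continuous.comp ((recomb_continuous n).comp (by fun_prop))))
      (Filter.Eventually.of_forall fun a => (hC' _).trans (mul_le_mul_of_nonneg_left
      (hmono _ _ (norm_nonneg _) (recomb_norm_fst n (a, b))) hC0')))
    (fun a b => ?_) t ht
  · rw [← recomb_integral, ← recomb_integral]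
    simp only [Psi_recomb]
    simpa using this
  · rw [SchwartzMap.fourierInv_coe, Real.fourierInv_eq', ← recomb_integral]
    simp only [recomb_inner, smul_eq_mul]

lemma derivList_prod (n : ℕ) (mv : Fin n → ℕ) (f : Fin (2 * n) → ℂ) :
    ((derivList n mv).map f).prod =
      ∏ j : Fin n, (f (splitE n (Sum.inl j)) * f (splitE n (Sum.inr j))) ^ mv j := by
  rw [derivList, List.map_flatMap, List.flatMap_def, List.prod_flatten, List.map_map,
    Fin.prod_univ_def]
  congr 1
  refine List.map_congr_left fun j _ => ?_
  simp only [Function.comp_apply, List.map_append, List.map_replicate, List.prod_append,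
    List.prod_replicate, mul_pow]
  rfl

lemma antidiag_eq (n k : ℕ) :
    Finset.Nat.antidiagonalTuple n k = Finset.piAntidiag (Finset.univ : Finset (Fin n)) k := by
  ext f
  simp [Finset.Nat.mem_antidiagonalTuple]

lemma Pfrak_eq (n : ℕ) (g : ℝ → ℂ) (ξ : ℝ) (h : SchwartzMap (EuclideanSpace ℝ (Fin (2 * n))) ℂ)
    (hh : ∀ x, h x = Nn n g ξ (fun i => x i)) (k : ℕ) :
    Integrable (fun x : EuclideanSpace ℝ (Fin (2 * n)) =>
      ((Psi n (fun i => x i) : ℝ) : ℂ) ^ k * (𝓕⁻ h) x) ∧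
    Pfrak n g k ξ = (Complex.I ^ k / (k.factorial : ℂ)) *
      ∫ x : EuclideanSpace ℝ (Fin (2 * n)),
        (-(4 * π ^ 2 : ℂ)) ^ k * (((Psi n (fun i => x i) : ℝ) : ℂ) ^ k * (𝓕⁻ h) x) := by
  choose G hG hP using fun mv : Fin n → ℕ => pderivIter_fourier (derivList n mv) (𝓕⁻ h)
  have hN : (fun η => Nn n g ξ η) = fun η : Fin (2 * n) → ℝ => (𝓕 (𝓕⁻ h)) (WithLp.toLp 2 η) := by
    funext η
    rw [FourierTransform.fourier_fourierInv_eq, hh]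
  have hval : ∀ mv, pderivIter (derivList n mv) (fun η => Nn n g ξ η) 0 = ∫ x, G mv x := by
    intro mv
    rw [hN, hP]
    simp only
    rw [SchwartzMap.fourier_coe, Real.fourier_eq']
    simp
  have hpi : (-(4 * π ^ 2 : ℂ)) ≠ 0 := by
    have := Real.pi_ne_zero
    simp [this]
  have hG' : ∀ mv ∈ Finset.Nat.antidiagonalTuple n k, ∀ x : EuclideanSpace ℝ (Fin (2 * n)),
      G mv x = (-(4 * π ^ 2 : ℂ)) ^ k * ((∏ j : Fin n, ((x (splitE n (Sum.inl j)) : ℂ) *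
        (x (splitE n (Sum.inr j)) : ℂ)) ^ mv j) * (𝓕⁻ h) x) := by
    intro mv hmv x
    rw [hG, derivList_prod, ← mul_assoc]
    congr 1
    rw [Finset.Nat.mem_antidiagonalTuple] at hmv
    rw [← hmv, ← Finset.prod_pow_eq_pow_sum, ← Finset.prod_mul_distrib]
    refine Finset.prod_congr rfl fun j _ => ?_
    rw [← mul_pow]
    congr 1
    linear_combination (4 * π ^ 2 * (x (splitE n (Sum.inl j)) : ℂ) *
        (x (splitE n (Sum.inr j)) : ℂ)) * Complex.I_sq
  have hsum : ∀ x : EuclideanSpace ℝ (Fin (2 * n)),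
      (-(4 * π ^ 2 : ℂ)) ^ k * (((Psi n (fun i => x i) : ℝ) : ℂ) ^ k * (𝓕⁻ h) x) =
      ∑ mv ∈ Finset.Nat.antidiagonalTuple n k,
        ((Nat.multinomial Finset.univ mv : ℕ) : ℂ) * G mv x := by
    intro x
    rw [Psi_eq_sum]
    push_cast
    rw [Finset.sum_pow_eq_sum_piAntidiag, ← antidiag_eq, Finset.sum_mul, Finset.mul_sum]
    refine Finset.sum_congr rfl fun mv hmv => ?_
    rw [hG' mv hmv]
    ring
  have hIntg : ∀ mv ∈ Finset.Nat.antidiagonalTuple n k, Integrable (fun x =>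
      ((Nat.multinomial Finset.univ mv : ℕ) : ℂ) * G mv x) :=
    fun mv _ => (G mv).integrable.const_mul _
  constructor
  · have h1 := (integrable_finsetSum _ hIntg).const_mul (((-(4 * π ^ 2 : ℂ)) ^ k)⁻¹)
    refine h1.congr (Filter.Eventually.of_forall fun x => ?_)
    simp only
    rw [← hsum, ← mul_assoc, inv_mul_cancel₀ (pow_ne_zero _ hpi), one_mul]
  · unfold Pfrak
    simp only [hsum]
    rw [integral_finsetSum _ hIntg]
    simp only [hval, integral_const_mul]

lemma toLp_integral (m : ℕ) (f : (Fin m → ℝ) → ℂ) :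
    ∫ x : EuclideanSpace ℝ (Fin m), f (fun i => x i) = ∫ η, f η :=
  (PiLp.volume_preserving_ofLp (Fin m)).integral_comp
    (MeasurableEquiv.toLp 2 (Fin m → ℝ)).symm.measurableEmbedding f

lemma invFTeta_eq (n : ℕ) (g : ℝ → ℂ) (ξ : ℝ) (h : SchwartzMap (EuclideanSpace ℝ (Fin (2 * n))) ℂ)
    (hh : ∀ x, h x = Nn n g ξ (fun i => x i)) (x : EuclideanSpace ℝ (Fin (2 * n))) :
    invFTeta n (fun σ => Nn n g ξ σ) (fun i => ((2 * π) • x) i) =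
      ((((2 * Real.pi) ^ n)⁻¹ : ℝ) : ℂ) * (𝓕⁻ h) x := by
  unfold invFTeta
  congr 1
  rw [SchwartzMap.fourierInv_coe, Real.fourierInv_eq', ← toLp_integral]
  refine integral_congr_ae (Filter.Eventually.of_forall fun y => ?_)
  simp only [hh, smul_eq_mul]
  rw [mul_comm Complex.I]
  congr 4
  rw [PiLp.inner_apply, Finset.mul_sum]
  refine Finset.sum_congr rfl fun j _ => ?_
  simp
  ring

lemma Psi_smul (n : ℕ) (r : ℝ) (x : EuclideanSpace ℝ (Fin (2 * n))) :
    Psi n (fun i => (r • x) i) = r ^ 2 * Psi n (fun i => x i) := by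
  simp only [Psi_eq_sum, Finset.mul_sum]
  refine Finset.sum_congr rfl fun j _ => ?_
  simp
  ring

lemma Rrem_eq (n : ℕ) (g : ℝ → ℂ) (ξ : ℝ) (h : SchwartzMap (EuclideanSpace ℝ (Fin (2 * n))) ℂ)
    (hh : ∀ x, h x = Nn n g ξ (fun i => x i)) (r : ℕ) (t : ℝ) (ht : 0 < t) :
    Rrem n g r t ξ = (((t ^ n : ℝ)⁻¹ : ℝ) : ℂ) * ∫ x : EuclideanSpace ℝ (Fin (2 * n)),
      (Complex.exp (-Complex.I * ((4 * π ^ 2 / t * Psi n (fun i => x i) : ℝ) : ℂ)) -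
        ∑ j ∈ Finset.range r,
          (-Complex.I * ((4 * π ^ 2 / t * Psi n (fun i => x i) : ℝ) : ℂ)) ^ j / (j.factorial : ℂ)) *
        (𝓕⁻ h) x := by
  unfold Rrem
  set W : (Fin (2 * n) → ℝ) → ℂ := fun η =>
      (Complex.exp (-Complex.I * ((Qform n η / (2 * t) : ℝ) : ℂ)) -
        ∑ j ∈ Finset.range r,
          (-Complex.I * ((Qform n η : ℝ) : ℂ)) ^ j /
            (((2 * t : ℝ) : ℂ) ^ j * (j.factorial : ℂ))) *
      invFTeta n (fun σ => Nn n g ξ σ) η with hW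
  rw [← toLp_integral]
  have hs := Measure.integral_comp_smul (volume : Measure (EuclideanSpace ℝ (Fin (2 * n))))
    (fun x => W (fun i => x i)) (2 * π)
  rw [finrank_euclideanSpace_fin, abs_of_pos (by positivity), Complex.real_smul] at hs
  have hpi : (π : ℂ) ≠ 0 := by exact_mod_cast Real.pi_ne_zero
  have htc : (t : ℂ) ≠ 0 := by exact_mod_cast ht.ne'
  have hWx : ∀ x : EuclideanSpace ℝ (Fin (2 * n)), W (fun i => ((2 * π) • x) i) =
      ((((2 * Real.pi) ^ n)⁻¹ : ℝ) : ℂ) * ((Complex.exp (-Complex.I * ((4 * π ^ 2 / t * Psi n (fun i => x i) : ℝ) : ℂ)) -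
        ∑ j ∈ Finset.range r,
          (-Complex.I * ((4 * π ^ 2 / t * Psi n (fun i => x i) : ℝ) : ℂ)) ^ j / (j.factorial : ℂ)) *
        (𝓕⁻ h) x) := by
    intro x
    simp only [hW]
    rw [invFTeta_eq n g ξ h hh, Qform, Psi_smul]
    have e1 : 2 * ((2 * π) ^ 2 * Psi n (fun i => x i)) / (2 * t) = 4 * π ^ 2 / t * Psi n (fun i => x i) := by
      field_simp; ring
    rw [e1]
    have e2 : ∀ j : ℕ, (-Complex.I * ((2 * ((2 * π) ^ 2 * Psi n (fun i => x i)) : ℝ) : ℂ)) ^ j /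
            (((2 * t : ℝ) : ℂ) ^ j * (j.factorial : ℂ)) =
          (-Complex.I * ((4 * π ^ 2 / t * Psi n (fun i => x i) : ℝ) : ℂ)) ^ j / (j.factorial : ℂ) := by
      intro j
      rw [← div_div, ← div_pow, ← e1]
      push_cast
      rw [mul_div_assoc]
    simp only [e2]
    ring
  simp only [hWx] at hs
  rw [integral_const_mul] at hs
  have hI : (∫ x : EuclideanSpace ℝ (Fin (2 * n)), W (fun i => x i)) = (((2 * π) ^ n : ℝ) : ℂ) *
      ∫ x : EuclideanSpace ℝ (Fin (2 * n)),
      (Complex.exp (-Complex.I * ((4 * π ^ 2 / t * Psi n (fun i => x i) : ℝ) : ℂ)) -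
        ∑ j ∈ Finset.range r,
          (-Complex.I * ((4 * π ^ 2 / t * Psi n (fun i => x i) : ℝ) : ℂ)) ^ j / (j.factorial : ℂ)) *
        (𝓕⁻ h) x := by
    have hne : ((((2 * π) ^ (2 * n))⁻¹ : ℝ) : ℂ) ≠ 0 := by
      rw [Complex.ofReal_ne_zero]; positivity
    apply mul_left_cancel₀ hne
    rw [← hs, ← mul_assoc]
    congr 1
    rw [← Complex.ofReal_mul]
    congr 1
    rw [two_mul n, pow_add]
    field_simp
  rw [hI]
  have hne : (((2 * π) ^ n : ℝ) : ℂ) ≠ 0 := by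
    rw [Complex.ofReal_ne_zero]; positivity
  rw [Complex.ofReal_inv ((2 * π) ^ n)]
  field_simp

/-- stationary phase expansion of `(2π)^{-n} ∫ e^{itΨⁿ} 𝒩ⁿ[g] dη`. -/
theorem statement3 (n : ℕ) (hn : 1 ≤ n) (N : ℕ) (g : SchwartzMap ℝ ℂ)
    (t : ℝ) (ht : 0 < t) (ξ : ℝ) :
    ((((2 * Real.pi) ^ n)⁻¹ : ℝ) : ℂ) *
        ∫ η : Fin (2 * n) → ℝ,
          Complex.exp (Complex.I * ((t * Psi n η : ℝ) : ℂ)) * Nn n (fun y => g y) ξ η =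
      (∑ k ∈ Finset.range (N + 1),
        (((t ^ (k + n) : ℝ)⁻¹ : ℝ) : ℂ) * Pfrak n (fun y => g y) k ξ) +
        Rrem n (fun y => g y) (N + 1) t ξ := by
  obtain ⟨h, hh⟩ := exists_schwartz_Nn n hn g ξ
  rw [Rrem_eq n _ ξ h hh (N + 1) t ht, ← toLp_integral]
  simp only [← hh]
  rw [parseval_osc n h t ht, ← mul_assoc, ← Complex.ofReal_mul]
  have e0 : ((2 * π) ^ n)⁻¹ * (2 * π / t) ^ n = (t ^ n)⁻¹ := by
    rw [div_pow]; field_simp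
  rw [e0]
  have htc : (t : ℂ) ≠ 0 := by exact_mod_cast ht.ne'
  set A : EuclideanSpace ℝ (Fin (2 * n)) → ℂ := fun x =>
    Complex.exp (-Complex.I * ((4 * π ^ 2 / t * Psi n (fun i => x i) : ℝ) : ℂ)) * (𝓕⁻ h) x with hA
  set B : ℕ → EuclideanSpace ℝ (Fin (2 * n)) → ℂ := fun j x =>
    (-Complex.I * ((4 * π ^ 2 / t * Psi n (fun i => x i) : ℝ) : ℂ)) ^ j / (j.factorial : ℂ) * (𝓕⁻ h) x with hB
  have hPc : Continuous (fun x : EuclideanSpace ℝ (Fin (2 * n)) => Psi n (fun i => x i)) := by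
    simp only [Psi_eq_sum]
    fun_prop
  have hAi : Integrable A := by
    refine (𝓕⁻ h).integrable.bdd_mul (c := 1) (Continuous.aestronglyMeasurable (by fun_prop)) ?_
    refine Filter.Eventually.of_forall fun x => ?_
    rw [neg_mul, mul_comm, ← neg_mul, ← Complex.ofReal_neg, Complex.norm_exp_ofReal_mul_I]
  have hBe : ∀ j x, B j x = ((t : ℂ) ^ j)⁻¹ * (Complex.I ^ j / (j.factorial : ℂ)) *
      ((-(4 * π ^ 2 : ℂ)) ^ j * (((Psi n (fun i => x i) : ℝ) : ℂ) ^ j * (𝓕⁻ h) x)) := by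
    intro j x
    simp only [hB]
    have : -Complex.I * ((4 * π ^ 2 / t * Psi n (fun i => x i) : ℝ) : ℂ) =
        (t : ℂ)⁻¹ * Complex.I * (-(4 * π ^ 2 : ℂ)) * ((Psi n (fun i => x i) : ℝ) : ℂ) := by
      push_cast; ring
    rw [this, mul_pow, mul_pow, mul_pow, inv_pow]
    ring
  have hBi : ∀ j ∈ Finset.range (N + 1), Integrable (B j) := by
    intro j _
    have := (((Pfrak_eq n _ ξ h hh j).1).const_mul ((-(4 * π ^ 2 : ℂ)) ^ j)).const_mul
      (((t : ℂ) ^ j)⁻¹ * (Complex.I ^ j / (j.factorial : ℂ)))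
    exact this.congr (Filter.Eventually.of_forall fun x => (hBe j x).symm)
  have hR : ∫ x : EuclideanSpace ℝ (Fin (2 * n)),
      (Complex.exp (-Complex.I * ((4 * π ^ 2 / t * Psi n (fun i => x i) : ℝ) : ℂ)) -
        ∑ j ∈ Finset.range (N + 1),
          (-Complex.I * ((4 * π ^ 2 / t * Psi n (fun i => x i) : ℝ) : ℂ)) ^ j / (j.factorial : ℂ)) *
        (𝓕⁻ h) x = (∫ x, A x) - ∑ j ∈ Finset.range (N + 1), ∫ x, B j x := by
    rw [← integral_finsetSum _ hBi, ← integral_sub hAi (integrable_finsetSum _ hBi)]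
    refine integral_congr_ae (Filter.Eventually.of_forall fun x => ?_)
    simp only [hA, hB, sub_mul, Finset.sum_mul]
  rw [hR]
  have hP : ∀ k ∈ Finset.range (N + 1), (((t ^ (k + n) : ℝ)⁻¹ : ℝ) : ℂ) * Pfrak n (fun y => g y) k ξ =
      (((t ^ n)⁻¹ : ℝ) : ℂ) * ∫ x, B k x := by
    intro k _
    rw [(Pfrak_eq n _ ξ h hh k).2]
    simp only [hBe]
    rw [integral_const_mul (((t : ℂ) ^ k)⁻¹ * (Complex.I ^ k / (k.factorial : ℂ)))]
    push_cast
    rw [pow_add, mul_inv]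
    ring
  rw [Finset.sum_congr rfl hP, ← Finset.mul_sum]
  ring
end
end

section
/- Let n ≥ 1 be an integer and let f be a Schwartz function on ℝ with Fourier transform f̂. Then for every ξ ∈ ℝ and every σ ∈ ℝ^{2n}, ℱ_η^{-1}[𝒩ⁿ[f̂](ξ,·)](σ) = (2π)^{-1/2} e^{i ξ (σ₁ + ⋯ + σ_{2n})} ∫_ℝ e^{-i ξ x} ℳⁿ[f](x,σ) dx. -/
noncomputable section

open MeasureTheory Real Finset
open scoped ENNReal

/-- The physical-space multilinear expression `ℳⁿ[f](x,σ)` (with the convention `σ₀ = 0`,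
empty sums being `0`). -/
def Mn (n : ℕ) (f : ℝ → ℂ) (x : ℝ) (σ : Fin (2 * n) → ℝ) : ℂ :=
  (∏ j ∈ Finset.Icc 1 n,
    f (x - coordOf σ (2 * j) - (∑ k ∈ Finset.Icc 1 (2 * (j - 1)), coordOf σ k) -
        ∑ k ∈ Finset.Icc j (n - 1), coordOf σ (2 * k + 1)) *
      (starRingEnd ℂ) (f (x - (∑ k ∈ Finset.Icc 1 (2 * (j - 1)), coordOf σ k) -
        ∑ k ∈ Finset.Icc j (n - 1), coordOf σ (2 * k + 1)))) *
  f (x - ∑ k ∈ Finset.range n, coordOf σ (2 * k + 1))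

/-- Fourier transform `φ̂(ξ) = (2π)^{-1/2} ∫ e^{-ixξ} φ(x) dx`. -/
def FT (φ : ℝ → ℂ) (ξ : ℝ) : ℂ :=
  (((Real.sqrt (2 * Real.pi))⁻¹ : ℝ) : ℂ) *
    ∫ x : ℝ, Complex.exp (-Complex.I * (x : ℂ) * (ξ : ℂ)) * φ x


open FourierTransform in
lemma FT_eq_fourier (f : ℝ → ℂ) (a : ℝ) :
    FT f a = (((Real.sqrt (2 * Real.pi))⁻¹ : ℝ) : ℂ) * 𝓕 f (a / (2 * π)) := by
  unfold FT
  rw [Real.fourier_real_eq_integral_exp_smul]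
  congr 1
  apply integral_congr_ae
  filter_upwards with x
  rw [smul_eq_mul]
  congr 2
  have : (π : ℂ) ≠ 0 := by exact_mod_cast Real.pi_ne_zero
  push_cast
  field_simp

open FourierTransform in
lemma FT_schwartz_eq (f : SchwartzMap ℝ ℂ) :
    FT (fun y => f y) = fun a => (((Real.sqrt (2 * Real.pi))⁻¹ : ℝ) : ℂ) *
      (𝓕 f : SchwartzMap ℝ ℂ) (a / (2 * π)) := by
  ext a
  rw [FT_eq_fourier, SchwartzMap.fourier_coe]

lemma FT_continuous (f : SchwartzMap ℝ ℂ) : Continuous (FT (fun y => f y)) := by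
  rw [FT_schwartz_eq]
  have := (FourierTransform.fourier f : SchwartzMap ℝ ℂ).continuous
  fun_prop

lemma FT_integrable (f : SchwartzMap ℝ ℂ) : Integrable (FT (fun y => f y)) := by
  rw [FT_schwartz_eq]
  have := (FourierTransform.fourier f : SchwartzMap ℝ ℂ).integrable (μ := volume)
  exact (this.comp_div (by positivity)).const_mul _

lemma FT_bounded (f : SchwartzMap ℝ ℂ) : ∃ C : NNReal, ∀ a, ‖FT (fun y => f y) a‖ₑ ≤ C := by
  rw [FT_schwartz_eq]
  obtain ⟨C, hC⟩ := (FourierTransform.fourier f : SchwartzMap ℝ ℂ).decay 0 0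
  simp only [pow_zero, one_mul, norm_iteratedFDeriv_zero] at hC
  refine ⟨((Real.sqrt (2 * Real.pi))⁻¹ * C).toNNReal, fun a => ?_⟩
  rw [← ofReal_norm]
  apply ENNReal.ofReal_le_ofReal
  rw [norm_mul, Complex.norm_real, Real.norm_of_nonneg (by positivity)]
  have := hC.2 (a / (2 * π))
  gcongr

lemma sqrt_two_pi_sq : (((Real.sqrt (2 * Real.pi)) : ℝ) : ℂ) * (((Real.sqrt (2 * Real.pi)) : ℝ) : ℂ)
    = 2 * π := by
  rw [← Complex.ofReal_mul, Real.mul_self_sqrt (by positivity)]; push_cast; rfl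

lemma sqrt_two_pi_ne : (((Real.sqrt (2 * Real.pi)) : ℝ) : ℂ) ≠ 0 := by
  have : Real.sqrt (2 * Real.pi) ≠ 0 := by positivity
  exact_mod_cast this

open FourierTransform in
lemma FT_inversion (f : SchwartzMap ℝ ℂ) (y : ℝ) :
    ∫ a : ℝ, Complex.exp (Complex.I * ((y * a : ℝ) : ℂ)) * FT (fun y => f y) a =
      ((Real.sqrt (2 * Real.pi) : ℝ) : ℂ) * f y := by
  rw [FT_schwartz_eq]
  have h1 : (𝓕⁻ (𝓕 f) : SchwartzMap ℝ ℂ) y = f y := by simp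
  rw [SchwartzMap.fourierInv_coe, Real.fourierInv_eq'] at h1
  have h2 := Measure.integral_comp_div (fun w : ℝ =>
    Complex.exp (Complex.I * ((y * (2 * π * w) : ℝ) : ℂ)) *
      ((((Real.sqrt (2 * Real.pi))⁻¹ : ℝ) : ℂ) * (𝓕 f : SchwartzMap ℝ ℂ) w)) (2 * π)
  have h3 : ∀ x : ℝ, 2 * π * (x / (2 * π)) = x := fun x => by field_simp
  simp only [h3] at h2
  rw [h2, ← h1, ← integral_const_mul, abs_of_pos (by positivity), ← integral_smul]
  apply integral_congr_ae
  filter_upwards with w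
  rw [smul_eq_mul, Complex.real_smul]
  have e : Complex.exp (Complex.I * ((y * (2 * π * w) : ℝ) : ℂ)) =
      Complex.exp (↑(2 * π * inner ℝ w y) * Complex.I) := by
    congr 1
    simp
    ring
  rw [e]
  have h := sqrt_two_pi_ne
  have h' := sqrt_two_pi_sq
  push_cast at h h' ⊢
  rw [← h']
  field_simp

lemma exp_norm_one (x : ℝ) : ‖Complex.exp (Complex.I * (x : ℂ))‖ = 1 := by
  rw [mul_comm]; exact Complex.norm_exp_ofReal_mul_I x

lemma conj_FT (f : ℝ → ℂ) (c : ℝ) : (starRingEnd ℂ) (FT f c) =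
    (((Real.sqrt (2 * Real.pi))⁻¹ : ℝ) : ℂ) *
      ∫ x : ℝ, Complex.exp (Complex.I * ((x * c : ℝ) : ℂ)) * (starRingEnd ℂ) (f x) := by
  unfold FT
  rw [map_mul, Complex.conj_ofReal, ← integral_conj]
  congr 2
  ext x
  rw [map_mul, ← Complex.exp_conj]
  congr 2
  simp
  ring

/-- The trilinear identity. -/
lemma trilinear (f h : SchwartzMap ℝ ℂ) (ξ s t : ℝ) :
    ∫ b : ℝ, ∫ a : ℝ, Complex.exp (Complex.I * ((s * a + t * b : ℝ) : ℂ)) *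
      (FT (fun y => f y) (ξ - b) * (starRingEnd ℂ) (FT (fun y => f y) (ξ - a - b)) *
        FT (fun y => h y) (ξ - a)) =
    (2 * π : ℂ) * Complex.exp (Complex.I * ((ξ * (s + t) : ℝ) : ℂ)) *
      FT (fun x => f (x - t) * (starRingEnd ℂ) (f x) * h (x - s)) ξ := by
  set c : ℂ := (((Real.sqrt (2 * Real.pi))⁻¹ : ℝ) : ℂ) with hc
  -- the triple integrand
  let T : (ℝ × ℝ) × ℝ → ℂ := fun p =>
    Complex.exp (Complex.I * ((-(s * p.1.2) - t * p.1.1 + p.2 * (p.1.1 + p.1.2 - ξ) : ℝ) : ℂ)) *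
      ((FT (fun y => f y) p.1.1 * FT (fun y => h y) p.1.2) * (starRingEnd ℂ) (f p.2))
  have hconj : Integrable (fun x => (starRingEnd ℂ) (f x)) := by
    have := f.integrable (μ := volume)
    exact (LinearIsometryEquiv.integrable_comp_iff Complex.conjLIE).2 this
  have hT : Integrable T ((volume.prod volume).prod volume) := by
    have h1 := ((FT_integrable f).mul_prod (FT_integrable h)).mul_prod hconj
    refine h1.bdd_mul (c := 1) ?_ ?_
    · apply Continuous.aestronglyMeasurable
      fun_prop
    · filter_upwards with p
      exact (exp_norm_one _).le
  have hstep : ∀ b a : ℝ, Complex.exp (Complex.I * ((s * (ξ - a) + t * (ξ - b) : ℝ) : ℂ)) *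
      (FT (fun y => f y) b * (starRingEnd ℂ) (FT (fun y => f y) (a + b - ξ)) *
        FT (fun y => h y) a) =
      Complex.exp (Complex.I * ((ξ * (s + t) : ℝ) : ℂ)) * c * ∫ x, T ((b, a), x) := by
    intro b a
    rw [conj_FT, ← hc]
    have : ∀ x, T ((b, a), x) = (Complex.exp (Complex.I * ((-(s * a) - t * b : ℝ) : ℂ)) *
       (FT (fun y => f y) b * FT (fun y => h y) a)) *
       (Complex.exp (Complex.I * ((x * (a + b - ξ) : ℝ) : ℂ)) * (starRingEnd ℂ) (f x)) := by
      intro x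
      simp only [T]
      rw [Complex.ofReal_add, mul_add, Complex.exp_add, add_comm b a]
      ring
    simp_rw [this]
    rw [integral_const_mul]
    have e : Complex.exp (Complex.I * ((s * (ξ - a) + t * (ξ - b) : ℝ) : ℂ)) =
      Complex.exp (Complex.I * ((ξ * (s + t) : ℝ) : ℂ)) *
      Complex.exp (Complex.I * ((-(s * a) - t * b : ℝ) : ℂ)) := by
      rw [← Complex.exp_add]
      congr 1
      push_cast
      ring
    rw [e]
    ring
  have hL : (∫ b : ℝ, ∫ a : ℝ, Complex.exp (Complex.I * ((s * a + t * b : ℝ) : ℂ)) *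
      (FT (fun y => f y) (ξ - b) * (starRingEnd ℂ) (FT (fun y => f y) (ξ - a - b)) *
        FT (fun y => h y) (ξ - a))) =
      ∫ b : ℝ, ∫ a : ℝ, Complex.exp (Complex.I * ((s * (ξ - a) + t * (ξ - b) : ℝ) : ℂ)) *
      (FT (fun y => f y) b * (starRingEnd ℂ) (FT (fun y => f y) (a + b - ξ)) *
        FT (fun y => h y) a) := by
    rw [← integral_sub_left_eq_self _ _ ξ]
    congr 1
    ext b
    rw [← integral_sub_left_eq_self _ _ ξ]
    congr 1
    ext a
    rw [show ξ - (ξ - b) = b by ring, show ξ - (ξ - a) = a by ring,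
      show a - (ξ - b) = a + b - ξ by ring]
  rw [hL]
  simp_rw [hstep, integral_const_mul]
  have hF1 : (∫ b : ℝ, ∫ a : ℝ, ∫ x, T ((b, a), x)) = ∫ x, ∫ p : ℝ × ℝ, T (p, x) := by
    have := hT.integral_prod_left
    rw [← integral_prod (fun p : ℝ × ℝ => ∫ x, T (p, x)) this]
    exact integral_integral_swap hT
  rw [hF1]
  have hin : ∀ x, (∫ p : ℝ × ℝ, T (p, x)) = (2 * π : ℂ) *
      (Complex.exp (-Complex.I * (x : ℂ) * (ξ : ℂ)) *
       (f (x - t) * (starRingEnd ℂ) (f x) * h (x - s))) := by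
    intro x
    have e : ∀ p : ℝ × ℝ, T (p, x) =
      (Complex.exp (-Complex.I * (x : ℂ) * (ξ : ℂ)) * (starRingEnd ℂ) (f x)) *
      ((Complex.exp (Complex.I * (((x - t) * p.1 : ℝ) : ℂ)) * FT (fun y => f y) p.1) *
      (Complex.exp (Complex.I * (((x - s) * p.2 : ℝ) : ℂ)) * FT (fun y => h y) p.2)) := by
      intro p
      simp only [T]
      have e' : Complex.exp (Complex.I *
          ((-(s * p.2) - t * p.1 + x * (p.1 + p.2 - ξ) : ℝ) : ℂ)) =
          Complex.exp (-Complex.I * (x : ℂ) * (ξ : ℂ)) *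
          Complex.exp (Complex.I * (((x - t) * p.1 : ℝ) : ℂ)) *
          Complex.exp (Complex.I * (((x - s) * p.2 : ℝ) : ℂ)) := by
        rw [← Complex.exp_add, ← Complex.exp_add]
        congr 1
        push_cast
        ring
      rw [e']
      ring
    simp_rw [e]
    rw [integral_const_mul]
    have := integral_prod_mul (μ := (volume : Measure ℝ)) (ν := (volume : Measure ℝ))
      (fun a => Complex.exp (Complex.I * (((x - t) * a : ℝ) : ℂ)) * FT (fun y => f y) a)
      (fun a => Complex.exp (Complex.I * (((x - s) * a : ℝ) : ℂ)) * FT (fun y => h y) a)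
    rw [← Measure.volume_eq_prod] at this
    rw [this, FT_inversion, FT_inversion, ← sqrt_two_pi_sq]
    ring
  simp_rw [hin]
  rw [integral_const_mul]
  unfold FT
  ring

/-- Append two coordinates. -/
def ext2 (n : ℕ) (η : Fin (2 * n) → ℝ) (a b : ℝ) : Fin (2 * (n + 1)) → ℝ :=
  Fin.snoc (α := fun _ : Fin (2 * n + 1 + 1) => ℝ)
    (Fin.snoc (α := fun _ : Fin (2 * n + 1) => ℝ) η a) b

lemma coordOf_snoc_lt {m : ℕ} (η : Fin m → ℝ) (a : ℝ) (j : ℕ) (hj : j - 1 < m) :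
    coordOf (Fin.snoc (α := fun _ : Fin (m + 1) => ℝ) η a) j = coordOf η j := by
  unfold coordOf
  rw [dif_pos (by omega), dif_pos hj]
  simp [Fin.snoc, hj]

lemma coordOf_snoc_last {m : ℕ} (η : Fin m → ℝ) (a : ℝ) :
    coordOf (Fin.snoc (α := fun _ : Fin (m + 1) => ℝ) η a) (m + 1) = a := by
  unfold coordOf
  rw [dif_pos (by omega)]
  simp [Fin.snoc]

lemma coordOf_ext2_lt (n : ℕ) (η : Fin (2 * n) → ℝ) (a b : ℝ) (j : ℕ) (hj : j - 1 < 2 * n) :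
    coordOf (ext2 n η a b) j = coordOf η j := by
  have h1 := coordOf_snoc_lt (Fin.snoc (α := fun _ : Fin (2 * n + 1) => ℝ) η a) b j (by omega)
  exact h1.trans (coordOf_snoc_lt η a j hj)

lemma coordOf_ext2_a (n : ℕ) (η : Fin (2 * n) → ℝ) (a b : ℝ) (j : ℕ) (hj : j = 2 * n + 1) :
    coordOf (ext2 n η a b) j = a := by
  subst hj
  have h1 := coordOf_snoc_lt (Fin.snoc (α := fun _ : Fin (2 * n + 1) => ℝ) η a) b (2 * n + 1)
    (by omega)
  exact h1.trans (coordOf_snoc_last η a)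

lemma coordOf_ext2_b (n : ℕ) (η : Fin (2 * n) → ℝ) (a b : ℝ) (j : ℕ) (hj : j = 2 * n + 2) :
    coordOf (ext2 n η a b) j = b := by
  subst hj
  exact coordOf_snoc_last (Fin.snoc (α := fun _ : Fin (2 * n + 1) => ℝ) η a) b

lemma sum_ext2 (n : ℕ) (η : Fin (2 * n) → ℝ) (a b : ℝ) :
    ∑ j, ext2 n η a b j = ∑ j, η j + a + b := by
  have h : ∑ j : Fin (2 * n + 1 + 1), (ext2 n η a b : Fin (2 * n + 1 + 1) → ℝ) j
      = ∑ j, η j + a + b := by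
    rw [Fin.sum_univ_castSucc, Fin.sum_univ_castSucc]
    simp [ext2]
  exact h

lemma sum_mul_ext2 (n : ℕ) (η σ : Fin (2 * n) → ℝ) (a b s t : ℝ) :
    ∑ j, ext2 n σ s t j * ext2 n η a b j = ∑ j, σ j * η j + (s * a + t * b) := by
  have h : ∑ j : Fin (2 * n + 1 + 1), (ext2 n σ s t : Fin (2 * n + 1 + 1) → ℝ) j *
      (ext2 n η a b : Fin (2 * n + 1 + 1) → ℝ) j
      = ∑ j, σ j * η j + (s * a + t * b) := by
    rw [Fin.sum_univ_castSucc, Fin.sum_univ_castSucc]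
    simp [ext2]
    ring
  exact h

lemma exists_ext2 (n : ℕ) (σ : Fin (2 * (n + 1)) → ℝ) : ∃ σ' s t, σ = ext2 n σ' s t := by
  refine ⟨Fin.init (α := fun _ : Fin (2 * n + 1) => ℝ)
    (Fin.init (α := fun _ : Fin (2 * n + 1 + 1) => ℝ) σ),
    (Fin.init (α := fun _ : Fin (2 * n + 1 + 1) => ℝ) σ) (Fin.last _),
    (show Fin (2 * n + 1 + 1) → ℝ from σ) (Fin.last _), ?_⟩
  unfold ext2
  rw [Fin.snoc_init_self]
  exact (Fin.snoc_init_self (α := fun _ : Fin (2 * n + 1 + 1) => ℝ) σ).symm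

lemma sum_coordOf {m : ℕ} (σ : Fin m → ℝ) : ∑ k ∈ Finset.Icc 1 m, coordOf σ k = ∑ j, σ j := by
  induction m with
  | zero => simp
  | succ m ih =>
    obtain ⟨σ', s, rfl⟩ : ∃ σ' s, σ = Fin.snoc (α := fun _ : Fin (m + 1) => ℝ) σ' s :=
      ⟨_, _, (Fin.snoc_init_self (α := fun _ : Fin (m + 1) => ℝ) σ).symm⟩
    rw [Finset.sum_Icc_succ_top (by omega), coordOf_snoc_last, Fin.sum_univ_castSucc]
    simp only [Fin.snoc_castSucc, Fin.snoc_last]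
    rw [← ih σ']
    congr 1
    apply Finset.sum_congr rfl
    intro k hk
    rw [Finset.mem_Icc] at hk
    exact coordOf_snoc_lt _ _ _ (by omega)

/-- Variant of `Nn` valid also for `n = 0`. -/
def Npr (n : ℕ) (g : ℝ → ℂ) (ξ : ℝ) (η : Fin (2 * n) → ℝ) : ℂ :=
  (∏ i ∈ Finset.Icc 1 n,
    g (Hf n ξ η (i + 1) - coordOf η (2 * i)) *
      (starRingEnd ℂ) (g (Hf n ξ η i - coordOf η (2 * i)))) *
  g (Hf n ξ η 1)

lemma Nn_eq_Npr (n : ℕ) (hn : 1 ≤ n) (g : ℝ → ℂ) (ξ : ℝ) (η : Fin (2 * n) → ℝ) :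
    Nn n g ξ η = Npr n g ξ η := by
  obtain ⟨m, rfl⟩ : ∃ m, n = m + 1 := ⟨n - 1, by omega⟩
  unfold Nn Npr
  rw [Finset.prod_Icc_succ_top (by omega)]
  have : Hf (m + 1) ξ η (m + 1 + 1) = ξ := by simp [Hf]
  rw [this, Nat.add_sub_cancel]
  ring

lemma Hf_ext2 (n : ℕ) (ξ : ℝ) (η : Fin (2 * n) → ℝ) (a b : ℝ) (i : ℕ) (h0 : 1 ≤ i)
    (hi : i ≤ n + 1) :
    Hf (n + 1) ξ (ext2 n η a b) i = Hf n (ξ - a) η i := by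
  unfold Hf
  rw [Finset.sum_Icc_succ_top hi, coordOf_ext2_a n η a b _ (by omega)]
  have : ∑ k ∈ Finset.Icc i n, coordOf (ext2 n η a b) (2 * k - 1) =
      ∑ k ∈ Finset.Icc i n, coordOf η (2 * k - 1) := by
    apply Finset.sum_congr rfl
    intro k hk
    rw [Finset.mem_Icc] at hk
    exact coordOf_ext2_lt _ _ _ _ _ (by omega)
  rw [this]
  ring

lemma Npr_ext2 (n : ℕ) (g : ℝ → ℂ) (ξ : ℝ) (η : Fin (2 * n) → ℝ) (a b : ℝ) :
    Npr (n + 1) g ξ (ext2 n η a b) =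
      g (ξ - b) * (starRingEnd ℂ) (g (ξ - a - b)) * Npr n g (ξ - a) η := by
  unfold Npr
  rw [Finset.prod_Icc_succ_top (by omega), coordOf_ext2_b n η a b _ (by omega),
    Hf_ext2 _ _ _ _ _ 1 (by omega) (by omega), Hf_ext2 _ _ _ _ _ (n + 1) (by omega) (by omega)]
  have h1 : Hf (n + 1) ξ (ext2 n η a b) (n + 1 + 1) = ξ := by simp [Hf]
  have h2 : Hf n (ξ - a) η (n + 1) = ξ - a := by simp [Hf]
  rw [h1, h2]
  have : ∏ i ∈ Finset.Icc 1 n,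
      g (Hf (n + 1) ξ (ext2 n η a b) (i + 1) - coordOf (ext2 n η a b) (2 * i)) *
      (starRingEnd ℂ) (g (Hf (n + 1) ξ (ext2 n η a b) i - coordOf (ext2 n η a b) (2 * i))) =
      ∏ i ∈ Finset.Icc 1 n, g (Hf n (ξ - a) η (i + 1) - coordOf η (2 * i)) *
      (starRingEnd ℂ) (g (Hf n (ξ - a) η i - coordOf η (2 * i))) := by
    apply Finset.prod_congr rfl
    intro i hi
    rw [Finset.mem_Icc] at hi
    rw [Hf_ext2 _ _ _ _ _ i (by omega) (by omega), Hf_ext2 _ _ _ _ _ (i + 1) (by omega) (by omega),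
      coordOf_ext2_lt _ _ _ _ _ (by omega)]
  rw [this]
  ring

lemma Mn_ext2 (n : ℕ) (f : ℝ → ℂ) (x : ℝ) (σ : Fin (2 * n) → ℝ) (s t : ℝ) :
    Mn (n + 1) f x (ext2 n σ s t) =
      f (x - ∑ j, σ j - t) * (starRingEnd ℂ) (f (x - ∑ j, σ j)) * Mn n f (x - s) σ := by
  have hsum : ∀ m, m ≤ 2 * n → ∑ k ∈ Finset.Icc 1 m, coordOf (ext2 n σ s t) k =
      ∑ k ∈ Finset.Icc 1 m, coordOf σ k := by
    intro m hm
    apply Finset.sum_congr rfl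
    intro k hk
    rw [Finset.mem_Icc] at hk
    exact coordOf_ext2_lt _ _ _ _ _ (by omega)
  unfold Mn
  rw [Finset.prod_Icc_succ_top (by omega), coordOf_ext2_b n σ s t _ (by omega),
    Nat.add_sub_cancel, hsum _ le_rfl, sum_coordOf, Finset.Icc_eq_empty (by omega : ¬ n + 1 ≤ n),
    Finset.sum_empty, Finset.sum_range_succ, coordOf_ext2_a n σ s t _ rfl]
  have hr : ∑ k ∈ Finset.range n, coordOf (ext2 n σ s t) (2 * k + 1) =
      ∑ k ∈ Finset.range n, coordOf σ (2 * k + 1) := by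
    apply Finset.sum_congr rfl
    intro k hk
    rw [Finset.mem_range] at hk
    exact coordOf_ext2_lt _ _ _ _ _ (by omega)
  rw [hr]
  have hp : ∀ j ∈ Finset.Icc 1 n, ∑ k ∈ Finset.Icc j n, coordOf (ext2 n σ s t) (2 * k + 1) =
      ∑ k ∈ Finset.Icc j (n - 1), coordOf σ (2 * k + 1) + s := by
    intro j hj
    rw [Finset.mem_Icc] at hj
    obtain ⟨m, rfl⟩ : ∃ m, n = m + 1 := ⟨n - 1, by omega⟩
    rw [Finset.sum_Icc_succ_top (by omega), coordOf_ext2_a _ σ s t _ rfl, Nat.add_sub_cancel]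
    congr 1
    apply Finset.sum_congr rfl
    intro k hk
    rw [Finset.mem_Icc] at hk
    exact coordOf_ext2_lt _ _ _ _ _ (by omega)
  have hprod : ∏ j ∈ Finset.Icc 1 n,
      f (x - coordOf (ext2 n σ s t) (2 * j) -
          (∑ k ∈ Finset.Icc 1 (2 * (j - 1)), coordOf (ext2 n σ s t) k) -
          ∑ k ∈ Finset.Icc j n, coordOf (ext2 n σ s t) (2 * k + 1)) *
        (starRingEnd ℂ) (f (x - (∑ k ∈ Finset.Icc 1 (2 * (j - 1)), coordOf (ext2 n σ s t) k) -
          ∑ k ∈ Finset.Icc j n, coordOf (ext2 n σ s t) (2 * k + 1))) =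
      ∏ j ∈ Finset.Icc 1 n,
      f (x - s - coordOf σ (2 * j) - (∑ k ∈ Finset.Icc 1 (2 * (j - 1)), coordOf σ k) -
          ∑ k ∈ Finset.Icc j (n - 1), coordOf σ (2 * k + 1)) *
        (starRingEnd ℂ) (f (x - s - (∑ k ∈ Finset.Icc 1 (2 * (j - 1)), coordOf σ k) -
          ∑ k ∈ Finset.Icc j (n - 1), coordOf σ (2 * k + 1))) := by
    apply Finset.prod_congr rfl
    intro j hj
    rw [hp j hj]
    rw [Finset.mem_Icc] at hj
    rw [hsum _ (by omega), coordOf_ext2_lt _ _ _ _ _ (by omega)]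
    congr 2
    · ring
    · congr 1
      ring
  rw [hprod]
  rw [show ∀ A S : ℝ, x - (S + A) = x - A - S from fun A S => by ring]
  rw [show x - t - ∑ j, σ j - 0 = x - ∑ j, σ j - t by ring,
    show x - ∑ j, σ j - 0 = x - ∑ j, σ j by ring]
  ring

lemma continuous_coordOf {m : ℕ} (j : ℕ) : Continuous (fun η : Fin m → ℝ => coordOf η j) := by
  unfold coordOf
  by_cases h : j - 1 < m
  · simp only [h, dif_pos]
    fun_prop
  · simp only [h, dif_neg, not_false_eq_true]
    fun_prop

lemma continuous_Hf (n : ℕ) (i : ℕ) :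
    Continuous (fun p : ℝ × (Fin (2 * n) → ℝ) => Hf n p.1 p.2 i) := by
  unfold Hf
  refine continuous_fst.sub (continuous_finsetSum _ fun k _ => ?_)
  exact (continuous_coordOf _).comp continuous_snd

lemma continuous_Npr (n : ℕ) (g : ℝ → ℂ) (hg : Continuous g) :
    Continuous (fun p : ℝ × (Fin (2 * n) → ℝ) => Npr n g p.1 p.2) := by
  unfold Npr
  have hH := continuous_Hf n
  have hc : ∀ j, Continuous (fun p : ℝ × (Fin (2 * n) → ℝ) => coordOf p.2 j) :=
    fun j => (continuous_coordOf _).comp continuous_snd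
  refine (continuous_finsetProd _ fun i _ => ?_).mul (hg.comp (hH 1))
  exact (hg.comp ((hH _).sub (hc _))).mul
    (Complex.continuous_conj.comp (hg.comp ((hH _).sub (hc _))))

lemma continuous_Npr' (n : ℕ) (g : ℝ → ℂ) (hg : Continuous g) (ξ : ℝ) :
    Continuous (fun η : Fin (2 * n) → ℝ => Npr n g ξ η) := by
  have h : Continuous fun η : Fin (2 * n) → ℝ => (ξ, η) := by fun_prop
  have h1 := (continuous_Npr n g hg).comp h
  simpa only [Function.comp_def] using h1

/-- The measurable equivalence splitting off the last two coordinates. -/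
def splitEquiv (n : ℕ) : (Fin (2 * (n + 1)) → ℝ) ≃ᵐ ℝ × (ℝ × (Fin (2 * n) → ℝ)) :=
  (MeasurableEquiv.piFinSuccAbove (fun _ : Fin (2 * n + 1 + 1) => ℝ) (Fin.last _)).trans
    ((MeasurableEquiv.refl ℝ).prodCongr
      (MeasurableEquiv.piFinSuccAbove (fun _ : Fin (2 * n + 1) => ℝ) (Fin.last _)))

lemma splitEquiv_symm (n : ℕ) (p : ℝ × (ℝ × (Fin (2 * n) → ℝ))) :
    (splitEquiv n).symm p = ext2 n p.2.2 p.2.1 p.1 := by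
  obtain ⟨b, a, η⟩ := p
  have : (splitEquiv n).symm (b, a, η) =
    Fin.insertNth (α := fun _ : Fin (2 * n + 1 + 1) => ℝ) (Fin.last _) b
     (Fin.insertNth (α := fun _ : Fin (2 * n + 1) => ℝ) (Fin.last _) a η) := rfl
  rw [this, Fin.insertNth_last', Fin.insertNth_last']
  rfl

lemma splitEquiv_mp (n : ℕ) : MeasurePreserving (splitEquiv n) := by
  have h1 := volume_preserving_piFinSuccAbove (fun _ : Fin (2 * n + 1 + 1) => ℝ) (Fin.last _)
  have h2 := volume_preserving_piFinSuccAbove (fun _ : Fin (2 * n + 1) => ℝ) (Fin.last _)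
  have h3 := (MeasurePreserving.id (volume : Measure ℝ)).prod h2
  exact h3.comp h1

lemma integral_ext2 (n : ℕ) (F : (Fin (2 * (n + 1)) → ℝ) → ℂ) :
    ∫ η, F η = ∫ p : ℝ × (ℝ × (Fin (2 * n) → ℝ)), F (ext2 n p.2.2 p.2.1 p.1) := by
  rw [← (splitEquiv_mp n).symm.integral_comp']
  simp_rw [splitEquiv_symm]

lemma lintegral_ext2 (n : ℕ) (F : (Fin (2 * (n + 1)) → ℝ) → ℝ≥0∞) :
    ∫⁻ η, F η = ∫⁻ p : ℝ × (ℝ × (Fin (2 * n) → ℝ)), F (ext2 n p.2.2 p.2.1 p.1) := by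
  rw [← (splitEquiv_mp n).symm.lintegral_comp_emb (splitEquiv n).symm.measurableEmbedding]
  simp_rw [splitEquiv_symm]

lemma integrable_ext2 (n : ℕ) (F : (Fin (2 * (n + 1)) → ℝ) → ℂ) (hF : Integrable F) :
    Integrable (fun p : ℝ × (ℝ × (Fin (2 * n) → ℝ)) => F (ext2 n p.2.2 p.2.1 p.1)) := by
  have := ((splitEquiv_mp n).symm.integrable_comp_emb (splitEquiv n).symm.measurableEmbedding
    (g := F)).2 hF
  refine this.congr ?_
  filter_upwards with p
  simp [splitEquiv_symm]

lemma lintegral_Npr (n : ℕ) (g : ℝ → ℂ) (hg : Continuous g) (hi : Integrable g)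
    (hb : ∃ C : NNReal, ∀ a, ‖g a‖ₑ ≤ C) :
    ∃ C : ℝ≥0∞, C ≠ ⊤ ∧ ∀ ξ, ∫⁻ η, ‖Npr n g ξ η‖ₑ ≤ C := by
  induction n with
  | zero =>
    obtain ⟨C, hC⟩ := hb
    refine ⟨C, ENNReal.coe_ne_top, fun ξ => ?_⟩
    refine (lintegral_mono (g := fun _ => (C : ℝ≥0∞)) fun η => ?_).trans ?_
    · simpa [Npr] using hC _
    · have : IsEmpty (Fin (2 * 0)) := inferInstanceAs (IsEmpty (Fin 0))
      rw [lintegral_const, volume_pi, Measure.pi_of_empty]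
      simp
  | succ n ih =>
    obtain ⟨C, hC, h⟩ := ih
    refine ⟨(∫⁻ a, ‖g a‖ₑ) * (∫⁻ a, ‖g a‖ₑ) * C, ?_, fun ξ => ?_⟩
    · have : ∫⁻ a, ‖g a‖ₑ ≠ ⊤ := hi.2.ne
      exact ENNReal.mul_ne_top (ENNReal.mul_ne_top this this) hC
    rw [lintegral_ext2]
    simp_rw [Npr_ext2]
    have hmeas : Continuous (fun p : ℝ × (ℝ × (Fin (2 * n) → ℝ)) =>
        ‖g (ξ - p.1) * (starRingEnd ℂ) (g (ξ - p.2.1 - p.1)) * Npr n g (ξ - p.2.1) p.2.2‖ₑ) := by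
      have h1 := (continuous_Npr n g hg).comp (by fun_prop :
        Continuous fun p : ℝ × (ℝ × (Fin (2 * n) → ℝ)) => (ξ - p.2.1, p.2.2))
      have h2 : Continuous fun p : ℝ × (ℝ × (Fin (2 * n) → ℝ)) => Npr n g (ξ - p.2.1) p.2.2 := h1
      have h3 := Complex.continuous_conj
      fun_prop
    rw [Measure.volume_eq_prod, lintegral_prod _ hmeas.measurable.aemeasurable]
    have hin : ∀ b : ℝ, ∫⁻ q : ℝ × (Fin (2 * n) → ℝ),
        ‖g (ξ - b) * (starRingEnd ℂ) (g (ξ - q.1 - b)) * Npr n g (ξ - q.1) q.2‖ₑ ≤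
        ‖g (ξ - b)‖ₑ * ((∫⁻ a, ‖g a‖ₑ) * C) := by
      intro b
      have hm := hmeas.comp (by fun_prop : Continuous fun q : ℝ × (Fin (2 * n) → ℝ) => (b, q))
      simp only [Function.comp_def] at hm
      rw [Measure.volume_eq_prod, lintegral_prod _ hm.measurable.aemeasurable]
      have hin2 : ∀ a : ℝ, ∫⁻ η : Fin (2 * n) → ℝ,
          ‖g (ξ - b) * (starRingEnd ℂ) (g (ξ - a - b)) * Npr n g (ξ - a) η‖ₑ ≤
          (‖g (ξ - b)‖ₑ * C) * ‖g (ξ - b - a)‖ₑ := by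
        intro a
        simp_rw [enorm_mul]
        rw [lintegral_const_mul _ (continuous_Npr' n g hg _).enorm.measurable]
        have hc : ‖(starRingEnd ℂ) (g (ξ - a - b))‖ₑ = ‖g (ξ - b - a)‖ₑ := by
          rw [← ofReal_norm, RCLike.norm_conj, ofReal_norm]
          congr 2
          ring
        rw [hc]
        calc _ ≤ ‖g (ξ - b)‖ₑ * ‖g (ξ - b - a)‖ₑ * C := by
              gcongr
              exact h _
          _ = _ := by ring
      refine (lintegral_mono hin2).trans ?_
      rw [lintegral_const_mul _
        ((by fun_prop : Continuous fun a => ‖g (ξ - b - a)‖ₑ).measurable),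
        lintegral_sub_left_eq_self (fun a => ‖g a‖ₑ) (ξ - b)]
      apply le_of_eq
      ring
    refine (lintegral_mono hin).trans ?_
    rw [lintegral_mul_const _
      ((by fun_prop : Continuous fun a => ‖g (ξ - a)‖ₑ).measurable), lintegral_sub_left_eq_self (fun a => ‖g a‖ₑ) ξ]
    apply le_of_eq
    ring

lemma integrable_Npr (n : ℕ) (f : SchwartzMap ℝ ℂ) (ξ : ℝ) :
    Integrable (fun η => Npr n (FT (fun y => f y)) ξ η) := by
  obtain ⟨C, hC, h⟩ := lintegral_Npr n _ (FT_continuous f) (FT_integrable f) (FT_bounded f)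
  exact ⟨(continuous_Npr' n _ (FT_continuous f) ξ).aestronglyMeasurable,
    (h ξ).trans_lt hC.lt_top⟩

lemma FT_shift (φ : ℝ → ℂ) (S ξ : ℝ) :
    Complex.exp (Complex.I * ((ξ * S : ℝ) : ℂ)) * FT φ ξ = FT (fun x => φ (x + S)) ξ := by
  unfold FT
  rw [← integral_add_right_eq_self (fun x : ℝ => Complex.exp (-Complex.I * (x : ℂ) * (ξ : ℂ)) * φ x) S,
    mul_left_comm, ← integral_const_mul]
  congr 2
  ext x
  rw [← mul_assoc, ← Complex.exp_add]
  congr 2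
  push_cast
  ring

lemma mul_schwartz (f g : SchwartzMap ℝ ℂ) : ∃ h : SchwartzMap ℝ ℂ, ∀ x, h x = f x * g x :=
  ⟨SchwartzMap.pairing (ContinuousLinearMap.mul ℂ ℂ) f g, fun x => by
    simp [SchwartzMap.pairing_apply_apply]⟩

lemma conj_schwartz (f : SchwartzMap ℝ ℂ) :
    ∃ h : SchwartzMap ℝ ℂ, ∀ x, h x = (starRingEnd ℂ) (f x) :=
  ⟨SchwartzMap.postcompCLM (𝕜 := ℝ) (Complex.conjCLE : ℂ →L[ℝ] ℂ) f, fun x => by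
    simp [SchwartzMap.postcompCLM_apply]⟩

lemma shift_schwartz (f : SchwartzMap ℝ ℂ) (a : ℝ) :
    ∃ h : SchwartzMap ℝ ℂ, ∀ x, h x = f (x - a) :=
  ⟨SchwartzMap.compSubConstCLM ℂ a f, fun x => by simp⟩

lemma Mn_schwartz (n : ℕ) (f : SchwartzMap ℝ ℂ) (σ : Fin (2 * n) → ℝ) :
    ∃ h : SchwartzMap ℝ ℂ, ∀ x, h x = Mn n (fun y => f y) x σ := by
  induction n with
  | zero => exact ⟨f, fun x => by simp [Mn]⟩
  | succ n ih =>
    obtain ⟨σ', s, t, rfl⟩ := exists_ext2 n σ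
    obtain ⟨h, hh⟩ := ih σ'
    obtain ⟨h1, hh1⟩ := shift_schwartz h s
    obtain ⟨f1, hf1⟩ := shift_schwartz f (∑ j, σ' j)
    obtain ⟨f2, hf2⟩ := conj_schwartz f1
    obtain ⟨f3, hf3⟩ := shift_schwartz f (∑ j, σ' j + t)
    obtain ⟨p, hp⟩ := mul_schwartz f3 f2
    obtain ⟨q, hq⟩ := mul_schwartz p h1
    refine ⟨q, fun x => ?_⟩
    rw [Mn_ext2, hq, hp, hf3, hf2, hf1, hh1, hh, ← sub_sub]

lemma main_Npr (n : ℕ) (f : SchwartzMap ℝ ℂ) (ξ : ℝ) (σ : Fin (2 * n) → ℝ) :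
    ∫ η : Fin (2 * n) → ℝ, Complex.exp (Complex.I * ((∑ j, σ j * η j : ℝ) : ℂ)) *
      Npr n (FT (fun y => f y)) ξ η =
    (2 * π : ℂ) ^ n * (Complex.exp (Complex.I * ((ξ * ∑ j, σ j : ℝ) : ℂ)) *
      FT (fun x => Mn n (fun y => f y) x σ) ξ) := by
  induction n generalizing ξ with
  | zero =>
    have : IsEmpty (Fin (2 * 0)) := inferInstanceAs (IsEmpty (Fin 0))
    rw [volume_pi, Measure.pi_of_empty]
    simp [Npr, Hf, Mn]
  | succ n ih =>
    obtain ⟨σ, s, t, rfl⟩ := exists_ext2 n σ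
    have hint : Integrable (fun η : Fin (2 * (n + 1)) → ℝ =>
        Complex.exp (Complex.I * ((∑ j, ext2 n σ s t j * η j : ℝ) : ℂ)) *
        Npr (n + 1) (FT (fun y => f y)) ξ η) := by
      refine (integrable_Npr (n + 1) f ξ).bdd_mul (c := 1) ?_ ?_
      · apply Continuous.aestronglyMeasurable
        fun_prop
      · filter_upwards with p
        exact (exp_norm_one _).le
    have hint2 := integrable_ext2 n _ hint
    rw [integral_ext2, Measure.volume_eq_prod, integral_prod _ (by rwa [Measure.volume_eq_prod] at hint2)]
    obtain ⟨m, hm⟩ := Mn_schwartz n f σ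
    obtain ⟨h, hh⟩ := shift_schwartz m (-∑ j, σ j)
    have hhM : ∀ x, h x = Mn n (fun y => f y) (x + ∑ j, σ j) σ := by
      intro x
      rw [hh, hm, sub_neg_eq_add]
    have hstep : ∀ᵐ b : ℝ, (∫ q : ℝ × (Fin (2 * n) → ℝ),
        Complex.exp (Complex.I * ((∑ j, ext2 n σ s t j * ext2 n q.2 q.1 b j : ℝ) : ℂ)) *
        Npr (n + 1) (FT (fun y => f y)) ξ (ext2 n q.2 q.1 b)) =
        ∫ a : ℝ, (2 * π : ℂ) ^ n * (Complex.exp (Complex.I * ((s * a + t * b : ℝ) : ℂ)) *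
          (FT (fun y => f y) (ξ - b) * (starRingEnd ℂ) (FT (fun y => f y) (ξ - a - b)) *
            FT (fun y => h y) (ξ - a))) := by
      rw [Measure.volume_eq_prod] at hint2
      filter_upwards [hint2.prod_right_ae] with b hb
      rw [Measure.volume_eq_prod] at hb ⊢
      rw [integral_prod _ hb]
      congr 1
      ext a
      have e : ∀ η : Fin (2 * n) → ℝ,
        Complex.exp (Complex.I * ((∑ j, ext2 n σ s t j * ext2 n η a b j : ℝ) : ℂ)) *
        Npr (n + 1) (FT (fun y => f y)) ξ (ext2 n η a b) =
        (Complex.exp (Complex.I * ((s * a + t * b : ℝ) : ℂ)) *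
          (FT (fun y => f y) (ξ - b) * (starRingEnd ℂ) (FT (fun y => f y) (ξ - a - b)))) *
        (Complex.exp (Complex.I * ((∑ j, σ j * η j : ℝ) : ℂ)) *
          Npr n (FT (fun y => f y)) (ξ - a) η) := by
        intro η
        rw [sum_mul_ext2, Npr_ext2, Complex.ofReal_add, mul_add, Complex.exp_add]
        ring
      simp_rw [e]
      rw [integral_const_mul, ih, FT_shift]
      simp_rw [hhM]
      ring
    rw [integral_congr_ae hstep]
    simp_rw [integral_const_mul]
    rw [trilinear, sum_ext2]
    have e1 : Complex.exp (Complex.I * ((ξ * (∑ j, σ j + s + t) : ℝ) : ℂ)) =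
      Complex.exp (Complex.I * ((ξ * (s + t) : ℝ) : ℂ)) *
      Complex.exp (Complex.I * ((ξ * (∑ j, σ j) : ℝ) : ℂ)) := by
      rw [← Complex.exp_add]
      congr 1
      push_cast
      ring
    rw [e1, mul_assoc (Complex.exp _) (Complex.exp _), FT_shift]
    have e2 : (fun x => f (x - t) * (starRingEnd ℂ) (f x) * h (x - s)) =
      fun x => Mn (n + 1) (fun y => f y) (x + ∑ j, σ j) (ext2 n σ s t) := by
      ext x
      rw [Mn_ext2, hhM, add_sub_cancel_right, show x - s + ∑ j, σ j = x + ∑ j, σ j - s by ring]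
    rw [e2]
    ring

/-- `ℱ_η^{-1}[𝒩ⁿ[f̂](ξ,·)](σ) = (2π)^{-1/2} e^{iξ∑σⱼ} ∫ e^{-iξx} ℳⁿ[f](x,σ) dx`. -/
theorem statement4 (n : ℕ) (hn : 1 ≤ n) (f : SchwartzMap ℝ ℂ) (ξ : ℝ)
    (σ : Fin (2 * n) → ℝ) :
    invFTeta n (fun η => Nn n (FT (fun y => f y)) ξ η) σ =
      (((Real.sqrt (2 * Real.pi))⁻¹ : ℝ) : ℂ) *
        Complex.exp (Complex.I * ((ξ * ∑ j, σ j : ℝ) : ℂ)) *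
        ∫ x : ℝ, Complex.exp (-Complex.I * ((ξ * x : ℝ) : ℂ)) * Mn n (fun y => f y) x σ := by
  unfold invFTeta
  simp_rw [Nn_eq_Npr n hn]
  rw [main_Npr]
  unfold FT
  have hpi : (2 * π : ℂ) ≠ 0 := by
    have : (2 * π : ℝ) ≠ 0 := by positivity
    exact_mod_cast this
  have e : ∀ x : ℝ, Complex.exp (-Complex.I * ((ξ * x : ℝ) : ℂ)) =
      Complex.exp (-Complex.I * (x : ℂ) * (ξ : ℂ)) := by
    intro x
    congr 1
    push_cast
    ring
  simp_rw [e]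
  rw [← mul_assoc]
  have e2 : ((((2 * Real.pi) ^ n)⁻¹ : ℝ) : ℂ) * (2 * π : ℂ) ^ n = 1 := by
    push_cast
    exact inv_mul_cancel₀ (pow_ne_zero _ hpi)
  rw [e2]
  ring
end
end

section
/- For every integer n ≥ 1 and every real α ≥ 0 there is a constant C(n,α) such that, for every measurable f : ℝ → ℂ, ∫_ℝ ∫_{ℝ^{2n}} (Σ_{j=1}^{2n} |σ_j| + |x|)^α · |ℳⁿ[f](x,σ)| dσ dx ≤ C(n,α) ∫_{ℝ^{2n+1}} (Σ_{j=1}^{2n+1} |Y_j|)^α · ∏_{j=1}^{2n+1} |f(Y_j)| dY₁ ⋯ dY_{2n+1}; moreover, when α = 0 this holds with equality and C(n,0) = 1. -/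
noncomputable section

open MeasureTheory Real Finset
open scoped ENNReal

/-- extension of a vector by zero to a sequence -/
def extV {m : ℕ} (v : Fin m → ℝ) (k : ℕ) : ℝ := if h : k < m then v ⟨k, h⟩ else 0

/-- the points at which `f` is evaluated -/
def Yf (V : ℕ → ℝ) (i : ℕ) : ℝ :=
  V 0 + (if i = 0 then 0 else V (2 * ((i - 1) / 2) + 1)) - ∑ l ∈ Finset.range (i / 2), V (2 * l + 2)

lemma extV_add {m : ℕ} (v w : Fin m → ℝ) (k : ℕ) : extV (v + w) k = extV v k + extV w k := by
  unfold extV; split_ifs <;> simp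

lemma extV_smul {m : ℕ} (c : ℝ) (v : Fin m → ℝ) (k : ℕ) : extV (c • v) k = c * extV v k := by
  unfold extV; split_ifs <;> simp

lemma extV_single {m : ℕ} (j : Fin m) (k : ℕ) :
    extV (Pi.single j (1 : ℝ)) k = if k = (j : ℕ) then 1 else 0 := by
  unfold extV
  by_cases h : k < m
  · simp [h, Pi.single_apply, Fin.ext_iff]
  · have : k ≠ j := by have := j.2; omega
    simp [h, this]

lemma extV_abs_le {m : ℕ} (v : Fin m → ℝ) (k : ℕ) : |extV v k| ≤ ‖v‖ := by
  unfold extV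
  split_ifs with h
  · exact norm_le_pi_norm v ⟨k, h⟩
  · simp

/-- the linear change of variables -/
def Lmap (n : ℕ) : (Fin (2 * n + 1) → ℝ) →ₗ[ℝ] (Fin (2 * n + 1) → ℝ) where
  toFun v i := Yf (extV v) i
  map_add' v w := by
    ext i
    simp only [Yf, extV_add, Pi.add_apply, Finset.sum_add_distrib]
    split_ifs <;> ring
  map_smul' c v := by
    ext i
    simp only [Yf, extV_smul, Pi.smul_apply, ← Finset.mul_sum, smul_eq_mul, RingHom.id_apply]
    split_ifs <;> ring

lemma Lmap_apply (n : ℕ) (v : Fin (2 * n + 1) → ℝ) (i : Fin (2 * n + 1)) :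
    Lmap n v i = Yf (extV v) i := rfl

lemma Yf_congr_zero (V : ℕ → ℝ) (i : ℕ) (h : ∀ k ≤ i, V k = 0) : Yf V i = 0 := by
  unfold Yf
  rw [h 0 (by omega), Finset.sum_eq_zero]
  · split_ifs with h0
    · simp
    · rw [h _ (by omega)]; simp
  · intro l hl
    rw [Finset.mem_range] at hl
    exact h _ (by omega)

lemma Yf_diag (i : ℕ) : |Yf (fun k => if k = i then 1 else 0) i| = 1 := by
  unfold Yf
  rcases Nat.even_or_odd' i with ⟨j, rfl | rfl⟩
  · rcases j with _ | j
    · simp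
    · have h1 : 2 * (j + 1) / 2 = j + 1 := by omega
      have h2 : 2 * ((2 * (j + 1) - 1) / 2) + 1 ≠ 2 * (j + 1) := by omega
      have h3 : (0 : ℕ) ≠ 2 * (j + 1) := by omega
      have h4 : ∑ l ∈ Finset.range j, (if 2 * l + 2 = 2 * (j + 1) then (1 : ℝ) else 0) = 0 := by
        apply Finset.sum_eq_zero
        intro l hl
        rw [Finset.mem_range] at hl
        rw [if_neg (by omega)]
      beta_reduce
      rw [h1, Finset.sum_range_succ, h4, if_neg h2, if_neg h3, if_neg h3.symm,
        if_pos (by omega)]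
      norm_num
  · have h2 : 2 * ((2 * j + 1 - 1) / 2) + 1 = 2 * j + 1 := by omega
    have h4 : ∑ l ∈ Finset.range ((2 * j + 1) / 2),
        (if 2 * l + 2 = 2 * j + 1 then (1 : ℝ) else 0) = 0 := by
      apply Finset.sum_eq_zero
      intro l hl
      rw [if_neg (by omega)]
    beta_reduce
    rw [h4, if_pos h2, if_neg (by omega), if_neg (by omega)]
    norm_num

lemma Lmap_det (n : ℕ) : |LinearMap.det (Lmap n)| = 1 := by
  rw [← LinearMap.det_toMatrix', Matrix.det_of_isLowerTriangular, Finset.abs_prod]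
  · apply Finset.prod_eq_one
    intro i _
    rw [LinearMap.toMatrix'_apply, Lmap_apply, show extV (Pi.single i (1 : ℝ)) =
      fun k => if k = (i : ℕ) then 1 else 0 from funext (extV_single i)]
    exact Yf_diag i
  · intro i j hij
    rw [LinearMap.toMatrix'_apply, Lmap_apply]
    apply Yf_congr_zero
    intro k hk
    rw [extV_single, if_neg]
    have : i < j := by simpa using hij
    have : (i : ℕ) < j := this
    omega

lemma Lmap_mp (n : ℕ) : MeasurePreserving (Lmap n) volume volume := by
  have hd := Lmap_det n
  have h0 : LinearMap.det (Lmap n) ≠ 0 := by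
    intro h; rw [h] at hd; simp at hd
  refine ⟨(LinearMap.continuous_on_pi _).measurable, ?_⟩
  rw [Real.map_linearMap_volume_pi_eq_smul_volume_pi h0, abs_inv, hd]
  simp

lemma Lmap_bound (n : ℕ) : ∃ K : ℝ, 0 ≤ K ∧ ∀ v, ‖v‖ ≤ K * ∑ j, |Lmap n v j| := by
  have hd := Lmap_det n
  have h0 : LinearMap.det (Lmap n) ≠ 0 := by
    intro h; rw [h] at hd; simp at hd
  have hk : LinearMap.ker (Lmap n) = ⊥ := by
    by_contra h
    exact h0 (LinearMap.det_eq_zero_iff_ker_ne_bot.2 h)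
  obtain ⟨K, -, hK⟩ := LinearMap.exists_antilipschitzWith (Lmap n) hk
  refine ⟨K, K.2, fun v => ?_⟩
  have h1 : ‖v‖ ≤ K * ‖Lmap n v‖ := by
    have := hK.le_mul_dist v 0
    simpa using this
  refine h1.trans (mul_le_mul_of_nonneg_left ?_ K.2)
  rw [pi_norm_le_iff_of_nonneg (Finset.sum_nonneg fun _ _ => abs_nonneg _)]
  intro i
  exact Finset.single_le_sum (f := fun j => |Lmap n v j|) (fun _ _ => abs_nonneg _)
    (Finset.mem_univ i)

lemma coordOf_tail {m : ℕ} (v : Fin (m + 1) → ℝ) (k : ℕ) :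
    coordOf (fun i : Fin m => v i.succ) (k + 1) = extV v (k + 1) := by
  unfold coordOf extV
  by_cases h : k < m <;> simp [h]

lemma coordOf_measurable {m : ℕ} (k : ℕ) : Measurable (fun σ : Fin m → ℝ => coordOf σ k) := by
  unfold coordOf
  split_ifs
  · exact measurable_pi_apply _
  · exact measurable_const

/-- sum of odd coordinates -/
def oddS (n : ℕ) (σ : Fin (2 * n) → ℝ) : ℝ := ∑ k ∈ Finset.range n, coordOf σ (2 * k + 1)

lemma oddS_measurable (n : ℕ) : Measurable (oddS n) :=
  Finset.measurable_sum _ fun _ _ => coordOf_measurable _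

lemma lint_change (n : ℕ) (F : ℝ → (Fin (2 * n) → ℝ) → ℝ≥0∞)
    (hF : Measurable (Function.uncurry F)) :
    ∫⁻ x : ℝ, ∫⁻ σ : Fin (2 * n) → ℝ, F x σ =
      ∫⁻ v : Fin (2 * n + 1) → ℝ, F (v 0 + oddS n (fun i => v i.succ)) (fun i => v i.succ) := by
  have hG : Measurable (fun p : ℝ × (Fin (2 * n) → ℝ) => F (p.1 + oddS n p.2) p.2) := by
    have : Measurable (fun p : ℝ × (Fin (2 * n) → ℝ) => (p.1 + oddS n p.2, p.2)) :=
      (measurable_fst.add ((oddS_measurable n).comp measurable_snd)).prodMk measurable_snd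
    exact hF.comp this
  rw [lintegral_lintegral_swap hF.aemeasurable]
  have h1 : ∀ σ, ∫⁻ x : ℝ, F x σ = ∫⁻ x : ℝ, F (x + oddS n σ) σ := fun σ =>
    (lintegral_add_right_eq_self (fun x => F x σ) (oddS n σ)).symm
  simp_rw [h1]
  rw [lintegral_lintegral_swap (f := fun σ x => F (x + oddS n σ) σ)
      (hG.comp measurable_swap).aemeasurable,
    ← lintegral_prod (fun p : ℝ × (Fin (2 * n) → ℝ) => F (p.1 + oddS n p.2) p.2)
      hG.aemeasurable]
  have hmp := volume_preserving_piFinSuccAbove (fun _ : Fin (2 * n + 1) => ℝ) 0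
  rw [← Measure.volume_eq_prod, ← hmp.lintegral_comp hG]
  rfl

lemma sum_split (V : ℕ → ℝ) (j : ℕ) :
    ∑ k ∈ Finset.Icc 1 (2 * j), V k =
      ∑ k ∈ Finset.range j, V (2 * k + 1) + ∑ k ∈ Finset.range j, V (2 * k + 2) := by
  induction j with
  | zero => simp
  | succ j ih =>
    rw [show 2 * (j + 1) = 2 * j + 1 + 1 by ring, Finset.sum_Icc_succ_top (by omega),
      Finset.sum_Icc_succ_top (by omega), ih, Finset.sum_range_succ, Finset.sum_range_succ]
    ring

lemma prod_split (g : ℕ → ℝ) (n : ℕ) :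
    ∏ i ∈ Finset.range (2 * n + 1), g i =
      (∏ j ∈ Finset.range n, g (2 * j + 2) * g (2 * j + 1)) * g 0 := by
  induction n with
  | zero => simp
  | succ n ih =>
    rw [show 2 * (n + 1) + 1 = 2 * n + 1 + 1 + 1 by ring, Finset.prod_range_succ,
      Finset.prod_range_succ, ih, Finset.prod_range_succ]
    ring

lemma Mn_norm (n : ℕ) (f : ℝ → ℂ) (v : Fin (2 * n + 1) → ℝ) :
    ‖Mn n f (v 0 + oddS n (fun i => v i.succ)) (fun i => v i.succ)‖ =
      ∏ j, ‖f (Lmap n v j)‖ := by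
  have hv0 : v 0 = extV v 0 := by simp [extV]
  simp_rw [Lmap_apply]
  rw [Fin.prod_univ_eq_prod_range (fun i => ‖f (Yf (extV v) i)‖) (2 * n + 1), prod_split]
  unfold Mn oddS
  rw [norm_mul, norm_prod]
  congr 1
  · rw [← Finset.Ico_add_one_right_eq_Icc, Finset.prod_Ico_eq_prod_range]
    apply Finset.prod_congr (by simp)
    intro j hj
    have hj : j < n := by simpa using hj
    have e1 : ∑ k ∈ Finset.Icc 1 (2 * (1 + j - 1)), coordOf (fun i => v i.succ) k
        = ∑ k ∈ Finset.range j, extV v (2 * k + 1) + ∑ k ∈ Finset.range j, extV v (2 * k + 2) := by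
      rw [← sum_split, show 2 * (1 + j - 1) = 2 * j by omega]
      apply Finset.sum_congr rfl
      intro k hk
      obtain ⟨k, rfl⟩ : ∃ k', k = k' + 1 := ⟨k - 1, by have := (Finset.mem_Icc.1 hk).1; omega⟩
      exact coordOf_tail v k
    have e2 : ∑ k ∈ Finset.range n, coordOf (fun i => v i.succ) (2 * k + 1) =
        ∑ k ∈ Finset.range j, extV v (2 * k + 1) + extV v (2 * j + 1) +
        ∑ k ∈ Finset.Icc (1 + j) (n - 1), coordOf (fun i => v i.succ) (2 * k + 1) := by
      simp_rw [coordOf_tail]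
      rw [← Finset.sum_range_succ, ← Finset.Ico_add_one_right_eq_Icc,
        show n - 1 + 1 = n by omega, add_comm 1 j,
        Finset.sum_range_add_sum_Ico _ (by omega : j + 1 ≤ n)]
    have e3 : coordOf (fun i => v i.succ) (2 * (1 + j)) = extV v (2 * j + 2) := by
      rw [show 2 * (1 + j) = 2 * j + 1 + 1 by ring, coordOf_tail]
    rw [e1, e2, e3, norm_mul, RCLike.norm_conj, hv0]
    congr 3
    · unfold Yf
      rw [if_neg (by omega), show 2 * ((2 * j + 2 - 1) / 2) + 1 = 2 * j + 1 by omega,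
        show (2 * j + 2) / 2 = j + 1 by omega, Finset.sum_range_succ]
      ring
    · unfold Yf
      rw [if_neg (by omega), show 2 * ((2 * j + 1 - 1) / 2) + 1 = 2 * j + 1 by omega,
        show (2 * j + 1) / 2 = j by omega]
      ring
  · rw [hv0]; simp [Yf]

lemma Mn_measurable (n : ℕ) (f : ℝ → ℂ) (hf : Measurable f) :
    Measurable (fun p : ℝ × (Fin (2 * n) → ℝ) => Mn n f p.1 p.2) := by
  have hc : ∀ k, Measurable (fun p : ℝ × (Fin (2 * n) → ℝ) => coordOf p.2 k) := fun k =>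
    (coordOf_measurable k).comp measurable_snd
  have hs : ∀ (s : Finset ℕ) (g : ℕ → ℕ),
      Measurable (fun p : ℝ × (Fin (2 * n) → ℝ) => ∑ k ∈ s, coordOf p.2 (g k)) := fun s g =>
    Finset.measurable_sum _ fun k _ => hc (g k)
  unfold Mn
  refine Measurable.mul (Finset.measurable_prod _ fun j _ => Measurable.mul ?_ ?_) ?_
  · exact hf.comp (((measurable_fst.sub (hc _)).sub (hs _ fun k => k)).sub
      (hs _ fun k => 2 * k + 1))
  · exact Complex.continuous_conj.measurable.comp
      (hf.comp ((measurable_fst.sub (hs _ fun k => k)).sub (hs _ fun k => 2 * k + 1)))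
  · exact hf.comp (measurable_fst.sub (hs _ fun k => 2 * k + 1))

lemma lhs_eq (n : ℕ) (α : ℝ) (f : ℝ → ℂ) (hf : Measurable f) :
    (∫⁻ x : ℝ, ∫⁻ σ : Fin (2 * n) → ℝ,
      ENNReal.ofReal (((∑ j, |σ j|) + |x|) ^ α * ‖Mn n f x σ‖)) =
    ∫⁻ v : Fin (2 * n + 1) → ℝ,
      ENNReal.ofReal (((∑ j : Fin (2 * n), |v j.succ|) +
        |v 0 + oddS n (fun i => v i.succ)|) ^ α * ∏ j, ‖f (Lmap n v j)‖) := by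
  rw [lint_change n (fun x σ => ENNReal.ofReal (((∑ j, |σ j|) + |x|) ^ α * ‖Mn n f x σ‖))]
  · simp_rw [Mn_norm]
  · have h1 := (Mn_measurable n f hf).norm
    refine ENNReal.measurable_ofReal.comp (Measurable.mul (Measurable.pow_const ?_ α) h1)
    fun_prop

lemma rhs_meas (n : ℕ) (α : ℝ) (f : ℝ → ℂ) (hf : Measurable f) :
    Measurable (fun Y : Fin (2 * n + 1) → ℝ =>
      ENNReal.ofReal ((∑ j, |Y j|) ^ α * ∏ j, ‖f (Y j)‖)) := by
  fun_prop

lemma weight_bound (n : ℕ) : ∃ K : ℝ, 0 ≤ K ∧ ∀ v : Fin (2 * n + 1) → ℝ,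
    (∑ j : Fin (2 * n), |v j.succ|) + |v 0 + oddS n (fun i => v i.succ)| ≤
      K * ∑ j, |Lmap n v j| := by
  obtain ⟨K, hK0, hK⟩ := Lmap_bound n
  refine ⟨(3 * n + 1) * K, by positivity, fun v => ?_⟩
  have h1 : ∑ j : Fin (2 * n), |v j.succ| ≤ 2 * n * ‖v‖ := by
    have := Finset.sum_le_card_nsmul Finset.univ (fun j : Fin (2 * n) => |v j.succ|) ‖v‖
      (fun j _ => norm_le_pi_norm v j.succ)
    simpa using this
  have h2 : |oddS n (fun i => v i.succ)| ≤ n * ‖v‖ := by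
    unfold oddS
    refine (Finset.abs_sum_le_sum_abs _ _).trans ?_
    have := Finset.sum_le_card_nsmul (Finset.range n)
      (fun k => |coordOf (fun i => v i.succ) (2 * k + 1)|) ‖v‖
      (fun k _ => by rw [coordOf_tail]; exact extV_abs_le v _)
    simpa using this
  have h3 : |v 0| ≤ ‖v‖ := norm_le_pi_norm v 0
  have h4 := abs_add_le (v 0) (oddS n (fun i => v i.succ))
  calc _ ≤ (3 * n + 1) * ‖v‖ := by linarith
    _ ≤ (3 * n + 1) * (K * ∑ j, |Lmap n v j|) := by
      exact mul_le_mul_of_nonneg_left (hK v) (by positivity)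
    _ = _ := by ring

/-- change of variables estimate for `ℳⁿ[f]`, with equality when `α = 0`. -/
theorem statement5 (n : ℕ) (hn : 1 ≤ n) (α : ℝ) (hα : 0 ≤ α) :
    ∃ C : ℝ,
      (∀ f : ℝ → ℂ, Measurable f →
        (∫⁻ x : ℝ, ∫⁻ σ : Fin (2 * n) → ℝ,
            ENNReal.ofReal (((∑ j, |σ j|) + |x|) ^ α * ‖Mn n f x σ‖)) ≤
          ENNReal.ofReal C *
            ∫⁻ Y : Fin (2 * n + 1) → ℝ,
              ENNReal.ofReal ((∑ j, |Y j|) ^ α * ∏ j, ‖f (Y j)‖)) ∧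
      (α = 0 → ∀ f : ℝ → ℂ, Measurable f →
        (∫⁻ x : ℝ, ∫⁻ σ : Fin (2 * n) → ℝ,
            ENNReal.ofReal (((∑ j, |σ j|) + |x|) ^ α * ‖Mn n f x σ‖)) =
          ∫⁻ Y : Fin (2 * n + 1) → ℝ,
            ENNReal.ofReal ((∑ j, |Y j|) ^ α * ∏ j, ‖f (Y j)‖)) := by
  obtain ⟨K, hK0, hK⟩ := weight_bound n
  refine ⟨K ^ α, fun f hf => ?_, fun h0 f hf => ?_⟩
  · rw [lhs_eq n α f hf, ← (Lmap_mp n).lintegral_comp (rhs_meas n α f hf),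
      ← lintegral_const_mul (f := fun v => ENNReal.ofReal ((∑ j, |Lmap n v j|) ^ α *
        ∏ j, ‖f (Lmap n v j)‖)) _ ((rhs_meas n α f hf).comp (Lmap_mp n).measurable)]
    refine lintegral_mono fun v => ?_
    rw [← ENNReal.ofReal_mul (by positivity)]
    refine ENNReal.ofReal_le_ofReal ?_
    rw [← mul_assoc, ← Real.mul_rpow hK0 (by positivity)]
    gcongr
    exact hK v
  · rw [lhs_eq n α f hf, ← (Lmap_mp n).lintegral_comp (rhs_meas n α f hf)]
    subst h0
    simp
end
end

section
/- Fix integers d ≥ 1, 1 ≤ n ≤ d and p ≥ 0. Let f : [1,∞) × ℝ → ℂ be such that f(t,·) is a Schwartz function for each t ≥ 1, and suppose there are constants C > 0 and 0 < α < 1/(16d+8) with sup_{t ≥ 1} t^{-α} ‖⟨x⟩^{p+1} f(t,·)‖_{L²(ℝ)} ≤ C. Then for all integers r, q ≥ 0 satisfying either (r > 0 and 2r + q − 2 = p) or (r = 0 and q = p), there exist δ ∈ (0,1) and a constant K, depending only on n, p, q, r and α, such that for all s ≥ 1, ‖Rⁿ_r(s,·)‖_{W^{q,∞}(ℝ)}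 ≤ K s^{-n-r+1-δ} C^{2n+1}, where Rⁿ_r(s,ξ) = (2π)^{-n} s^{-n} ∫_{ℝ^{2n}} (e^{-i η·Qⁿη/(2s)} − Σ_{j=0}^{r-1} (−i η·Qⁿη)^j/((2s)^j j!)) · ℱ_η^{-1}[𝒩ⁿ[f̂(s,·)](ξ,·)](η) dη (the sum over j is empty when r = 0), and f̂(s,·) denotes the Fourier transform of f(s,·) in x. -/
noncomputable section

open MeasureTheory Real Finset
open scoped ENNReal

/-- Japanese bracket `⟨x⟩ = (1+x²)^{1/2}`. -/
def jb (x : ℝ) : ℝ := Real.sqrt (1 + x ^ 2)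

/-- Weighted L² norm `‖⟨x⟩^m f‖_{L²}` (valued in `ℝ≥0∞`). -/
def wnormE (m : ℝ) (f : ℝ → ℂ) : ℝ≥0∞ :=
  eLpNorm (fun x : ℝ => ((jb x ^ m : ℝ) : ℂ) * f x) 2 volume

/-- `W^{q,∞}` norm `∑_{j=0}^q ‖∂^j φ‖_{L^∞}`. -/
def WqNormE (q : ℕ) (φ : ℝ → ℂ) : ℝ≥0∞ :=
  ∑ j ∈ Finset.range (q + 1), eLpNorm (iteratedDeriv j φ) ⊤ volume

open scoped FourierTransform

lemma aux_ft_eq (f : SchwartzMap ℝ ℂ) (ξ : ℝ) :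
    FT (fun x => f x) ξ = (((Real.sqrt (2 * Real.pi))⁻¹ : ℝ) : ℂ) * (𝓕 f) ((2 * Real.pi)⁻¹ * ξ) := by
  unfold FT
  congr 1
  rw [SchwartzMap.fourier_coe, Real.fourier_eq']
  congr 1
  ext x
  simp only [smul_eq_mul]
  congr 2
  have hpi : (Real.pi : ℂ) ≠ 0 := by exact_mod_cast Real.pi_ne_zero
  simp only [RCLike.inner_apply, conj_trivial]
  push_cast
  field_simp

lemma aux_ft_cont (f : SchwartzMap ℝ ℂ) : Continuous (FT (fun x => f x)) := by
  rw [funext (aux_ft_eq f)]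
  have := (𝓕 f).continuous
  fun_prop

lemma aux_ft_int (f : SchwartzMap ℝ ℂ) : Integrable (FT (fun x => f x)) := by
  rw [funext (aux_ft_eq f)]
  apply Integrable.const_mul
  have h : Integrable (fun x => (𝓕 f) x) := (𝓕 f).integrable
  exact h.comp_mul_left' (by positivity)

lemma aux_ft_inv (f : SchwartzMap ℝ ℂ) (A : ℝ) :
    ∫ u : ℝ, Complex.exp (Complex.I * ((A * u : ℝ) : ℂ)) * FT (fun x => f x) u
      = ((Real.sqrt (2 * Real.pi) : ℝ) : ℂ) * f A := by
  have h0 : f A = 𝓕⁻ (𝓕 f) A := by rw [FourierPair.fourierInv_fourier_eq f]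
  rw [h0, SchwartzMap.fourierInv_coe, Real.fourierInv_eq']
  have h1 := Measure.integral_comp_mul_left (fun v : ℝ => Complex.exp (((2 * Real.pi * inner ℝ v A : ℝ) : ℂ) * Complex.I) • (𝓕 f) v) ((2 * Real.pi)⁻¹)
  have h2 : ∀ u : ℝ, Complex.exp (Complex.I * ((A * u : ℝ) : ℂ)) * FT (fun x => f x) u =
      (((Real.sqrt (2 * Real.pi))⁻¹ : ℝ) : ℂ) * (Complex.exp (((2 * Real.pi * inner ℝ ((2 * Real.pi)⁻¹ * u) A : ℝ) : ℂ) * Complex.I) • (𝓕 f) ((2 * Real.pi)⁻¹ * u)) := by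
    intro u
    rw [aux_ft_eq]
    have hpi : (Real.pi : ℂ) ≠ 0 := by exact_mod_cast Real.pi_ne_zero
    have : Complex.I * ((A * u : ℝ) : ℂ) = ((2 * Real.pi * inner ℝ ((2 * Real.pi)⁻¹ * u) A : ℝ) : ℂ) * Complex.I := by
      simp only [RCLike.inner_apply, conj_trivial]
      push_cast
      field_simp
    rw [this, smul_eq_mul]
    ring
  simp_rw [h2]
  rw [integral_const_mul, h1]
  rw [inv_inv, abs_of_pos (by positivity), Complex.real_smul, ← mul_assoc, ← Complex.ofReal_mul]
  congr 2
  have : (0:ℝ) < Real.sqrt (2 * Real.pi) := by positivity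
  field_simp
  rw [Real.sq_sqrt (by positivity)]

lemma aux_ft_inv_shift (f : SchwartzMap ℝ ℂ) (A ξ : ℝ) :
    ∫ u : ℝ, Complex.exp (Complex.I * ((A * u : ℝ) : ℂ)) * FT (fun x => f x) (ξ + u)
      = ((Real.sqrt (2 * Real.pi) : ℝ) : ℂ) * (Complex.exp (- Complex.I * ((A * ξ : ℝ) : ℂ)) * f A) := by
  have h := integral_add_left_eq_self (μ := (volume : Measure ℝ))
    (fun u : ℝ => Complex.exp (Complex.I * ((A * (u - ξ) : ℝ) : ℂ)) * FT (fun x => f x) u) ξ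
  simp only [add_sub_cancel_left] at h
  rw [h]
  have h2 : ∀ u : ℝ, Complex.exp (Complex.I * ((A * (u - ξ) : ℝ) : ℂ)) * FT (fun x => f x) u
      = Complex.exp (- Complex.I * ((A * ξ : ℝ) : ℂ)) * (Complex.exp (Complex.I * ((A * u : ℝ) : ℂ)) * FT (fun x => f x) u) := by
    intro u
    rw [← mul_assoc, ← Complex.exp_add]
    congr 2
    push_cast
    ring
  simp_rw [h2]
  rw [integral_const_mul, aux_ft_inv]
  ring

lemma aux_ft_inv_shift_conj (f : SchwartzMap ℝ ℂ) (A ξ : ℝ) :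
    ∫ u : ℝ, Complex.exp (-Complex.I * ((A * u : ℝ) : ℂ)) * (starRingEnd ℂ) (FT (fun x => f x) (ξ + u))
      = ((Real.sqrt (2 * Real.pi) : ℝ) : ℂ) * (Complex.exp (Complex.I * ((A * ξ : ℝ) : ℂ)) * (starRingEnd ℂ) (f A)) := by
  have h := congrArg (starRingEnd ℂ) (aux_ft_inv_shift f A ξ)
  rw [← integral_conj] at h
  simpa only [map_mul, ← Complex.exp_conj, map_neg, Complex.conj_I, Complex.conj_ofReal, neg_neg] using h

lemma aux_lin_change {E F : Type} [NormedAddCommGroup E] [NormedSpace ℝ E] [MeasureSpace E] [BorelSpace E]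
    [FiniteDimensional ℝ E] [NormedAddCommGroup F] [NormedSpace ℝ F] [MeasureSpace F] [BorelSpace F]
    [FiniteDimensional ℝ F]
    (hE : (volume : Measure E).IsAddHaarMeasure) (hF : (volume : Measure F).IsAddHaarMeasure)
    (L : E ≃L[ℝ] F) :
    ∃ c : ℝ, 0 ≤ c ∧ (∀ h : F → ℂ, ∫ x : E, h (L x) = (c : ℂ) * ∫ y : F, h y) ∧
      (∀ h : F → ℂ, Integrable h → Integrable (fun x => h (L x))) := by
  have h1 : (Measure.map L (volume : Measure E)).IsAddHaarMeasure := L.isAddHaarMeasure_map _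
  have h2 := Measure.isAddLeftInvariant_eq_smul (Measure.map L (volume : Measure E)) (volume : Measure F)
  set c := (Measure.map L (volume : Measure E)).addHaarScalarFactor (volume : Measure F)
  refine ⟨c, c.2, ?_, ?_⟩
  · intro h
    have h3 := L.toHomeomorph.measurableEmbedding.integral_map (μ := (volume : Measure E)) h
    have h4 : Measure.map L.toHomeomorph (volume : Measure E) = c • (volume : Measure F) := h2
    rw [h4, integral_smul_nnreal_measure] at h3
    rw [show ∫ x : E, h (L x) = ∫ x : E, h (L.toHomeomorph x) from rfl, ← h3]
    rw [NNReal.smul_def, Complex.real_smul]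
  · intro h hh
    have h4 : Measure.map L.toHomeomorph (volume : Measure E) = c • (volume : Measure F) := h2
    have h5 : Integrable h (Measure.map L.toHomeomorph (volume : Measure E)) := by
      rw [h4]
      exact hh.smul_measure_nnreal
    exact (L.toHomeomorph.measurableEmbedding.integrable_map_iff).1 h5

abbrev VV (n : ℕ) : Type := (Fin n → ℝ) × (Fin n → ℝ)

lemma aux_haar_V (n : ℕ) : (volume : Measure (VV n)).IsAddHaarMeasure := by
  exact Measure.prod.instIsAddHaarMeasure volume volume

lemma aux_haar_W (n : ℕ) : (volume : Measure (ℝ × VV n)).IsAddHaarMeasure := by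
  have := aux_haar_V n
  exact Measure.prod.instIsAddHaarMeasure volume volume

def splitL (n : ℕ) : (Fin (2 * n) → ℝ) ≃ₗ[ℝ] VV n where
  toFun η := (fun i => η ⟨2 * i.val, by have := i.isLt; omega⟩,
    fun i => η ⟨2 * i.val + 1, by have := i.isLt; omega⟩)
  invFun w := fun j => if j.val % 2 = 0 then w.1 ⟨j.val / 2, by have := j.isLt; omega⟩
    else w.2 ⟨j.val / 2, by have := j.isLt; omega⟩
  map_add' _ _ := rfl
  map_smul' _ _ := rfl
  left_inv η := by
    ext j
    dsimp only
    split_ifs with h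
    · congr 1; ext; dsimp only; omega
    · congr 1; ext; dsimp only; omega
  right_inv w := by
    refine Prod.ext ?_ ?_
    · ext i
      dsimp only
      rw [if_pos (by omega)]
      exact congrArg w.1 (Fin.ext (by dsimp only; omega))
    · ext i
      dsimp only
      rw [if_neg (by omega)]
      exact congrArg w.2 (Fin.ext (by dsimp only; omega))

/-- `(o,e) ↦ (u,v)`. -/
def TL (n : ℕ) : VV n ≃ₗ[ℝ] VV n where
  toFun w := (fun i => -(∑ k, if i < k then w.1 k else 0) - w.2 i,
    fun i => -(∑ k, if i < k then w.1 k else 0) - w.2 i - w.1 i)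
  invFun w := (fun i => w.1 i - w.2 i,
    fun i => -(∑ k, if i < k then (w.1 k - w.2 k) else 0) - w.1 i)
  map_add' a b := by
    have h : ∀ i, (∑ k, if i < k then (a.1 k + b.1 k) else 0) =
      (∑ k, if i < k then a.1 k else 0) + ∑ k, if i < k then b.1 k else 0 := by
      intro i
      rw [← Finset.sum_add_distrib]
      refine Finset.sum_congr rfl fun k _ => ?_
      split_ifs <;> simp
    refine Prod.ext ?_ ?_ <;> ext i <;> simp only [Prod.fst_add, Prod.snd_add, Pi.add_apply, h] <;> ring
  map_smul' c a := by
    have h : ∀ i, (∑ k, if i < k then (c * a.1 k) else 0) =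
      c * (∑ k, if i < k then a.1 k else 0) := by
      intro i
      rw [Finset.mul_sum]
      refine Finset.sum_congr rfl fun k _ => ?_
      split_ifs <;> simp
    refine Prod.ext ?_ ?_ <;> ext i <;> simp only [Prod.smul_fst, Prod.smul_snd, Pi.smul_apply, smul_eq_mul, h, RingHom.id_apply] <;> ring
  left_inv w := by
    refine Prod.ext ?_ ?_ <;> ext i <;> simp
  right_inv w := by
    refine Prod.ext ?_ ?_ <;> ext i <;> simp

/-- `(x,o,e) ↦ (x,b,a)`. -/
def WL (n : ℕ) : (ℝ × VV n) ≃ₗ[ℝ] (ℝ × VV n) where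
  toFun w := (w.1, (fun i => w.1 + w.2.1 i - (∑ k, if k < i then w.2.2 k else 0) - w.2.2 i,
    fun i => w.1 + w.2.1 i - (∑ k, if k < i then w.2.2 k else 0)))
  invFun w := (w.1, (fun i => w.2.2 i - w.1 + (∑ k, if k < i then (w.2.2 k - w.2.1 k) else 0),
    fun i => w.2.2 i - w.2.1 i))
  map_add' a b := by
    have h : ∀ i, (∑ k, if k < i then (a.2.2 k + b.2.2 k) else 0) =
      (∑ k, if k < i then a.2.2 k else 0) + ∑ k, if k < i then b.2.2 k else 0 := by
      intro i
      rw [← Finset.sum_add_distrib]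
      refine Finset.sum_congr rfl fun k _ => ?_
      split_ifs <;> simp
    refine Prod.ext ?_ (Prod.ext ?_ ?_)
    · simp
    all_goals
      ext i
      simp only [Prod.fst_add, Prod.snd_add, Pi.add_apply, h]
      ring
  map_smul' c a := by
    have h : ∀ i, (∑ k, if k < i then (c * a.2.2 k) else 0) =
      c * (∑ k, if k < i then a.2.2 k else 0) := by
      intro i
      rw [Finset.mul_sum]
      refine Finset.sum_congr rfl fun k _ => ?_
      split_ifs <;> simp
    refine Prod.ext ?_ (Prod.ext ?_ ?_)
    · simp
    all_goals
      ext i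
      simp only [Prod.smul_fst, Prod.smul_snd, Pi.smul_apply, smul_eq_mul, h, RingHom.id_apply]
      ring
  left_inv w := by
    refine Prod.ext ?_ (Prod.ext ?_ ?_)
    · simp
    all_goals
      ext i
      simp <;> ring
  right_inv w := by
    refine Prod.ext ?_ (Prod.ext ?_ ?_)
    · simp
    all_goals
      ext i
      simp <;> ring

lemma aux_sum_Icc {M : Type*} [CommMonoid M] (n : ℕ) (F : ℕ → M) :
    ∏ k ∈ Finset.Icc 1 n, F k = ∏ i : Fin n, F (i.val + 1) := by
  induction n with
  | zero => simp
  | succ m ih =>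
    rw [Finset.prod_Icc_succ_top (by omega), ih, Fin.prod_univ_castSucc]
    simp

lemma aux_sum_Icc' {M : Type*} [AddCommMonoid M] (n : ℕ) (F : ℕ → M) :
    ∑ k ∈ Finset.Icc 1 n, F k = ∑ i : Fin n, F (i.val + 1) := by
  induction n with
  | zero => simp
  | succ m ih =>
    rw [Finset.sum_Icc_succ_top (by omega), ih, Fin.sum_univ_castSucc]
    simp

lemma aux_coord_odd (n : ℕ) (η : Fin (2 * n) → ℝ) (i : Fin n) :
    coordOf η (2 * (i.val + 1) - 1) = (splitL n η).1 i := by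
  unfold coordOf
  rw [dif_pos (by have := i.isLt; omega)]
  rfl

lemma aux_coord_even (n : ℕ) (η : Fin (2 * n) → ℝ) (i : Fin n) :
    coordOf η (2 * (i.val + 1)) = (splitL n η).2 i := by
  unfold coordOf
  rw [dif_pos (by have := i.isLt; omega)]
  rfl

lemma aux_Psi (n : ℕ) (η : Fin (2 * n) → ℝ) :
    Psi n η = ∑ i, (splitL n η).2 i * (splitL n η).1 i := by
  unfold Psi
  rw [aux_sum_Icc']
  simp_rw [aux_coord_odd, aux_coord_even]

lemma aux_Hf (n : ℕ) (ξ : ℝ) (η : Fin (2 * n) → ℝ) (j : ℕ) :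
    Hf n ξ η (j + 1) = ξ - ∑ k : Fin n, if j ≤ k.val then (splitL n η).1 k else 0 := by
  unfold Hf
  congr 1
  have : Finset.Icc (j + 1) n = (Finset.Icc 1 n).filter (fun k => j + 1 ≤ k) := by
    ext k
    simp only [Finset.mem_Icc, Finset.mem_filter]
    omega
  rw [this, Finset.sum_filter, aux_sum_Icc']
  simp_rw [aux_coord_odd]
  simp

lemma aux_Nn (n : ℕ) (hn : 1 ≤ n) (g : ℝ → ℂ) (ξ : ℝ) (η : Fin (2 * n) → ℝ) :
    Nn n g ξ η = ((∏ i, g (ξ + (TL n (splitL n η)).1 i)) *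
      (∏ i, (starRingEnd ℂ) (g (ξ + (TL n (splitL n η)).2 i)))) *
      g (ξ - ∑ i, (splitL n η).1 i) := by
  have key : Nn n g ξ η = (∏ i ∈ Finset.Icc 1 n, (g (Hf n ξ η (i + 1) - coordOf η (2 * i)) *
      (starRingEnd ℂ) (g (Hf n ξ η i - coordOf η (2 * i))))) * g (Hf n ξ η 1) := by
    unfold Nn
    obtain ⟨m, rfl⟩ : ∃ m, n = m + 1 := ⟨n - 1, by omega⟩
    rw [Finset.prod_Icc_succ_top (by omega)]
    have : Hf (m + 1) ξ η (m + 1 + 1) = ξ := by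
      unfold Hf
      simp
    rw [this]
    simp only [Nat.add_sub_cancel]
    ring
  rw [key, aux_sum_Icc, ← Finset.prod_mul_distrib]
  have hH1 : Hf n ξ η 1 = ξ - ∑ i, (splitL n η).1 i := by
    have := aux_Hf n ξ η 0
    simpa using this
  rw [hH1]
  congr 1
  refine Finset.prod_congr rfl fun i _ => ?_
  rw [aux_coord_even, aux_Hf, aux_Hf]
  have h1 : (∑ k : Fin n, if i.val + 1 ≤ k.val then (splitL n η).1 k else 0) =
      ∑ k : Fin n, if i < k then (splitL n η).1 k else 0 := rfl
  have h2 : (∑ k : Fin n, if i.val ≤ k.val then (splitL n η).1 k else 0) =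
      (∑ k : Fin n, if i < k then (splitL n η).1 k else 0) + (splitL n η).1 i := by
    have : (splitL n η).1 i = ∑ k : Fin n, if i = k then (splitL n η).1 k else 0 := by simp
    rw [this, ← Finset.sum_add_distrib]
    refine Finset.sum_congr rfl fun k _ => ?_
    rcases lt_trichotomy i k with h | h | h
    · rw [if_pos (show i.val ≤ k.val from le_of_lt h), if_pos h, if_neg h.ne]; simp
    · subst h; simp
    · rw [if_neg (show ¬ i.val ≤ k.val from not_le.2 h), if_neg (not_lt.2 h.le), if_neg h.ne']; simp
  rw [h1, h2]
  have e1 : ∀ a b : ℝ, ξ - a - b = ξ + (-a - b) := by intros; ring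
  have e2 : ∀ a c b : ℝ, ξ - (a + c) - b = ξ + (-a - b - c) := by intros; ring
  rw [e1, e2]
  rfl

lemma aux_dot (n : ℕ) (σ η : Fin (2 * n) → ℝ) :
    ∑ j, σ j * η j = ∑ i, (splitL n σ).1 i * (splitL n η).1 i +
      ∑ i, (splitL n σ).2 i * (splitL n η).2 i := by
  have h : ∀ (m : ℕ) (F : ℕ → ℝ), ∑ j ∈ Finset.range (2 * m), F j =
      ∑ i ∈ Finset.range m, F (2 * i) + ∑ i ∈ Finset.range m, F (2 * i + 1) := by
    intro m F
    induction m with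
    | zero => simp
    | succ m ih =>
      rw [show 2 * (m + 1) = 2 * m + 1 + 1 by ring, Finset.sum_range_succ, Finset.sum_range_succ, ih,
        Finset.sum_range_succ, Finset.sum_range_succ]
      ring
  have h2 := h n (fun j => if hj : j < 2 * n then σ ⟨j, hj⟩ * η ⟨j, hj⟩ else 0)
  rw [Finset.sum_range, Finset.sum_range, Finset.sum_range] at h2
  have e0 : ∀ j : Fin (2 * n), (if hj : j.val < 2 * n then σ ⟨j.val, hj⟩ * η ⟨j.val, hj⟩ else 0) = σ j * η j := by
    intro j; rw [dif_pos j.isLt]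
  have e1 : ∀ i : Fin n, (if hj : 2 * i.val < 2 * n then σ ⟨2 * i.val, hj⟩ * η ⟨2 * i.val, hj⟩ else 0) =
      (splitL n σ).1 i * (splitL n η).1 i := by
    intro j; rw [dif_pos (by have := j.isLt; omega)]; rfl
  have e2 : ∀ i : Fin n, (if hj : 2 * i.val + 1 < 2 * n then σ ⟨2 * i.val + 1, hj⟩ * η ⟨2 * i.val + 1, hj⟩ else 0) =
      (splitL n σ).2 i * (splitL n η).2 i := by
    intro j; rw [dif_pos (by have := j.isLt; omega)]; rfl
  simp_rw [e0, e1, e2] at h2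
  exact h2

lemma aux_dual (n : ℕ) (x : ℝ) (s w : VV n) :
    ∑ i, s.1 i * w.1 i + ∑ i, s.2 i * w.2 i + x * ∑ i, w.1 i =
      ∑ i, (WL n (x, s)).2.1 i * (TL n w).1 i - ∑ i, (WL n (x, s)).2.2 i * (TL n w).2 i := by
  have hA : ∀ i, (WL n (x, s)).2.2 i = x + s.1 i - (∑ k, if k < i then s.2 k else 0) := fun i => rfl
  have hB : ∀ i, (WL n (x, s)).2.1 i = (WL n (x, s)).2.2 i - s.2 i := fun i => rfl
  have hu : ∀ i, (TL n w).1 i = -(∑ k, if i < k then w.1 k else 0) - w.2 i := fun i => rfl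
  have hv : ∀ i, (TL n w).2 i = (TL n w).1 i - w.1 i := fun i => rfl
  have hsw : ∑ i, s.2 i * (∑ k, if i < k then w.1 k else 0) =
      ∑ i, w.1 i * (∑ k, if k < i then s.2 k else 0) := by
    simp_rw [Finset.mul_sum]
    rw [Finset.sum_comm]
    refine Finset.sum_congr rfl fun i _ => Finset.sum_congr rfl fun k _ => ?_
    split_ifs <;> ring
  rw [← Finset.sum_sub_distrib]
  have : ∀ i, (WL n (x, s)).2.1 i * (TL n w).1 i - (WL n (x, s)).2.2 i * (TL n w).2 i =
      s.1 i * w.1 i + s.2 i * w.2 i + x * w.1 i + s.2 i * (∑ k, if i < k then w.1 k else 0)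
        - w.1 i * (∑ k, if k < i then s.2 k else 0) := by
    intro i
    rw [hB, hv, hu, hA]
    ring
  simp_rw [this]
  rw [Finset.sum_sub_distrib, Finset.sum_add_distrib, Finset.sum_add_distrib, Finset.sum_add_distrib, hsw,
    Finset.mul_sum]
  ring

def FF (n : ℕ) (f : SchwartzMap ℝ ℂ) (w : ℝ × VV n) : ℂ :=
  f w.1 * ((∏ i, f (w.2.1 i)) * ∏ i, (starRingEnd ℂ) (f (w.2.2 i)))

def ell (n : ℕ) (w : ℝ × VV n) : ℝ := w.1 + ∑ i, w.2.1 i - ∑ i, w.2.2 i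

def PP (n : ℕ) (g : ℝ → ℂ) (ξ : ℝ) (w : VV n) : ℂ :=
  (∏ i, g (ξ + w.1 i)) * ∏ i, (starRingEnd ℂ) (g (ξ + w.2 i))

lemma aux_PP_int (n : ℕ) (g : ℝ → ℂ) (hg : Integrable g) (ξ : ℝ) : Integrable (PP n g ξ) := by
  have h1 : Integrable (fun u => g (ξ + u)) := hg.comp_add_left ξ
  have h2 : Integrable (fun u => (starRingEnd ℂ) (g (ξ + u))) :=
    (LinearIsometryEquiv.integrable_comp_iff Complex.conjLIE).2 h1
  exact Integrable.mul_prod (μ := volume) (ν := volume)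
    (Integrable.fintype_prod (ι := Fin n) (μ := fun _ => volume) (fun _ => h1))
    (Integrable.fintype_prod (ι := Fin n) (μ := fun _ => volume) (fun _ => h2))

lemma aux_PP_ft (n : ℕ) (f : SchwartzMap ℝ ℂ) (ξ : ℝ) (b a : Fin n → ℝ) :
    ∫ w : VV n, Complex.exp (Complex.I * ((∑ i, b i * w.1 i - ∑ i, a i * w.2 i : ℝ) : ℂ)) *
      PP n (FT (fun x => f x)) ξ w =
    (((Real.sqrt (2 * Real.pi)) ^ (2 * n) : ℝ) : ℂ) *
      (Complex.exp (-Complex.I * ((ξ * (∑ i, b i - ∑ i, a i) : ℝ) : ℂ)) *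
      ((∏ i, f (b i)) * ∏ i, (starRingEnd ℂ) (f (a i)))) := by
  have h : ∀ w : VV n, Complex.exp (Complex.I * ((∑ i, b i * w.1 i - ∑ i, a i * w.2 i : ℝ) : ℂ)) *
      PP n (FT (fun x => f x)) ξ w =
      (∏ i, (Complex.exp (Complex.I * ((b i * w.1 i : ℝ) : ℂ)) * FT (fun x => f x) (ξ + w.1 i))) *
      (∏ i, (Complex.exp (-Complex.I * ((a i * w.2 i : ℝ) : ℂ)) *
        (starRingEnd ℂ) (FT (fun x => f x) (ξ + w.2 i)))) := by
    intro w
    rw [Finset.prod_mul_distrib, Finset.prod_mul_distrib, ← Complex.exp_sum, ← Complex.exp_sum]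
    unfold PP
    have : Complex.exp (Complex.I * ((∑ i, b i * w.1 i - ∑ i, a i * w.2 i : ℝ) : ℂ)) =
      Complex.exp (∑ i, Complex.I * ((b i * w.1 i : ℝ) : ℂ)) *
      Complex.exp (∑ i, -Complex.I * ((a i * w.2 i : ℝ) : ℂ)) := by
      rw [← Complex.exp_add, ← Finset.mul_sum, ← Finset.mul_sum]
      congr 1
      push_cast
      ring
    rw [this]
    ring
  simp_rw [h]
  rw [Measure.volume_eq_prod]
  rw [integral_prod_mul (μ := (volume : Measure (Fin n → ℝ))) (ν := (volume : Measure (Fin n → ℝ)))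
    (fun u : Fin n → ℝ => ∏ i, (Complex.exp (Complex.I * ((b i * u i : ℝ) : ℂ)) * FT (fun x => f x) (ξ + u i)))
    (fun v : Fin n → ℝ => ∏ i, (Complex.exp (-Complex.I * ((a i * v i : ℝ) : ℂ)) *
        (starRingEnd ℂ) (FT (fun x => f x) (ξ + v i))))]
  rw [integral_fintype_prod_volume_eq_prod (ι := Fin n) (E := fun _ => ℝ)
    (fun i u => Complex.exp (Complex.I * ((b i * u : ℝ) : ℂ)) * FT (fun x => f x) (ξ + u))]
  rw [integral_fintype_prod_volume_eq_prod (ι := Fin n) (E := fun _ => ℝ)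
    (fun i v => Complex.exp (-Complex.I * ((a i * v : ℝ) : ℂ)) *
        (starRingEnd ℂ) (FT (fun x => f x) (ξ + v)))]
  simp_rw [aux_ft_inv_shift, aux_ft_inv_shift_conj]
  rw [Finset.prod_mul_distrib, Finset.prod_mul_distrib, Finset.prod_mul_distrib, Finset.prod_mul_distrib,
    ← Complex.exp_sum, ← Complex.exp_sum]
  simp only [Finset.prod_const, Finset.card_univ, Fintype.card_fin]
  have : Complex.exp (-Complex.I * ((ξ * (∑ i, b i - ∑ i, a i) : ℝ) : ℂ)) =
      Complex.exp (∑ i, -Complex.I * ((b i * ξ : ℝ) : ℂ)) *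
      Complex.exp (∑ i, Complex.I * ((a i * ξ : ℝ) : ℂ)) := by
      rw [← Complex.exp_add, ← Finset.mul_sum, ← Finset.mul_sum]
      congr 1
      push_cast
      rw [← Finset.sum_mul, ← Finset.sum_mul]
      ring
  rw [this]
  push_cast
  ring

lemma aux_inv (n : ℕ) (hn : 1 ≤ n) : ∃ c : ℝ, ∀ (f : SchwartzMap ℝ ℂ) (ξ : ℝ) (σ : Fin (2 * n) → ℝ),
    invFTeta n (fun η => Nn n (FT (fun x => f x)) ξ η) σ =
      (c : ℂ) * ∫ x : ℝ, Complex.exp (-Complex.I * ((ξ * ell n (WL n (x, splitL n σ)) : ℝ) : ℂ)) *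
        FF n f (WL n (x, splitL n σ)) := by
  obtain ⟨c, -, hc, hci⟩ := aux_lin_change (inferInstance) (aux_haar_V n)
    ((splitL n).trans (TL n)).toContinuousLinearEquiv
  set L := ((splitL n).trans (TL n)).toContinuousLinearEquiv with hL
  have hLa : ∀ η, L η = TL n (splitL n η) := fun η => rfl
  refine ⟨((2 * Real.pi) ^ n)⁻¹ * ((Real.sqrt (2 * Real.pi))⁻¹ * (c * (Real.sqrt (2 * Real.pi)) ^ (2 * n))), ?_⟩
  intro f ξ σ
  set g := FT (fun x => f x) with hg
  have hgc : Continuous g := aux_ft_cont f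
  have hsc : Continuous (splitL n) := (splitL n).toContinuousLinearEquiv.continuous
  set k1 : ℂ := (((Real.sqrt (2 * Real.pi))⁻¹ : ℝ) : ℂ) with hk1
  unfold invFTeta
  have h1 : ∀ η : Fin (2 * n) → ℝ, Complex.exp (Complex.I * ((∑ j, σ j * η j : ℝ) : ℂ)) * Nn n g ξ η =
      k1 * ∫ x : ℝ, (Complex.exp (Complex.I * ((∑ j, σ j * η j : ℝ) : ℂ)) *
        Complex.exp (-Complex.I * (x : ℂ) * ((ξ - ∑ i, (splitL n η).1 i : ℝ) : ℂ))) *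
        (PP n g ξ (L η) * f x) := by
    intro η
    rw [aux_Nn n hn, hLa]
    have : g (ξ - ∑ i, (splitL n η).1 i) = k1 * ∫ x : ℝ, 
        Complex.exp (-Complex.I * (x : ℂ) * ((ξ - ∑ i, (splitL n η).1 i : ℝ) : ℂ)) * f x := rfl
    rw [this, mul_left_comm _ k1, mul_left_comm _ k1, ← integral_const_mul, ← integral_const_mul]
    congr 1
    refine integral_congr_ae (ae_of_all _ fun x => ?_)
    simp only [PP]
    ring
  simp_rw [h1]
  rw [integral_const_mul, integral_integral_swap]
  · have h2 : ∀ x : ℝ, ∫ η : Fin (2 * n) → ℝ, (Complex.exp (Complex.I * ((∑ j, σ j * η j : ℝ) : ℂ)) *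
        Complex.exp (-Complex.I * (x : ℂ) * ((ξ - ∑ i, (splitL n η).1 i : ℝ) : ℂ))) *
        (PP n g ξ (L η) * f x) = 
        ((c * (Real.sqrt (2 * Real.pi)) ^ (2 * n) : ℝ) : ℂ) * 
        (Complex.exp (-Complex.I * ((ξ * ell n (WL n (x, splitL n σ)) : ℝ) : ℂ)) *
        FF n f (WL n (x, splitL n σ))) := by
      intro x
      obtain ⟨G, hG⟩ : ∃ G : VV n → ℂ, G = (fun w : VV n => Complex.exp (Complex.I * ((∑ i, (WL n (x, splitL n σ)).2.1 i * w.1 i -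
            ∑ i, (WL n (x, splitL n σ)).2.2 i * w.2 i : ℝ) : ℂ)) * PP n g ξ w) := ⟨_, rfl⟩
      have h3 : ∀ η : Fin (2 * n) → ℝ, (Complex.exp (Complex.I * ((∑ j, σ j * η j : ℝ) : ℂ)) *
        Complex.exp (-Complex.I * (x : ℂ) * ((ξ - ∑ i, (splitL n η).1 i : ℝ) : ℂ))) *
        (PP n g ξ (L η) * f x) = (Complex.exp (-Complex.I * ((ξ * x : ℝ) : ℂ)) * f x) *
          G (L η) := by
        intro η
        rw [hG]
        dsimp only
        rw [hLa, ← aux_dual, aux_dot]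
        have he : Complex.exp (Complex.I * ((∑ i, (splitL n σ).1 i * (splitL n η).1 i +
            ∑ i, (splitL n σ).2 i * (splitL n η).2 i : ℝ) : ℂ)) *
            Complex.exp (-Complex.I * (x : ℂ) * ((ξ - ∑ i, (splitL n η).1 i : ℝ) : ℂ)) =
            Complex.exp (-Complex.I * ((ξ * x : ℝ) : ℂ)) *
            Complex.exp (Complex.I * ((∑ i, (splitL n σ).1 i * (splitL n η).1 i +
            ∑ i, (splitL n σ).2 i * (splitL n η).2 i + x * ∑ i, (splitL n η).1 i : ℝ) : ℂ)) := by
          rw [← Complex.exp_add, ← Complex.exp_add]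
          congr 1
          push_cast
          ring
        rw [he]
        ring
      rw [integral_congr_ae (ae_of_all _ h3), integral_const_mul, hc, hG, aux_PP_ft]
      unfold FF
      have : Complex.exp (-Complex.I * ((ξ * ell n (WL n (x, splitL n σ)) : ℝ) : ℂ)) =
        Complex.exp (-Complex.I * ((ξ * x : ℝ) : ℂ)) * 
        Complex.exp (-Complex.I * ((ξ * (∑ i, (WL n (x, splitL n σ)).2.1 i - ∑ i, (WL n (x, splitL n σ)).2.2 i) : ℝ) : ℂ)) := by
        rw [← Complex.exp_add]
        congr 1
        have : (WL n (x, splitL n σ)).1 = x := rfl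
        unfold ell
        rw [this]
        push_cast
        ring
      rw [this]
      have : (WL n (x, splitL n σ)).1 = x := rfl
      rw [this]
      push_cast
      ring
    simp_rw [h2]
    rw [integral_const_mul, hk1]
    push_cast
    ring
  · have hI : Integrable (fun z : (Fin (2 * n) → ℝ) × ℝ => PP n g ξ (L z.1) * f z.2) (volume.prod volume) :=
      (hci _ (aux_PP_int n g (aux_ft_int f) ξ)).mul_prod f.integrable
    have hfc := f.continuous
    have hLc := L.continuous
    refine hI.mono ?_ (ae_of_all _ fun z => ?_)
    · apply Continuous.aestronglyMeasurable
      have hPc : Continuous (PP n g ξ) := by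
        unfold PP
        have := Complex.continuous_conj
        fun_prop
      unfold Function.uncurry
      fun_prop
    · simp only [Function.uncurry, norm_mul]
      rw [show -Complex.I * (z.2 : ℂ) * ((ξ - ∑ i, (splitL n z.1).1 i : ℝ) : ℂ) =
        Complex.I * ((-(z.2 * (ξ - ∑ i, (splitL n z.1).1 i)) : ℝ) : ℂ) by push_cast; ring]
      rw [Complex.norm_exp_I_mul_ofReal, Complex.norm_exp_I_mul_ofReal]
      simp

lemma aux_taylor (r : ℕ) (hr : 0 < r) (θ : ℝ) (h0 : 0 ≤ θ) (h1 : θ ≤ 1) (y : ℝ) :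
    ‖Complex.exp (-Complex.I * (y : ℂ)) - ∑ j ∈ Finset.range r, (-Complex.I * (y : ℂ)) ^ j / (j.factorial : ℂ)‖
      ≤ ((r : ℝ) + 4) * |y| ^ ((r : ℝ) - 1 + θ) := by
  have hn : ‖-Complex.I * (y : ℂ)‖ = |y| := by simp
  have hr1 : (1 : ℝ) ≤ r := by exact_mod_cast hr
  rcases le_total (|y|) 1 with hy | hy
  · have h := Complex.norm_exp_sub_sum_le_norm_mul_exp (-Complex.I * (y : ℂ)) r
    rw [hn] at h
    refine h.trans ?_
    have e1 : Real.exp |y| ≤ 3 := by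
      refine (Real.exp_le_exp.2 hy).trans ?_
      have := Real.exp_one_lt_d9
      linarith
    have e2 : |y| ^ r ≤ |y| ^ ((r : ℝ) - 1 + θ) := by
      rcases (abs_nonneg y).eq_or_lt with h0y | h0y
      · rw [← h0y, zero_pow (by omega)]
        positivity
      · rw [← Real.rpow_natCast]
        exact Real.rpow_le_rpow_of_exponent_ge h0y hy (by linarith)
    have e3 : 0 ≤ |y| ^ ((r : ℝ) - 1 + θ) := by positivity
    nlinarith [Real.exp_pos |y|, pow_nonneg (abs_nonneg y) r]
  · have e3 : ∀ j ∈ Finset.range r, ‖(-Complex.I * (y : ℂ)) ^ j / (j.factorial : ℂ)‖ ≤ |y| ^ ((r : ℝ) - 1 + θ) := by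
      intro j hj
      rw [norm_div, norm_pow, hn, Complex.norm_natCast]
      have : (1 : ℝ) ≤ j.factorial := by exact_mod_cast Nat.succ_le_of_lt (Nat.factorial_pos j)
      refine (div_le_self (by positivity) this).trans ?_
      rw [← Real.rpow_natCast]
      refine Real.rpow_le_rpow_of_exponent_le hy ?_
      have : (j : ℝ) + 1 ≤ r := by exact_mod_cast Finset.mem_range.1 hj
      linarith
    have e4 : ‖Complex.exp (-Complex.I * (y : ℂ))‖ ≤ |y| ^ ((r : ℝ) - 1 + θ) := by
      rw [show -Complex.I * (y : ℂ) = Complex.I * ((-y : ℝ) : ℂ) by push_cast; ring, Complex.norm_exp_I_mul_ofReal]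
      exact Real.one_le_rpow hy (by linarith)
    refine (norm_sub_le _ _).trans ?_
    have e5 := (norm_sum_le (Finset.range r) fun j => (-Complex.I * (y : ℂ)) ^ j / (j.factorial : ℂ)).trans
      (Finset.sum_le_sum e3)
    simp only [Finset.sum_const, Finset.card_range, nsmul_eq_mul] at e5
    have e6 : 0 ≤ |y| ^ ((r : ℝ) - 1 + θ) := by positivity
    nlinarith

lemma aux_taylor0 (y : ℝ) :
    ‖Complex.exp (-Complex.I * (y : ℂ)) - ∑ j ∈ Finset.range 0, (-Complex.I * (y : ℂ)) ^ j / (j.factorial : ℂ)‖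
      ≤ (((0 : ℕ) : ℝ) + 4) * |y| ^ (0 : ℝ) := by
  rw [show -Complex.I * (y : ℂ) = Complex.I * ((-y : ℝ) : ℂ) by push_cast; ring]
  simp only [Finset.range_zero, Finset.sum_empty, sub_zero, Complex.norm_exp_I_mul_ofReal, Real.rpow_zero]
  norm_num

lemma jb_one_le (x : ℝ) : 1 ≤ jb x := by
  unfold jb
  rw [Real.one_le_sqrt]
  nlinarith [sq_nonneg x]

lemma jb_pos (x : ℝ) : 0 < jb x := lt_of_lt_of_le one_pos (jb_one_le x)

lemma abs_le_jb (x : ℝ) : |x| ≤ jb x := by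
  unfold jb
  apply Real.abs_le_sqrt
  linarith

lemma jb_cont : Continuous jb := by
  unfold jb
  fun_prop

lemma jb_rpow_cont (κ : ℝ) : Continuous (fun x => jb x ^ κ) :=
  jb_cont.rpow_const fun x => Or.inl (jb_pos x).ne'

lemma jb_int (f : SchwartzMap ℝ ℂ) (κ : ℝ) : Integrable (fun x => jb x ^ κ * ‖f x‖) := by
  obtain ⟨N, hN⟩ := exists_nat_ge κ
  have hI : Integrable (fun x : ℝ => (2 : ℝ) ^ N * (‖x‖ ^ 0 * ‖f x‖ + ‖x‖ ^ (2 * N) * ‖f x‖)) :=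
    ((f.integrable_pow_mul volume 0).add (f.integrable_pow_mul volume (2 * N))).const_mul _
  refine hI.mono' ?_ (ae_of_all _ fun x => ?_)
  · have := f.continuous
    have := jb_rpow_cont κ
    apply Continuous.aestronglyMeasurable
    fun_prop
  · rw [norm_mul, norm_norm, Real.norm_of_nonneg (by have := jb_pos x; positivity)]
    rw [← add_mul, ← mul_assoc]
    refine mul_le_mul_of_nonneg_right ?_ (norm_nonneg _)
    have h1 : jb x ^ κ ≤ jb x ^ (2 * N) := by
      rw [← Real.rpow_natCast]
      refine Real.rpow_le_rpow_of_exponent_le (jb_one_le x) ?_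
      push_cast
      have : (0 : ℝ) ≤ N := by positivity
      linarith
    refine h1.trans ?_
    rw [pow_mul, jb, Real.sq_sqrt (by positivity), pow_zero, pow_mul, Real.norm_eq_abs, sq_abs]
    rcases le_total (x ^ 2) 1 with h | h
    · have a1 : (1 + x ^ 2) ^ N ≤ 2 ^ N := pow_le_pow_left₀ (by positivity) (by linarith) _
      have a2 : 0 ≤ (2 : ℝ) ^ N * (x ^ 2) ^ N := by positivity
      linarith
    · have a1 : (1 + x ^ 2) ^ N ≤ (2 * x ^ 2) ^ N := pow_le_pow_left₀ (by positivity) (by linarith) _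
      rw [mul_pow] at a1
      have a2 : 0 ≤ (2 : ℝ) ^ N := by positivity
      linarith

lemma aux_holder (p : ℕ) : ∃ D : ℝ, 0 ≤ D ∧ ∀ (f : SchwartzMap ℝ ℂ) (T : ℝ), 0 ≤ T →
    wnormE (p + 1) (fun x => f x) ≤ ENNReal.ofReal T →
    ∫ x, jb x ^ ((p : ℝ) + 1 / 4) * ‖f x‖ ≤ D * T := by
  set φ : ℝ → ℝ := fun x => jb x ^ (-(3 / 4) : ℝ) with hφ
  have hφc : Continuous φ := jb_rpow_cont _
  have hφm : MemLp φ 2 volume := by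
    rw [memLp_two_iff_integrable_sq hφc.aestronglyMeasurable]
    have := integrable_rpow_neg_one_add_norm_sq (E := ℝ) (μ := volume) (r := 3 / 2) (by simp; norm_num)
    refine this.congr (ae_of_all _ fun x => ?_)
    simp only [hφ, jb, Real.norm_eq_abs, sq_abs]
    have hy : (0 : ℝ) ≤ 1 + x ^ 2 := by positivity
    generalize 1 + x ^ 2 = y at hy
    rw [Real.sqrt_eq_rpow, ← Real.rpow_natCast, ← Real.rpow_mul hy, ← Real.rpow_mul hy]
    norm_num
  refine ⟨(eLpNorm φ 2 volume).toReal, ENNReal.toReal_nonneg, ?_⟩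
  intro f T hT h
  have hfc := f.continuous
  set F : ℝ → ℂ := fun x => ((jb x ^ ((p : ℝ) + 1) : ℝ) : ℂ) * f x with hF
  have hFc : Continuous F := by
    have := jb_rpow_cont ((p : ℝ) + 1)
    fun_prop
  have h1 : eLpNorm (φ • F) 1 volume ≤ eLpNorm φ 2 volume * eLpNorm F 2 volume :=
    eLpNorm_smul_le_mul_eLpNorm hFc.aestronglyMeasurable hφc.aestronglyMeasurable
  have h2 : ∀ x, jb x ^ ((p : ℝ) + 1 / 4) * ‖f x‖ = ‖(φ • F) x‖ := by
    intro x
    have := jb_pos x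
    simp only [hφ, hF, Pi.smul_apply', norm_smul, norm_mul, Complex.norm_real]
    rw [Real.norm_of_nonneg (by positivity), Real.norm_of_nonneg (by positivity), ← mul_assoc, ← Real.rpow_add this]
    congr 2
    ring
  simp_rw [h2]
  have hIntg : Integrable (φ • F) := by
    have h3 := jb_int f ((p : ℝ) + 1 / 4)
    simp_rw [h2] at h3
    exact (integrable_norm_iff ((hφc.smul hFc).aestronglyMeasurable)).1 h3
  rw [eLpNorm_one_eq_lintegral_enorm] at h1
  rw [integral_norm_eq_lintegral_enorm hIntg.aestronglyMeasurable]
  have h4 : eLpNorm φ 2 volume * eLpNorm F 2 volume ≤ ENNReal.ofReal ((eLpNorm φ 2 volume).toReal * T) := by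
    rw [ENNReal.ofReal_mul ENNReal.toReal_nonneg, ENNReal.ofReal_toReal hφm.2.ne]
    exact mul_le_mul_right h _
  exact ENNReal.toReal_le_of_le_ofReal (mul_nonneg ENNReal.toReal_nonneg hT) (h1.trans h4)

lemma aux_deriv {α : Type*} [MeasurableSpace α] (μ : Measure α) (l : α → ℝ) (H : α → ℂ)
    (hl : AEStronglyMeasurable l μ) (hH : AEStronglyMeasurable H μ)
    (hI : ∀ k : ℕ, Integrable (fun a => |l a| ^ k * ‖H a‖) μ) (k : ℕ) :
    iteratedDeriv k (fun ξ : ℝ => ∫ a, Complex.exp (-Complex.I * ((ξ * l a : ℝ) : ℂ)) * H a ∂μ) =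
      fun ξ : ℝ => ∫ a, Complex.exp (-Complex.I * ((ξ * l a : ℝ) : ℂ)) * ((-Complex.I * (l a : ℂ)) ^ k * H a) ∂μ := by
  have hlc : AEStronglyMeasurable (fun a => (l a : ℂ)) μ := Complex.continuous_ofReal.comp_aestronglyMeasurable hl
  have hm : ∀ (ξ : ℝ) (k : ℕ), AEStronglyMeasurable
      (fun a => Complex.exp (-Complex.I * ((ξ * l a : ℝ) : ℂ)) * ((-Complex.I * (l a : ℂ)) ^ k * H a)) μ := by
    intro ξ k
    refine AEStronglyMeasurable.mul ?_ (((hlc.const_mul _).pow k).mul hH)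
    have hc : Continuous fun t : ℝ => Complex.exp (-Complex.I * ((ξ * t : ℝ) : ℂ)) := by fun_prop
    exact hc.comp_aestronglyMeasurable hl
  have hnorm : ∀ (ξ : ℝ) (k : ℕ) (a : α),
      ‖Complex.exp (-Complex.I * ((ξ * l a : ℝ) : ℂ)) * ((-Complex.I * (l a : ℂ)) ^ k * H a)‖ = |l a| ^ k * ‖H a‖ := by
    intro ξ k a
    rw [show -Complex.I * ((ξ * l a : ℝ) : ℂ) = Complex.I * ((-(ξ * l a) : ℝ) : ℂ) by push_cast; ring]
    rw [norm_mul, Complex.norm_exp_I_mul_ofReal]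
    simp
  have hIntg : ∀ (ξ : ℝ) (k : ℕ), Integrable
      (fun a => Complex.exp (-Complex.I * ((ξ * l a : ℝ) : ℂ)) * ((-Complex.I * (l a : ℂ)) ^ k * H a)) μ := by
    intro ξ k
    exact (hI k).mono' (hm ξ k) (ae_of_all _ fun a => (hnorm ξ k a).le)
  induction k with
  | zero => simp
  | succ k ih =>
    rw [iteratedDeriv_succ, ih]
    funext ξ
    refine (hasDerivAt_integral_of_dominated_loc_of_deriv_le (bound := fun a => |l a| ^ (k + 1) * ‖H a‖)
      (F' := fun (ξ : ℝ) a => Complex.exp (-Complex.I * ((ξ * l a : ℝ) : ℂ)) * ((-Complex.I * (l a : ℂ)) ^ (k + 1) * H a))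
      Filter.univ_mem (Filter.Eventually.of_forall fun ξ => hm ξ k) (hIntg ξ k) (hm ξ (k + 1))
      (ae_of_all _ fun a ξ _ => (hnorm ξ (k + 1) a).le) (hI (k + 1)) (ae_of_all _ fun a ξ _ => ?_)).2.deriv
    have h1 : HasDerivAt (fun ξ : ℝ => -Complex.I * ((ξ * l a : ℝ) : ℂ)) (-Complex.I * (l a : ℂ)) ξ := by
      have := ((hasDerivAt_id ξ).mul_const (l a)).ofReal_comp.const_mul (-Complex.I)
      simpa using this
    have h2 := (h1.cexp).mul_const ((-Complex.I * (l a : ℂ)) ^ k * H a)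
    exact h2.congr_deriv (by ring)

lemma aux_deriv_norm {α : Type*} [MeasurableSpace α] (μ : Measure α) (l : α → ℝ) (H : α → ℂ)
    (hl : AEStronglyMeasurable l μ) (hH : AEStronglyMeasurable H μ)
    (hI : ∀ k : ℕ, Integrable (fun a => |l a| ^ k * ‖H a‖) μ) (k : ℕ) (ξ : ℝ) :
    ‖iteratedDeriv k (fun ξ : ℝ => ∫ a, Complex.exp (-Complex.I * ((ξ * l a : ℝ) : ℂ)) * H a ∂μ) ξ‖
      ≤ ∫ a, |l a| ^ k * ‖H a‖ ∂μ := by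
  rw [aux_deriv μ l H hl hH hI k]
  refine (norm_integral_le_integral_norm _).trans (le_of_eq ?_)
  refine integral_congr_ae (ae_of_all _ fun a => ?_)
  dsimp only
  rw [show -Complex.I * ((ξ * l a : ℝ) : ℂ) = Complex.I * ((-(ξ * l a) : ℝ) : ℂ) by push_cast; ring]
  rw [norm_mul, Complex.norm_exp_I_mul_ofReal]
  simp

def BB (n : ℕ) (w : ℝ × VV n) : ℝ := jb w.1 * ((∏ i, jb (w.2.1 i)) * ∏ i, jb (w.2.2 i))

def QQ (n : ℕ) (w : ℝ × VV n) : ℝ :=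
  2 * ∑ i, ((WL n).symm w).2.2 i * ((WL n).symm w).2.1 i

def MM (n r : ℕ) (t : ℝ) (w : ℝ × VV n) : ℂ :=
  Complex.exp (-Complex.I * ((QQ n w / (2 * t) : ℝ) : ℂ)) -
        ∑ j ∈ Finset.range r,
          (-Complex.I * ((QQ n w : ℝ) : ℂ)) ^ j /
            (((2 * t : ℝ) : ℂ) ^ j * (j.factorial : ℂ))

lemma one_le_prod_jb (n : ℕ) (b : Fin n → ℝ) : 1 ≤ ∏ i, jb (b i) := by
  have := Finset.prod_le_prod (s := Finset.univ) (f := fun _ : Fin n => (1 : ℝ)) (g := fun i => jb (b i))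
    (fun _ _ => zero_le_one) (fun i _ => jb_one_le _)
  simpa using this

lemma le_prod_jb (n : ℕ) (b : Fin n → ℝ) (i : Fin n) : jb (b i) ≤ ∏ i, jb (b i) := by
  rw [← Finset.mul_prod_erase Finset.univ (fun i => jb (b i)) (Finset.mem_univ i)]
  refine le_mul_of_one_le_right (jb_pos _).le ?_
  have := Finset.prod_le_prod (s := Finset.univ.erase i) (f := fun _ : Fin n => (1 : ℝ)) (g := fun i => jb (b i))
    (fun _ _ => zero_le_one) (fun i _ => jb_one_le _)
  simpa using this

lemma one_le_BB (n : ℕ) (w : ℝ × VV n) : 1 ≤ BB n w :=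
  one_le_mul_of_one_le_of_one_le (jb_one_le _)
    (one_le_mul_of_one_le_of_one_le (one_le_prod_jb _ _) (one_le_prod_jb _ _))

lemma abs_x_le (n : ℕ) (w : ℝ × VV n) : |w.1| ≤ BB n w := by
  refine (abs_le_jb _).trans (le_mul_of_one_le_right (jb_pos _).le ?_)
  exact (one_le_mul_of_one_le_of_one_le (one_le_prod_jb _ _) (one_le_prod_jb _ _))

lemma abs_b_le (n : ℕ) (w : ℝ × VV n) (i : Fin n) : |w.2.1 i| ≤ BB n w := by
  have h1 := one_le_prod_jb n w.2.1
  have h2 := one_le_prod_jb n w.2.2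
  refine ((abs_le_jb _).trans (le_prod_jb n w.2.1 i)).trans ?_
  refine (le_mul_of_one_le_right (by linarith) h2).trans ?_
  exact le_mul_of_one_le_left (by positivity) (jb_one_le _)

lemma abs_a_le (n : ℕ) (w : ℝ × VV n) (i : Fin n) : |w.2.2 i| ≤ BB n w := by
  have h1 := one_le_prod_jb n w.2.1
  have h2 := one_le_prod_jb n w.2.2
  refine ((abs_le_jb _).trans (le_prod_jb n w.2.2 i)).trans ?_
  refine (le_mul_of_one_le_left (by linarith) h1).trans ?_
  exact le_mul_of_one_le_left (by positivity) (jb_one_le _)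

lemma abs_sum_le_card (n : ℕ) (F : Fin n → ℝ) (B : ℝ) (h : ∀ i, |F i| ≤ B) : |∑ i, F i| ≤ n * B := by
  refine (Finset.abs_sum_le_sum_abs _ _).trans ?_
  refine (Finset.sum_le_sum fun i _ => h i).trans ?_
  simp

lemma abs_ell_le (n : ℕ) (w : ℝ × VV n) : |ell n w| ≤ (2 * n + 1) * BB n w := by
  unfold ell
  have h1 := abs_x_le n w
  have h2 := abs_sum_le_card n _ _ (abs_b_le n w)
  have h3 := abs_sum_le_card n _ _ (abs_a_le n w)
  rw [abs_le] at *
  constructor <;> linarith [h1.1, h1.2, h2.1, h2.2, h3.1, h3.2]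

lemma abs_QQ_le (n : ℕ) (w : ℝ × VV n) : |QQ n w| ≤ 8 * n * (n + 1) * BB n w ^ 2 := by
  have hB := one_le_BB n w
  have hd : ∀ i, |w.2.2 i - w.2.1 i| ≤ 2 * BB n w := by
    intro i
    have h1 := abs_a_le n w i
    have h2 := abs_b_le n w i
    rw [abs_le] at *
    constructor <;> linarith [h1.1, h1.2, h2.1, h2.2]
  have he : ∀ i, |((WL n).symm w).2.2 i| ≤ 2 * BB n w := hd
  have ho : ∀ i, |((WL n).symm w).2.1 i| ≤ (2 + 2 * n) * BB n w := by
    intro i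
    have : ((WL n).symm w).2.1 i = w.2.2 i - w.1 + (∑ k, if k < i then (w.2.2 k - w.2.1 k) else 0) := rfl
    rw [this]
    have h1 := abs_a_le n w i
    have h2 := abs_x_le n w
    have h3 := abs_sum_le_card n (fun k => if k < i then (w.2.2 k - w.2.1 k) else 0) (2 * BB n w) (by
      intro k
      split_ifs
      · exact hd k
      · simp; linarith)
    rw [abs_le] at *
    constructor <;> linarith [h1.1, h1.2, h2.1, h2.2, h3.1, h3.2]
  unfold QQ
  have h := abs_sum_le_card n (fun i => ((WL n).symm w).2.2 i * ((WL n).symm w).2.1 i)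
    ((2 * BB n w) * ((2 + 2 * n) * BB n w)) (by
      intro i
      rw [abs_mul]
      exact mul_le_mul (he i) (ho i) (abs_nonneg _) (by linarith))
  rw [abs_mul, abs_two]
  calc _ ≤ 2 * ((n : ℝ) * ((2 * BB n w) * ((2 + 2 * n) * BB n w))) := by linarith
    _ = _ := by ring

lemma norm_MM_le (n r : ℕ) (A e : ℝ) (he : 0 ≤ e) (hA : 0 ≤ A)
    (hT : ∀ y : ℝ, ‖Complex.exp (-Complex.I * (y : ℂ)) -
      ∑ j ∈ Finset.range r, (-Complex.I * (y : ℂ)) ^ j / (j.factorial : ℂ)‖ ≤ A * |y| ^ e)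
    (t : ℝ) (ht : 1 ≤ t) (w : ℝ × VV n) :
    ‖MM n r t w‖ ≤ A * (4 * n * (n + 1)) ^ e * t ^ (-e) * BB n w ^ (2 * e) := by
  have hB := one_le_BB n w
  have h1 : MM n r t w = Complex.exp (-Complex.I * ((QQ n w / (2 * t) : ℝ) : ℂ)) -
      ∑ j ∈ Finset.range r, (-Complex.I * ((QQ n w / (2 * t) : ℝ) : ℂ)) ^ j / (j.factorial : ℂ) := by
    unfold MM
    congr 1
    refine Finset.sum_congr rfl fun j _ => ?_
    have : (t : ℂ) ≠ 0 := by
      have : t ≠ 0 := by linarith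
      exact_mod_cast this
    push_cast
    rw [← mul_div_assoc, div_pow, div_div]
  rw [h1]
  refine (hT _).trans ?_
  rw [mul_assoc, mul_assoc]
  refine mul_le_mul_of_nonneg_left ?_ hA
  have h2 : |QQ n w / (2 * t)| ≤ (4 * n * (n + 1)) * (t⁻¹ * BB n w ^ 2) := by
    rw [abs_div, abs_of_pos (show 0 < 2 * t by linarith), div_le_iff₀ (by linarith)]
    refine (abs_QQ_le n w).trans (le_of_eq ?_)
    have : t ≠ 0 := by linarith
    field_simp
    ring
  refine (Real.rpow_le_rpow (abs_nonneg _) h2 he).trans (le_of_eq ?_)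
  have ht0 : 0 < t := by linarith
  rw [Real.mul_rpow (x := 4 * (n:ℝ) * (n+1)) (y := t⁻¹ * BB n w ^ 2) (by positivity) (by positivity),
    Real.mul_rpow (x := t⁻¹) (y := BB n w ^ 2) (by positivity) (by positivity),
    Real.inv_rpow ht0.le, Real.rpow_neg ht0.le, Real.rpow_mul (by linarith), Real.rpow_two]

lemma BB_FF (n : ℕ) (f : SchwartzMap ℝ ℂ) (κ : ℝ) (w : ℝ × VV n) :
    BB n w ^ κ * ‖FF n f w‖ = (jb w.1 ^ κ * ‖f w.1‖) *
      ((∏ i, (jb (w.2.1 i) ^ κ * ‖f (w.2.1 i)‖)) * ∏ i, (jb (w.2.2 i) ^ κ * ‖f (w.2.2 i)‖)) := by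
  have h1 := one_le_prod_jb n w.2.1
  have h2 := one_le_prod_jb n w.2.2
  unfold BB FF
  rw [Real.mul_rpow (jb_pos _).le (by positivity), Real.mul_rpow (by linarith) (by linarith),
    ← Real.finsetProd_rpow _ _ (fun i _ => (jb_pos _).le), ← Real.finsetProd_rpow _ _ (fun i _ => (jb_pos _).le),
    Finset.prod_mul_distrib, Finset.prod_mul_distrib, norm_mul, norm_mul, norm_prod, norm_prod]
  simp only [RCLike.norm_conj]
  ring

lemma BB_FF_int (n : ℕ) (f : SchwartzMap ℝ ℂ) (κ : ℝ) :
    Integrable (fun w : ℝ × VV n => BB n w ^ κ * ‖FF n f w‖) := by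
  simp_rw [BB_FF]
  have h := jb_int f κ
  have hp := Integrable.fintype_prod (ι := Fin n) (μ := fun _ => volume) (fun _ => h)
  exact h.mul_prod (hp.mul_prod hp)

lemma BB_FF_integral (n : ℕ) (f : SchwartzMap ℝ ℂ) (κ : ℝ) :
    ∫ w : ℝ × VV n, BB n w ^ κ * ‖FF n f w‖ = (∫ x, jb x ^ κ * ‖f x‖) ^ (2 * n + 1) := by
  simp_rw [BB_FF]
  rw [Measure.volume_eq_prod]
  rw [integral_prod_mul (μ := (volume : Measure ℝ)) (ν := (volume : Measure (VV n)))
    (fun x => jb x ^ κ * ‖f x‖)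
    (fun v : VV n => (∏ i, (jb (v.1 i) ^ κ * ‖f (v.1 i)‖)) * ∏ i, (jb (v.2 i) ^ κ * ‖f (v.2 i)‖))]
  rw [Measure.volume_eq_prod (Fin n → ℝ)]
  rw [integral_prod_mul (μ := (volume : Measure (Fin n → ℝ))) (ν := (volume : Measure (Fin n → ℝ)))
    (fun v => (∏ i, (jb (v i) ^ κ * ‖f (v i)‖))) (fun v => (∏ i, (jb (v i) ^ κ * ‖f (v i)‖)))]
  rw [integral_fintype_prod_volume_eq_prod (ι := Fin n) (E := fun _ => ℝ)
    (fun i x => jb x ^ κ * ‖f x‖)]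
  simp only [Finset.prod_const, Finset.card_univ, Fintype.card_fin]
  ring

lemma FF_cont (n : ℕ) (f : SchwartzMap ℝ ℂ) : Continuous (FF n f) := by
  have := f.continuous
  have := Complex.continuous_conj
  unfold FF
  fun_prop

lemma ell_cont (n : ℕ) : Continuous (ell n) := by
  unfold ell
  fun_prop

lemma QQ_cont (n : ℕ) : Continuous (QQ n) := by
  have : Continuous (fun w => (WL n).symm w) := (WL n).symm.toContinuousLinearEquiv.continuous
  unfold QQ
  fun_prop

lemma MM_cont (n r : ℕ) (t : ℝ) : Continuous (MM n r t) := by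
  have := QQ_cont n
  unfold MM
  simp only [div_eq_mul_inv]
  fun_prop

lemma aux_dom (n r : ℕ) (A e : ℝ) (he : 0 ≤ e) (hA : 0 ≤ A)
    (hT : ∀ y : ℝ, ‖Complex.exp (-Complex.I * (y : ℂ)) -
      ∑ j ∈ Finset.range r, (-Complex.I * (y : ℂ)) ^ j / (j.factorial : ℂ)‖ ≤ A * |y| ^ e)
    (t : ℝ) (ht : 1 ≤ t) (f : SchwartzMap ℝ ℂ) (k : ℕ) (κ : ℝ) (hκ : 2 * e + k ≤ κ) (w : ℝ × VV n) :
    |ell n w| ^ k * ‖MM n r t w * FF n f w‖ ≤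
      ((2 * n + 1) ^ k * (A * (4 * n * (n + 1)) ^ e) * t ^ (-e)) * (BB n w ^ κ * ‖FF n f w‖) := by
  have hB := one_le_BB n w
  have ht0 : 0 < t := by linarith
  rw [norm_mul, ← mul_assoc, ← mul_assoc]
  refine mul_le_mul_of_nonneg_right ?_ (norm_nonneg _)
  have h1 : |ell n w| ^ k ≤ (2 * n + 1) ^ k * BB n w ^ (k : ℝ) := by
    rw [Real.rpow_natCast, ← mul_pow]
    exact pow_le_pow_left₀ (abs_nonneg _) (abs_ell_le n w) k
  have h2 := norm_MM_le n r A e he hA hT t ht w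
  have h3 : BB n w ^ (k : ℝ) * BB n w ^ (2 * e) ≤ BB n w ^ κ := by
    rw [← Real.rpow_add (by linarith)]
    exact Real.rpow_le_rpow_of_exponent_le hB (by linarith)
  calc |ell n w| ^ k * ‖MM n r t w‖
      ≤ ((2 * n + 1) ^ k * BB n w ^ (k : ℝ)) * (A * (4 * n * (n + 1)) ^ e * t ^ (-e) * BB n w ^ (2 * e)) :=
        mul_le_mul h1 h2 (norm_nonneg _) (by positivity)
    _ = ((2 * n + 1) ^ k * (A * (4 * n * (n + 1)) ^ e) * t ^ (-e)) * (BB n w ^ (k : ℝ) * BB n w ^ (2 * e)) := by ring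
    _ ≤ _ := mul_le_mul_of_nonneg_left h3 (by positivity)

lemma aux_dom_int (n r : ℕ) (A e : ℝ) (he : 0 ≤ e) (hA : 0 ≤ A)
    (hT : ∀ y : ℝ, ‖Complex.exp (-Complex.I * (y : ℂ)) -
      ∑ j ∈ Finset.range r, (-Complex.I * (y : ℂ)) ^ j / (j.factorial : ℂ)‖ ≤ A * |y| ^ e)
    (t : ℝ) (ht : 1 ≤ t) (f : SchwartzMap ℝ ℂ) (k : ℕ) :
    Integrable (fun w : ℝ × VV n => |ell n w| ^ k * ‖MM n r t w * FF n f w‖) := by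
  refine ((BB_FF_int n f (2 * e + k)).const_mul
    ((2 * n + 1) ^ k * (A * (4 * n * (n + 1)) ^ e) * t ^ (-e))).mono' ?_ (ae_of_all _ fun w => ?_)
  · have := ell_cont n
    have := MM_cont n r t
    have := FF_cont n f
    apply Continuous.aestronglyMeasurable
    fun_prop
  · rw [Real.norm_of_nonneg (by positivity)]
    exact aux_dom n r A e he hA hT t ht f k _ le_rfl w

lemma aux_Rrem (n : ℕ) (hn : 1 ≤ n) : ∃ c : ℝ, ∀ (r : ℕ) (A e : ℝ), 0 ≤ e → 0 ≤ A →
    (∀ y : ℝ, ‖Complex.exp (-Complex.I * (y : ℂ)) -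
      ∑ j ∈ Finset.range r, (-Complex.I * (y : ℂ)) ^ j / (j.factorial : ℂ)‖ ≤ A * |y| ^ e) →
    ∀ (f : SchwartzMap ℝ ℂ) (t : ℝ), 1 ≤ t → ∀ ξ : ℝ,
    Rrem n (FT (fun x => f x)) r t ξ = ((c * (t ^ n)⁻¹ : ℝ) : ℂ) *
      ∫ w : ℝ × VV n, Complex.exp (-Complex.I * ((ξ * ell n w : ℝ) : ℂ)) * (MM n r t w * FF n f w) := by
  obtain ⟨c1, hc1⟩ := aux_inv n hn
  have hE : (volume : Measure ((Fin (2 * n) → ℝ) × ℝ)).IsAddHaarMeasure :=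
    Measure.prod.instIsAddHaarMeasure volume volume
  obtain ⟨c2, -, hc2, hci⟩ := aux_lin_change hE (aux_haar_W n)
    (((LinearEquiv.prodComm ℝ (Fin (2 * n) → ℝ) ℝ).trans
      ((LinearEquiv.refl ℝ ℝ).prodCongr (splitL n))).trans (WL n)).toContinuousLinearEquiv
  set L := (((LinearEquiv.prodComm ℝ (Fin (2 * n) → ℝ) ℝ).trans
      ((LinearEquiv.refl ℝ ℝ).prodCongr (splitL n))).trans (WL n)).toContinuousLinearEquiv with hL
  have hLa : ∀ σ x, L (σ, x) = WL n (x, splitL n σ) := fun σ x => rfl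
  refine ⟨((2 * Real.pi) ^ n)⁻¹ * c1 * c2, ?_⟩
  intro r A e he hA hT f t ht ξ
  obtain ⟨G, hG⟩ : ∃ G : (ℝ × VV n) → ℂ, G = fun w => 
    Complex.exp (-Complex.I * ((ξ * ell n w : ℝ) : ℂ)) * (MM n r t w * FF n f w) := ⟨_, rfl⟩
  have hGi : Integrable G := by
    have h := aux_dom_int n r A e he hA hT t ht f 0
    have h1 := ell_cont n
    have h2 := MM_cont n r t
    have h3 := FF_cont n f
    refine h.mono' ?_ (ae_of_all _ fun w => ?_)
    · rw [hG]
      apply Continuous.aestronglyMeasurable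
      fun_prop
    · rw [hG]
      dsimp only
      rw [show -Complex.I * ((ξ * ell n w : ℝ) : ℂ) = Complex.I * ((-(ξ * ell n w) : ℝ) : ℂ) by push_cast; ring]
      rw [norm_mul, Complex.norm_exp_I_mul_ofReal]
      simp
  have hQ : ∀ σ x, Qform n σ = QQ n (L (σ, x)) := by
    intro σ x
    rw [hLa]
    unfold Qform QQ
    rw [LinearEquiv.symm_apply_apply, aux_Psi]
  unfold Rrem
  simp_rw [hc1]
  have h1 : ∀ σ : Fin (2 * n) → ℝ, (Complex.exp (-Complex.I * ((Qform n σ / (2 * t) : ℝ) : ℂ)) -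
        ∑ j ∈ Finset.range r,
          (-Complex.I * ((Qform n σ : ℝ) : ℂ)) ^ j /
            (((2 * t : ℝ) : ℂ) ^ j * (j.factorial : ℂ))) *
      ((c1 : ℂ) * ∫ x : ℝ, Complex.exp (-Complex.I * ((ξ * ell n (WL n (x, splitL n σ)) : ℝ) : ℂ)) *
        FF n f (WL n (x, splitL n σ))) = (c1 : ℂ) * ∫ x : ℝ, G (L (σ, x)) := by
    intro σ
    rw [mul_left_comm, ← integral_const_mul]
    congr 1
    refine integral_congr_ae (ae_of_all _ fun x => ?_)
    dsimp only
    rw [hQ σ x, hG, hLa]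
    unfold MM
    ring
  rw [integral_congr_ae (ae_of_all _ h1), integral_const_mul]
  have h2 : ∫ σ : Fin (2 * n) → ℝ, ∫ x : ℝ, G (L (σ, x)) = ∫ z : (Fin (2 * n) → ℝ) × ℝ, G (L z) :=
    (integral_prod (μ := (volume : Measure (Fin (2 * n) → ℝ))) (ν := (volume : Measure ℝ))
      (fun z => G (L z)) (hci G hGi)).symm
  rw [h2, hc2, ← hG]
  push_cast
  ring

lemma aux_core (n p q r : ℕ) (hn : 1 ≤ n) (A e : ℝ) (he : 0 ≤ e) (hA : 0 ≤ A)
    (hT : ∀ y : ℝ, ‖Complex.exp (-Complex.I * (y : ℂ)) -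
      ∑ j ∈ Finset.range r, (-Complex.I * (y : ℂ)) ^ j / (j.factorial : ℂ)‖ ≤ A * |y| ^ e)
    (hκ : 2 * e + q ≤ (p : ℝ) + 1 / 4) :
    ∃ K : ℝ, ∀ (f : SchwartzMap ℝ ℂ) (t T : ℝ), 1 ≤ t → 0 ≤ T →
      wnormE (p + 1) (fun x => f x) ≤ ENNReal.ofReal T →
      WqNormE q (fun ξ => Rrem n (FT (fun x => f x)) r t ξ) ≤
        ENNReal.ofReal (K * ((t ^ n)⁻¹ * t ^ (-e) * T ^ (2 * n + 1))) := by
  obtain ⟨c, hc⟩ := aux_Rrem n hn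
  obtain ⟨D, hD0, hD⟩ := aux_holder p
  refine ⟨(q + 1) * (|c| * ((2 * n + 1) ^ q * (A * (4 * n * (n + 1)) ^ e)) * D ^ (2 * n + 1)), ?_⟩
  intro f t T ht hT0 hw
  have ht0 : 0 < t := by linarith
  set Y : ℝ := (|c| * ((2 * n + 1) ^ q * (A * (4 * n * (n + 1)) ^ e)) * D ^ (2 * n + 1)) *
    ((t ^ n)⁻¹ * t ^ (-e) * T ^ (2 * n + 1)) with hY
  have hJ := hD f T hT0 hw
  have hmain : ∀ j ∈ Finset.range (q + 1),
      eLpNorm (iteratedDeriv j (fun ξ => Rrem n (FT (fun x => f x)) r t ξ)) ⊤ volume ≤ ENNReal.ofReal Y := by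
    intro j hj
    have hjq : j ≤ q := Nat.lt_succ_iff.1 (Finset.mem_range.1 hj)
    rw [eLpNorm_exponent_top]
    refine eLpNormEssSup_le_of_ae_bound (ae_of_all _ fun ξ => ?_)
    rw [funext (hc r A e he hA hT f t ht)]
    rw [iteratedDeriv_const_mul_field, norm_mul]
    have h1 := aux_deriv_norm volume (ell n) (fun w => MM n r t w * FF n f w)
      (ell_cont n).aestronglyMeasurable ((MM_cont n r t).mul (FF_cont n f)).aestronglyMeasurable
      (aux_dom_int n r A e he hA hT t ht f) j ξ
    have hjκ : 2 * e + j ≤ (p : ℝ) + 1 / 4 := by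
      have : (j : ℝ) ≤ q := by exact_mod_cast hjq
      linarith
    have h2 : ∫ w : ℝ × VV n, |ell n w| ^ j * ‖MM n r t w * FF n f w‖ ≤
        ((2 * n + 1) ^ j * (A * (4 * n * (n + 1)) ^ e) * t ^ (-e)) * (D * T) ^ (2 * n + 1) := by
      refine (integral_mono (aux_dom_int n r A e he hA hT t ht f j)
        ((BB_FF_int n f ((p : ℝ) + 1 / 4)).const_mul _)
        (fun w => aux_dom n r A e he hA hT t ht f j _ hjκ w)).trans ?_
      rw [integral_const_mul, BB_FF_integral]
      refine mul_le_mul_of_nonneg_left (pow_le_pow_left₀ ?_ hJ _) (by positivity)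
      exact integral_nonneg fun x => by have := jb_pos x; positivity
    have h3 : ((2 : ℝ) * n + 1) ^ j ≤ (2 * n + 1) ^ q :=
      pow_le_pow_right₀ (by have : (0 : ℝ) ≤ n := by positivity
                            linarith) hjq
    have h4 : ‖((c * (t ^ n)⁻¹ : ℝ) : ℂ)‖ = |c| * (t ^ n)⁻¹ := by
      rw [Complex.norm_real, Real.norm_eq_abs, abs_mul, abs_of_pos (show 0 < (t ^ n)⁻¹ by positivity)]
    rw [h4]
    calc _ ≤ |c| * (t ^ n)⁻¹ * (((2 * n + 1) ^ j * (A * (4 * n * (n + 1)) ^ e) * t ^ (-e)) * (D * T) ^ (2 * n + 1)) :=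
          mul_le_mul_of_nonneg_left (h1.trans h2) (by positivity)
      _ ≤ |c| * (t ^ n)⁻¹ * (((2 * n + 1) ^ q * (A * (4 * n * (n + 1)) ^ e) * t ^ (-e)) * (D * T) ^ (2 * n + 1)) := by
          gcongr
      _ = Y := by rw [hY, mul_pow]; ring
  unfold WqNormE
  refine (Finset.sum_le_sum hmain).trans ?_
  rw [Finset.sum_const, Finset.card_range, nsmul_eq_mul, ← ENNReal.ofReal_natCast,
    ← ENNReal.ofReal_mul (by positivity)]
  refine ENNReal.ofReal_le_ofReal (le_of_eq ?_)
  rw [hY]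
  push_cast
  ring

lemma aux_final (n p q r : ℕ) (hn : 1 ≤ n) (A e α δ : ℝ) (he : 0 ≤ e) (hA : 0 ≤ A)
    (hT : ∀ y : ℝ, ‖Complex.exp (-Complex.I * (y : ℂ)) -
      ∑ j ∈ Finset.range r, (-Complex.I * (y : ℂ)) ^ j / (j.factorial : ℂ)‖ ≤ A * |y| ^ e)
    (hκ : 2 * e + q ≤ (p : ℝ) + 1 / 4) (hδ : -e + (2 * n + 1) * α = -(r : ℝ) + 1 - δ) :
    ∃ K : ℝ, ∀ f : ℝ → SchwartzMap ℝ ℂ, ∀ C : ℝ, 0 < C →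
        (∀ t : ℝ, 1 ≤ t →
          ENNReal.ofReal (t ^ (-α)) * wnormE (p + 1) (fun x => f t x) ≤ ENNReal.ofReal C) →
        ∀ s : ℝ, 1 ≤ s →
          WqNormE q (fun ξ => Rrem n (FT (fun x => f s x)) r s ξ) ≤
            ENNReal.ofReal (K * s ^ (-(n : ℝ) - (r : ℝ) + 1 - δ) * C ^ (2 * n + 1)) := by
  obtain ⟨K, hK⟩ := aux_core n p q r hn A e he hA hT hκ
  refine ⟨K, fun f C hC hf s hs => ?_⟩
  have hs0 : 0 < s := by linarith
  have hw : wnormE (p + 1) (fun x => f s x) ≤ ENNReal.ofReal (s ^ α * C) := by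
    have h := hf s hs
    have h1 : ENNReal.ofReal (s ^ α) * (ENNReal.ofReal (s ^ (-α)) * wnormE (p + 1) (fun x => f s x)) =
        wnormE (p + 1) (fun x => f s x) := by
      rw [← mul_assoc, ← ENNReal.ofReal_mul (by positivity), ← Real.rpow_add hs0]
      simp
    rw [← h1, ENNReal.ofReal_mul (by positivity)]
    exact mul_le_mul_right h _
  refine (hK (f s) s (s ^ α * C) hs (by positivity) hw).trans (ENNReal.ofReal_le_ofReal (le_of_eq ?_))
  have h2 : (s ^ n)⁻¹ * s ^ (-e) * (s ^ α) ^ (2 * n + 1) = s ^ (-(n : ℝ) - (r : ℝ) + 1 - δ) := by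
    rw [← Real.rpow_natCast s n, ← Real.rpow_neg hs0.le, ← Real.rpow_natCast, ← Real.rpow_mul hs0.le,
      ← Real.rpow_add hs0, ← Real.rpow_add hs0]
    congr 1
    push_cast
    linarith
  rw [← h2, mul_pow]
  ring

/-- the main estimate on the stationary-phase error terms `Rⁿ_r`.
The constants `δ` and `K` depend only on `n, p, q, r` and `α`. -/
theorem statement6 (d n p : ℕ) (hd : 1 ≤ d) (hn1 : 1 ≤ n) (hnd : n ≤ d)
    (α : ℝ) (hα0 : 0 < α) (hα1 : α < 1 / (16 * d + 8))
    (r q : ℕ) (hrq : (0 < r ∧ 2 * r + q = p + 2) ∨ (r = 0 ∧ q = p)) :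
    ∃ δ : ℝ, 0 < δ ∧ δ < 1 ∧ ∃ K : ℝ,
      ∀ f : ℝ → SchwartzMap ℝ ℂ, ∀ C : ℝ, 0 < C →
        (∀ t : ℝ, 1 ≤ t →
          ENNReal.ofReal (t ^ (-α)) * wnormE (p + 1) (fun x => f t x) ≤ ENNReal.ofReal C) →
        ∀ s : ℝ, 1 ≤ s →
          WqNormE q (fun ξ => Rrem n (FT (fun x => f s x)) r s ξ) ≤
            ENNReal.ofReal (K * s ^ (-(n : ℝ) - (r : ℝ) + 1 - δ) * C ^ (2 * n + 1)) := by
  have hα2 : (2 * (n : ℝ) + 1) * α < 1 / 8 := by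
    have hnd' : (n : ℝ) ≤ d := by exact_mod_cast hnd
    have hd' : (0 : ℝ) < 16 * d + 8 := by positivity
    rw [lt_div_iff₀ hd'] at hα1
    nlinarith
  have hα3 : 0 < (2 * (n : ℝ) + 1) * α := by positivity
  rcases hrq with ⟨hr, hrq⟩ | ⟨rfl, rfl⟩
  · have hr1 : (1 : ℝ) ≤ r := by exact_mod_cast hr
    have hrq' : 2 * (r : ℝ) + q = p + 2 := by exact_mod_cast hrq
    refine ⟨1 / 8 - (2 * (n : ℝ) + 1) * α, by linarith, by linarith, ?_⟩
    exact aux_final n p q r hn1 (r + 4) ((r : ℝ) - 1 + 1 / 8) α _ (by linarith) (by positivity)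
      (aux_taylor r hr (1 / 8) (by norm_num) (by norm_num)) (by linarith) (by ring)
  · refine ⟨1 - (2 * (n : ℝ) + 1) * α, by linarith, by linarith, ?_⟩
    exact aux_final n q q 0 hn1 (((0 : ℕ) : ℝ) + 4) 0 α _ le_rfl (by positivity)
      aux_taylor0 (by linarith) (by push_cast; ring)
end
end
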